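/- arXiv:2310.03868 — 5 statements merged into one kernel-verified Lean document; each statement's English description precedes it below -/
import Mathlib

section
/- A finitely generated commutative (not necessarily unital) ring is finitely separable if and only if each of its subrings generated by two elements is finitely separable. -/
/-- `nupow a n` represents the power `a ^ (n + 1)` in a (possibly non-unital) multiplicative
structure. -/
def nupow {K : Type*} [Mul K] (a : K) : ℕ → K
  | 0 => a
  | n + 1 => nupow a n * a

/-- Evaluation at `a ∈ K` of a one-variable polynomial over `ZMod p` with zero constant term;
coefficients act through their natural-number representatives (`ZMod.val`), which is the
natural action on a ring of characteristic `p`. -/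
noncomputable def pEval {p : ℕ} {K : Type*} [NonUnitalNonAssocRing K]
    (f : Polynomial (ZMod p)) (a : K) : K :=
  ∑ i ∈ f.support, (f.coeff i).val • (if i = 0 then 0 else nupow a (i - 1))

/-- Evaluation of the monomial `x ^ m 0 * y ^ m 1` at `(a, b)` (zero if `m = 0`). -/
noncomputable def monEval {K : Type*} [Mul K] [Zero K] (a b : K) (m : Fin 2 →₀ ℕ) : K :=
  if m 0 = 0 then (if m 1 = 0 then 0 else nupow b (m 1 - 1))
  else (if m 1 = 0 then nupow a (m 0 - 1) else nupow a (m 0 - 1) * nupow b (m 1 - 1))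

/-- Evaluation at `(a, b) ∈ K × K` of a two-variable polynomial over `ZMod p` with zero
constant term. -/
noncomputable def mvEval {p : ℕ} {K : Type*} [NonUnitalNonAssocRing K]
    (a b : K) (f : MvPolynomial (Fin 2) (ZMod p)) : K :=
  ∑ m ∈ f.support, (MvPolynomial.coeff m f).val • monEval a b m

/-- An element `a` of a ring of characteristic `p` is integral (algebraic over `Z_p`) if it is a
root of some nonzero polynomial over `Z_p` with zero constant term. -/
noncomputable def IsAlgebraicElt (p : ℕ) {K : Type*} [NonUnitalNonAssocRing K] (a : K) : Prop :=
  ∃ f : Polynomial (ZMod p), f ≠ 0 ∧ f.coeff 0 = 0 ∧ pEval f a = 0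

/-- An element is transcendental if it is not a root of any nonzero polynomial over `Z_p`
with zero constant term. -/
noncomputable def IsTranscendentalElt (p : ℕ) {K : Type*} [NonUnitalNonAssocRing K]
    (a : K) : Prop :=
  ∀ f : Polynomial (ZMod p), f ≠ 0 → f.coeff 0 = 0 → pEval f a ≠ 0

/-- A two-variable polynomial over `Z_p` is monic in the variable `i` if, viewed as a polynomial
in the variable `i`, its leading coefficient is `1`. -/
def MonicInVar {p : ℕ} (f : MvPolynomial (Fin 2) (ZMod p)) (i : Fin 2) : Prop :=
  MvPolynomial.coeff (Finsupp.single i (f.degreeOf i)) f = 1 ∧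
    ∀ m ∈ f.support, m i = f.degreeOf i → m = Finsupp.single i (f.degreeOf i)

/-- Two elements `a, b` of a ring of prime characteristic `p` are integrally dependent if
`f (a, b) = 0` for some polynomial `f ∈ Z_p[x, y]` with zero constant term that is monic as a
polynomial in `x` and monic as a polynomial in `y`. -/
noncomputable def IntegrallyDependent (p : ℕ) {K : Type*} [NonUnitalNonAssocRing K]
    (a b : K) : Prop :=
  ∃ f : MvPolynomial (Fin 2) (ZMod p), MvPolynomial.constantCoeff f = 0 ∧
    MonicInVar f 0 ∧ MonicInVar f 1 ∧ mvEval a b f = 0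

/-- A (not necessarily unital) ring `K` is finitely separable if every element `a ∉ A`, where
`A` is a (not necessarily unital) subring, can be separated from `A` by a homomorphism to a
finite ring. -/
def FinitelySeparable (K : Type*) [NonUnitalNonAssocRing K] : Prop :=
  ∀ (a : K) (A : NonUnitalSubring K), a ∉ A →
    ∃ (F : Type) (_ : NonUnitalRing F) (_ : Finite F) (φ : K →ₙ+* F),
      φ a ∉ φ '' (A : Set K)

/-- The `k`-torsion ideal `I_k = {a ∈ K : k • a = 0}` of `K`, as an additive subgroup. -/
def torsionAddSubgroup (K : Type*) [NonUnitalNonAssocRing K] (k : ℕ) : AddSubgroup K where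
  carrier := {a | k • a = 0}
  add_mem' := by
    intro a b ha hb
    simp only [Set.mem_setOf_eq, smul_add] at *
    rw [ha, hb, add_zero]
  zero_mem' := by simp
  neg_mem' := by
    intro a ha
    simp only [Set.mem_setOf_eq, smul_neg] at *
    rw [ha, neg_zero]

/-- The `k`-torsion ideal `I_k = {a ∈ K : k • a = 0}` of a commutative ring `K`, as a
non-unital subring (it is in fact an ideal). -/
def torsionSubring (K : Type*) [NonUnitalCommRing K] (k : ℕ) : NonUnitalSubring K where
  carrier := {a | k • a = 0}
  add_mem' := by
    intro a b ha hb
    simp only [Set.mem_setOf_eq, smul_add] at *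
    rw [ha, hb, add_zero]
  zero_mem' := by simp
  neg_mem' := by
    intro a ha
    simp only [Set.mem_setOf_eq, smul_neg] at *
    rw [ha, neg_zero]
  mul_mem' := by
    intro a b ha hb
    simp only [Set.mem_setOf_eq] at *
    rw [← smul_mul_assoc, ha, zero_mul]

namespace FinitelySeparable

variable {K K' : Type*} [NonUnitalCommRing K] [NonUnitalCommRing K']

theorem exists_small_target {K : Type*} [NonUnitalNonAssocRing K] {a : K} {A : NonUnitalSubring K}
    {F : Type*} [NonUnitalRing F] [Finite F] (φ : K →ₙ+* F) (h : ∀ y ∈ A, φ a ≠ φ y) :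
    ∃ (F : Type) (_ : NonUnitalRing F) (_ : Finite F) (φ : K →ₙ+* F),
      φ a ∉ φ '' (A : Set K) := by
  have : Small.{0} F := Countable.toSmall F
  refine ⟨Shrink.{0} F, inferInstance, .of_equiv F (equivShrink F),
    ((Shrink.ringEquiv F).symm : F →ₙ+* Shrink.{0} F).comp φ, ?_⟩
  rintro ⟨y, hy, hya⟩
  exact h y hy ((Shrink.ringEquiv F).symm.injective hya).symm

theorem of_injective (f : K →ₙ+* K') (hf : Function.Injective f) (h : FinitelySeparable K') :
    FinitelySeparable K := by
  intro a A ha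
  obtain ⟨F, _, _, φ, hφ⟩ := h (f a) (A.map f) (by
    rintro ⟨y, hy, hya⟩
    exact ha (hf hya ▸ hy))
  refine ⟨F, _, ‹_›, φ.comp f, ?_⟩
  rintro ⟨y, hy, hya⟩
  exact hφ ⟨f y, ⟨y, hy, rfl⟩, hya⟩

theorem of_surjective (f : K →ₙ+* K') (hf : Function.Surjective f) (h : FinitelySeparable K) :
    FinitelySeparable K' := by
  intro a A ha
  obtain ⟨a, rfl⟩ := hf a
  obtain ⟨F, _, _, φ, hφ⟩ := h a (A.comap f) ha
  let J : TwoSidedIdeal K' := TwoSidedIdeal.mk' {y | ∃ x, f x = y ∧ φ x = 0}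
    ⟨0, by simp⟩
    (by rintro _ _ ⟨x, rfl, hx⟩ ⟨y, rfl, hy⟩; exact ⟨x + y, by simp, by simp [hx, hy]⟩)
    (by rintro _ ⟨x, rfl, hx⟩; exact ⟨-x, by simp, by simp [hx]⟩)
    (by
      rintro y _ ⟨x, rfl, hx⟩
      obtain ⟨y, rfl⟩ := hf y
      exact ⟨y * x, by simp, by simp [hx]⟩)
    (by
      rintro _ y ⟨x, rfl, hx⟩
      obtain ⟨y, rfl⟩ := hf y
      exact ⟨x * y, by simp, by simp [hx]⟩)
  have hJ (x y : K') : J.ringCon x y ↔ ∃ z, f z = x - y ∧ φ z = 0 := Iff.rfl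
  have : Finite J.ringCon.Quotient := by
    have key (x : Set.range φ) (z : K) (hz : φ z = x) :
        ((f x.2.choose : K') : J.ringCon.Quotient) = ((f z : K') : J.ringCon.Quotient) :=
      J.ringCon.eq.mpr ((hJ _ _).mpr ⟨x.2.choose - z, by simp, by
        rw [map_sub, x.2.choose_spec, hz, sub_self]⟩)
    refine Finite.of_surjective
      (fun x : Set.range φ ↦ ((f x.2.choose : K') : J.ringCon.Quotient)) fun y ↦ ?_
    obtain ⟨y, rfl⟩ := Quotient.mk_surjective y
    obtain ⟨z, rfl⟩ := hf y
    exact ⟨⟨φ z, z, rfl⟩, key _ z rfl⟩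
  let π : K' →ₙ+* J.ringCon.Quotient :=
    { toFun := fun x ↦ (x : J.ringCon.Quotient), map_mul' := fun _ _ ↦ rfl, map_zero' := rfl,
      map_add' := fun _ _ ↦ rfl }
  refine exists_small_target π fun y hy hya ↦ ?_
  obtain ⟨z, hz, hz'⟩ := (hJ _ _).mp (J.ringCon.eq.mp hya)
  refine hφ ⟨a - z, ?_, by simp [hz']⟩
  change f (a - z) ∈ A
  rwa [map_sub, hz, sub_sub_cancel]

theorem map {S : NonUnitalSubring K} (h : FinitelySeparable S) (f : K →ₙ+* K') :
    FinitelySeparable (S.map f) :=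
  of_surjective (NonUnitalRingHom.codRestrict (f.comp (NonUnitalSubringClass.subtype S)) (S.map f)
    fun x ↦ ⟨x, x.2, rfl⟩)
    (by rintro ⟨_, x, hx, rfl⟩; exact ⟨⟨x, hx⟩, rfl⟩) h

theorem of_map {S : NonUnitalSubring K} (f : K →ₙ+* K') (hf : Function.Injective f)
    (h : FinitelySeparable (S.map f)) : FinitelySeparable S :=
  of_injective (NonUnitalRingHom.codRestrict (f.comp (NonUnitalSubringClass.subtype S)) (S.map f)
    fun x ↦ ⟨x, x.2, rfl⟩)
    (fun _ _ hxy ↦ Subtype.ext (hf congr(($hxy).1))) h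

theorem mono {S T : NonUnitalSubring K} (hST : S ≤ T) (h : FinitelySeparable T) :
    FinitelySeparable S :=
  of_injective (NonUnitalSubring.inclusion hST) (fun _ _ hxy ↦ Subtype.ext congr(($hxy).1)) h

end FinitelySeparable

namespace Valuation

open Polynomial

variable {L B Γ : Type*} [Field L] [CommRing B] [Algebra B L]
  [LinearOrderedCommGroupWithZero Γ] (v : Valuation L Γ)

theorem exists_map_coeff_mul_pow_eq [FaithfulSMul B L] {z : L} (hz : z ≠ 0) {p : B[X]} (hp : p ≠ 0)
    (hpz : aeval z p = 0) :
    ∃ i j, i < j ∧ p.coeff i ≠ 0 ∧ p.coeff j ≠ 0 ∧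
      v (algebraMap B L (p.coeff i) * z ^ i) = v (algebraMap B L (p.coeff j) * z ^ j) := by
  classical
  have hnz (i) (hi : i ∈ p.support) : algebraMap B L (p.coeff i) * z ^ i ≠ 0 :=
    mul_ne_zero (by simpa using hi) (pow_ne_zero _ hz)
  by_contra! H
  obtain ⟨j, hj, hmax⟩ := p.support.exists_max_image
    (fun i ↦ v (algebraMap B L (p.coeff i) * z ^ i)) (support_nonempty.mpr hp)
  refine (v.ne_zero_iff.mpr (hnz j hj)) ?_
  rw [← v.map_sum_eq_of_lt (f := fun i ↦ algebraMap B L (p.coeff i) * z ^ i) hj, ← v.map_zero,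
    ← hpz, aeval_def, eval₂_eq_sum]
  · rfl
  · intro i hi
    obtain ⟨hi, hij⟩ : i ∈ p.support ∧ i ≠ j := by simpa using hi
    refine (hmax i hi).lt_of_ne fun heq ↦ ?_
    rcases hij.lt_or_gt with h | h
    · exact H i j h (by simpa using hi) (by simpa using hj) heq
    · exact H j i h (by simpa using hj) (by simpa using hi) heq.symm


theorem exists_uniformizer [IsDomain B] [IsPrincipalIdealRing B]
    (hv : ∀ f : B, v (algebraMap B L f) ≤ 1)
    (hnt : ∃ f : B, f ≠ 0 ∧ v (algebraMap B L f) < 1) :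
    ∃ π : B, Prime π ∧ (∀ f, v (algebraMap B L f) < 1 ↔ π ∣ f) ∧
      ∀ f, f ≠ 0 → ∃ k : ℕ, v (algebraMap B L f) = v (algebraMap B L π) ^ k := by
  let P : Ideal B :=
    { carrier := {f | v (algebraMap B L f) < 1}
      add_mem' := fun {a b} ha hb ↦ by
        change v _ < 1
        rw [map_add]
        exact v.map_add_lt ha hb
      zero_mem' := by change v _ < 1; simp
      smul_mem' := fun c x hx ↦ by
        change v _ < 1
        rw [smul_eq_mul, map_mul, map_mul]
        exact (mul_le_of_le_one_left' (hv c)).trans_lt hx }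
  have hP (f) : v (algebraMap B L f) < 1 ↔ f ∈ P := Iff.rfl
  obtain ⟨π, hπ⟩ : ∃ π, P = Ideal.span {π} := (IsPrincipalIdealRing.principal P).principal
  have hd (f) : v (algebraMap B L f) < 1 ↔ π ∣ f := by
    rw [hP, hπ, Ideal.mem_span_singleton]
  obtain ⟨f, hf0, hf1⟩ := hnt
  have hπ0 : π ≠ 0 := by
    rintro rfl
    exact hf0 (zero_dvd_iff.mp ((hd f).mp hf1))
  have hprime : Prime π := by
    refine ⟨hπ0, fun hu ↦ ?_, fun a b hab ↦ ?_⟩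
    · have := (hd 1).mpr hu.dvd
      simp at this
    · simp only [← hd] at hab ⊢
      by_contra! H
      rw [map_mul, map_mul, le_antisymm (hv a) H.1, le_antisymm (hv b) H.2] at hab
      simp at hab
  refine ⟨π, hprime, hd, fun f hf ↦ ?_⟩
  obtain ⟨k, a, ha, rfl⟩ := WfDvdMonoid.max_power_factor hf hprime.irreducible
  refine ⟨k, ?_⟩
  rw [← hd, not_lt] at ha
  simp [le_antisymm (hv a) ha]

theorem exists_pow_eq_zpow [FaithfulSMul B L] {π : B}
    (hπ : ∀ f, f ≠ 0 → ∃ k : ℕ, v (algebraMap B L f) = v (algebraMap B L π) ^ k)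
    (hπ0 : v (algebraMap B L π) ≠ 0)
    {z : L} (hz : z ≠ 0) (halg : IsAlgebraic B z) :
    ∃ n : ℕ, 0 < n ∧ ∃ k : ℤ, v z ^ n = v (algebraMap B L π) ^ k := by
  obtain ⟨p, hp, hpz⟩ := halg
  obtain ⟨i, j, hij, hi, hj, h⟩ := v.exists_map_coeff_mul_pow_eq hz hp hpz
  obtain ⟨k, hk⟩ := hπ _ hi
  obtain ⟨l, hl⟩ := hπ _ hj
  refine ⟨j - i, Nat.sub_pos_of_lt hij, k - l, ?_⟩
  have hvz : v z ≠ 0 := v.ne_zero_iff.mpr hz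
  obtain ⟨d, rfl⟩ := Nat.exists_eq_add_of_lt hij
  simp only [map_mul, map_pow, hk, hl] at h
  rw [zpow_sub₀ hπ0, eq_div_iff (zpow_ne_zero _ hπ0), zpow_natCast, zpow_natCast]
  rw [show i + d + 1 - i = d + 1 by omega]
  apply mul_right_cancel₀ (pow_ne_zero i hvz)
  rw [h, add_assoc, pow_add (v z) i, mul_assoc, mul_left_comm, mul_comm (v z ^ i)]

end Valuation

namespace ValuationSubring

open Polynomial

variable {L B : Type*} [Field L] [CommRing B] [IsDomain B] [Algebra B L] [FaithfulSMul B L]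
  [IsPrincipalIdealRing B] (V : ValuationSubring L)

theorem exists_valuation_pow_sub_one_lt_one (hv : ∀ f : B, algebraMap B L f ∈ V)
    {π : B} (hprime : Prime π) (hπ : ∀ f, V.valuation (algebraMap B L f) < 1 ↔ π ∣ f)
    [Finite (B ⧸ Ideal.span {π})]
    {y : L} (hy : V.valuation y = 1) (halg : IsAlgebraic B y) :
    ∃ n : ℕ, 0 < n ∧ V.valuation (y ^ n - 1) < 1 := by
  obtain ⟨p, hp, hpy⟩ := halg
  obtain ⟨m, q, hdvd, rfl⟩ :=
    WfDvdMonoid.max_power_factor hp (prime_C_iff.mpr hprime).irreducible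
  have hπ0 : algebraMap B L π ≠ 0 := by simpa using hprime.ne_zero
  have hq : aeval y q = 0 := by simpa [hπ0] using hpy
  let ι : B →+* V := (algebraMap B L).codRestrict V.toSubring hv
  let k := IsLocalRing.ResidueField V
  let y' : V := ⟨y, V.mem_of_valuation_le_one _ hy.le⟩
  let P := Ideal.span {π}
  let ψ : B ⧸ P →+* k := Ideal.Quotient.lift P ((IsLocalRing.residue V).comp ι) (by
    intro a ha
    rw [RingHom.comp_apply, IsLocalRing.residue_eq_zero_iff, V.valuation_lt_one_iff]
    exact (hπ a).mpr (Ideal.mem_span_singleton.mp ha))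
  have hP : P.IsPrime := (Ideal.span_singleton_prime hprime.ne_zero).mpr hprime
  let _ : Field (B ⧸ P) := (Finite.isField_of_domain (B ⧸ P)).toField
  let _ : Algebra (B ⧸ P) k := ψ.toAlgebra
  let ybar : k := IsLocalRing.residue V y'
  have hy0 : ybar ≠ 0 := by
    rw [Ne, IsLocalRing.residue_eq_zero_iff, V.valuation_lt_one_iff]
    exact hy.not_lt
  have hint : IsIntegral (B ⧸ P) ybar := by
    refine IsAlgebraic.isIntegral ⟨q.map (Ideal.Quotient.mk P), fun h0 ↦ hdvd ?_, ?_⟩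
    · rw [C_dvd_iff_dvd_coeff]
      intro i
      rw [← Ideal.mem_span_singleton, ← Ideal.Quotient.eq_zero_iff_mem, ← coeff_map]
      rw [h0, coeff_zero]
    · rw [aeval_def, eval₂_map]
      have : eval₂ ι y' q = 0 := by
        apply Subtype.ext
        refine Eq.trans ?_ hq
        rw [aeval_def]
        exact hom_eval₂ q ι V.subtype y'
      have h2 := hom_eval₂ q ι (IsLocalRing.residue V) y'
      rw [this, map_zero] at h2
      exact h2.symm
  have : Module.Finite (B ⧸ P) (Algebra.adjoin (B ⧸ P) {ybar}) :=
    Module.Finite.iff_fg.mpr hint.fg_adjoin_singleton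
  have : Finite (Algebra.adjoin (B ⧸ P) {ybar}) := Module.finite_of_finite (B ⧸ P)
  obtain ⟨i, j, hij, h⟩ := Finite.exists_ne_map_eq_of_infinite
    fun i : ℕ ↦ (⟨ybar, Algebra.self_mem_adjoin_singleton _ _⟩ : Algebra.adjoin (B ⧸ P) {ybar}) ^ i
  replace h : ybar ^ i = ybar ^ j := congr(($h).1)
  wlog hlt : i < j generalizing i j
  · exact this j i hij.symm h.symm (by omega)
  refine ⟨j - i, Nat.sub_pos_of_lt hlt, ?_⟩
  have h1 : ybar ^ (j - i) = 1 := by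
    apply mul_right_cancel₀ (pow_ne_zero i hy0)
    rw [← pow_add, Nat.sub_add_cancel hlt.le, h, one_mul]
  have h2 : IsLocalRing.residue V (y' ^ (j - i) - 1) = 0 := by
    rw [map_sub, map_pow, map_one, h1, sub_self]
  rw [IsLocalRing.residue_eq_zero_iff, V.valuation_lt_one_iff] at h2
  exact h2

end ValuationSubring

namespace FinitelySeparable

open Polynomial

theorem isIntegral_of_isAlgebraic {L B : Type*} [Field L] [CommRing B] [IsDomain B] [Algebra B L]
    [FaithfulSMul B L] [IsPrincipalIdealRing B] [Ring.HasFiniteQuotients B]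
    {D : NonUnitalSubring L} (hD : FinitelySeparable D) {b : L} (hb : b ∈ D)
    (halg : IsAlgebraic B b) (hinf : {f : B | algebraMap B L f ∈ D}.Infinite) :
    IsIntegral B b := by
  by_contra hni
  obtain ⟨V, hV, hbV⟩ := Subring.exists_le_valuationSubring_of_isIntegrallyClosedIn
    (R := (integralClosure B L).toSubring) hni
  have hmem (f : B) : algebraMap B L f ∈ V := hV isIntegral_algebraMap
  set v := V.valuation with hv_def
  have hv (f : B) : v (algebraMap B L f) ≤ 1 := (V.valuation_le_one_iff _).mpr (hmem f)
  have hb0 : b ≠ 0 := fun h ↦ hbV (h ▸ V.zero_mem)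
  have hb1 : 1 < v b := by
    rw [← not_le, V.valuation_le_one_iff]
    exact hbV
  have hnt : ∃ f : B, f ≠ 0 ∧ v (algebraMap B L f) < 1 := by
    obtain ⟨p, hp, hpb⟩ := halg
    obtain ⟨i, j, hij, hi, hj, h⟩ := v.exists_map_coeff_mul_pow_eq hb0 hp hpb
    refine ⟨_, hj, (hv _).lt_of_ne fun h1 ↦ ?_⟩
    simp only [map_mul, map_pow, h1, one_mul] at h
    refine (pow_lt_pow_right₀ hb1 hij).not_ge ?_
    rw [← h]
    exact mul_le_of_le_one_left' (hv _)
  obtain ⟨π, hprime, hd, hpow⟩ := v.exists_uniformizer hv hnt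
  have hπ0 : v (algebraMap B L π) ≠ 0 := by simpa using hprime.ne_zero
  have hπ1 : v (algebraMap B L π) < 1 := (hd π).mpr dvd_rfl
  have : Finite (B ⧸ Ideal.span {π}) :=
    Ring.HasFiniteQuotients.finiteQuotient (by simpa using hprime.ne_zero)
  obtain ⟨F, _, _, φ, hφ⟩ := hD ⟨b, hb⟩
    (V.toSubring.toNonUnitalSubring.comap (NonUnitalSubringClass.subtype D)) hbV
  obtain ⟨f, hf0, hfD, hφf⟩ : ∃ f : B, f ≠ 0 ∧ ∃ hf : algebraMap B L f ∈ D, φ ⟨_, hf⟩ = 0 := by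
    have := hinf.to_subtype
    obtain ⟨f, g, hne, h⟩ := Finite.exists_ne_map_eq_of_infinite
      fun f : {f : B | algebraMap B L f ∈ D} ↦ φ ⟨_, f.2⟩
    refine ⟨f - g, sub_ne_zero.mpr (Subtype.coe_ne_coe.mpr hne), ?_, ?_⟩
    · rw [map_sub]
      exact D.sub_mem f.2 g.2
    · rw [← sub_eq_zero, ← map_sub] at h
      rw [← h]
      congr 1
      exact Subtype.ext (map_sub _ _ _)
  have hker (d : L) (hdD : d ∈ D) (z : L) (hz : ∃ hz : z ∈ D, φ ⟨z, hz⟩ = 0) (s : ℕ) :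
      ∃ hz : d ^ s * z ∈ D, φ ⟨d ^ s * z, hz⟩ = 0 := by
    induction s with
    | zero => simpa using hz
    | succ s ih =>
      obtain ⟨h1, h2⟩ := ih
      refine ⟨by rw [pow_succ', mul_assoc]; exact D.mul_mem hdD h1, ?_⟩
      have : φ (⟨d, hdD⟩ * ⟨_, h1⟩) = 0 := by rw [map_mul, h2, mul_zero]
      rw [← this]
      congr 1
      exact Subtype.ext (by simp [pow_succ', mul_assoc])
  obtain ⟨n, hn, k, hk⟩ := v.exists_pow_eq_zpow hpow hπ0 hb0 halg
  obtain ⟨m, hm, rfl⟩ : ∃ m : ℕ, 0 < m ∧ k = -m := by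
    have hk0 : k < 0 := by
      by_contra! h
      obtain ⟨m, rfl⟩ := Int.eq_ofNat_of_zero_le h
      have h1 := one_lt_pow₀ hb1 hn.ne'
      rw [hk, zpow_natCast] at h1
      exact h1.not_ge (pow_le_one₀ (zero_le) hπ1.le)
    exact ⟨k.natAbs, by omega, by omega⟩
  obtain ⟨l, hl⟩ := hpow f hf0
  have hfalg : IsAlgebraic B (algebraMap B L f) := isAlgebraic_algebraMap f
  have hvy : v (b ^ (n * l) * algebraMap B L f ^ m) = 1 := by
    rw [map_mul, map_pow, map_pow, pow_mul, hk, hl, zpow_neg, zpow_natCast, inv_pow, ← pow_mul,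
      ← pow_mul, mul_comm m l, inv_mul_cancel₀ (pow_ne_zero _ hπ0)]
  obtain ⟨e, he, hve⟩ := V.exists_valuation_pow_sub_one_lt_one hmem hprime hd hvy
    ((halg.pow _).mul (hfalg.pow _))
  set y := (b ^ (n * l) * algebraMap B L f ^ m) ^ e with hy
  have hyalg : IsAlgebraic B y := ((halg.pow _).mul (hfalg.pow _)).pow _
  obtain ⟨hyD, hφy⟩ : ∃ hz : y ∈ D, φ ⟨y, hz⟩ = 0 := by
    have h0 : ∃ hz : b ^ (n * l) * algebraMap B L f ^ m ∈ D, φ ⟨_, hz⟩ = 0 := by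
      obtain ⟨m, rfl⟩ := Nat.exists_eq_succ_of_ne_zero hm.ne'
      rw [Nat.succ_eq_add_one, pow_succ]
      exact hker _ hb _ (hker _ hfD _ ⟨hfD, hφf⟩ _) _
    obtain ⟨e, rfl⟩ := Nat.exists_eq_succ_of_ne_zero he.ne'
    rw [hy, Nat.succ_eq_add_one, pow_succ]
    exact hker _ h0.1 _ h0 _
  have hw1 : v (1 - y) < 1 := by rwa [v.map_sub_swap]
  obtain ⟨N, hN⟩ : ∃ N : ℕ, v (b * (1 - y) ^ N) ≤ 1 := by
    rcases eq_or_ne (1 - y) 0 with h0 | h0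
    · exact ⟨1, by simp [h0]⟩
    obtain ⟨n', hn', k', hk'⟩ := v.exists_pow_eq_zpow hpow hπ0 h0 (isAlgebraic_one.sub hyalg)
    have hk0 : 0 < k' := by
      by_contra! h
      have h1 := pow_lt_one' hw1 hn'.ne'
      rw [hk'] at h1
      exact h1.not_ge (one_le_zpow_of_nonpos₀ (zero_lt_iff.mpr hπ0) hπ1.le h)
    refine ⟨n' * m, ?_⟩
    rw [map_mul, map_pow, pow_mul, hk']
    calc v b * (v (algebraMap B L π) ^ k') ^ m
        ≤ v b ^ n * v (algebraMap B L π) ^ m := by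
          gcongr
          · exact le_self_pow hb1.le hn.ne'
          · obtain ⟨c, rfl⟩ := Int.eq_ofNat_of_zero_le hk0.le
            rw [zpow_natCast]
            exact pow_le_of_le_one (zero_le) hπ1.le (by omega)
      _ = 1 := by rw [hk, zpow_neg, zpow_natCast, inv_mul_cancel₀ (pow_ne_zero _ hπ0)]
  have hQ (s : ℕ) : ∃ hx : b * (1 - y) ^ s ∈ D, φ ⟨_, hx⟩ = φ ⟨b, hb⟩ := by
    induction s with
    | zero => simp [hb]
    | succ s ih =>
      obtain ⟨h1, h2⟩ := ih
      have h3 : b * (1 - y) ^ (s + 1) = b * (1 - y) ^ s - b * (1 - y) ^ s * y := by ring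
      refine ⟨h3 ▸ D.sub_mem h1 (D.mul_mem h1 hyD), ?_⟩
      have h4 : φ (⟨_, h1⟩ - ⟨_, h1⟩ * ⟨y, hyD⟩) = φ ⟨b, hb⟩ := by
        rw [map_sub, map_mul, hφy, mul_zero, sub_zero, h2]
      rw [← h4]
      congr 1
      exact Subtype.ext h3
  obtain ⟨h1, h2⟩ := hQ N
  exact hφ ⟨⟨_, h1⟩, (V.valuation_le_one_iff _).mp hN, h2⟩

end FinitelySeparable

namespace Polynomial

theorem aeval_X_mul_mem_nonUnitalSubring {R : Type*} [CommRing R] (D : NonUnitalSubring R) {c : R}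
    (hc : c ∈ D) (f : ℤ[X]) : aeval c (X * f) ∈ D := by
  induction f using Polynomial.induction_on' with
  | add p q hp hq =>
    rw [mul_add, map_add]
    exact D.add_mem hp hq
  | monomial n m =>
    rw [X_mul_monomial, aeval_monomial, eq_intCast, ← zsmul_eq_mul]
    refine D.zsmul_mem ?_ m
    induction n with
    | zero => simpa using hc
    | succ n ih =>
      rw [pow_succ]
      exact D.mul_mem ih hc

instance hasFiniteQuotients {k : Type*} [Field k] [Finite k] : Ring.HasFiniteQuotients k[X] where
  finiteQuotient {I} hI := by
    obtain ⟨g, hgI, hg0⟩ := Submodule.exists_mem_ne_zero_of_ne_bot hI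
    have := Finite.of_equiv _ (degreeLTEquiv k g.natDegree).toEquiv.symm
    refine Finite.of_surjective
      (fun f : degreeLT k g.natDegree ↦ Ideal.Quotient.mk I f) fun y ↦ ?_
    obtain ⟨f, rfl⟩ := Ideal.Quotient.mk_surjective y
    refine ⟨⟨f % g, ?_⟩, ?_⟩
    · rw [mem_degreeLT, ← degree_eq_natDegree hg0]
      exact EuclideanDomain.mod_lt f hg0
    · rw [Ideal.Quotient.eq, ← neg_mem_iff, neg_sub]
      refine I.mem_of_dvd ?_ hgI
      exact ⟨f / g, by rw [sub_eq_iff_eq_add, EuclideanDomain.div_add_mod]⟩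

end Polynomial

namespace FinitelySeparable

open Polynomial

variable {L : Type*} [Field L]

theorem isIntegral_int_of_isAlgebraic [CharZero L] {D : NonUnitalSubring L}
    (hD : FinitelySeparable D) {c : L} (hc : c ∈ D) (halg : IsAlgebraic ℤ c) : IsIntegral ℤ c := by
  rcases eq_or_ne c 0 with rfl | hc0
  · exact isIntegral_zero
  obtain ⟨p, hp, hpc⟩ := halg.exists_nonzero_coeff_and_aeval_eq_zero (by simpa using hc0)
  refine hD.isIntegral_of_isAlgebraic hc halg ?_
  refine Set.infinite_of_injective_forall_mem (f := fun n : ℕ ↦ (n : ℤ) * p.coeff 0)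
    (fun m n h ↦ by simpa [hp] using h) fun n ↦ ?_
  have h1 := D.neg_mem (aeval_X_mul_mem_nonUnitalSubring D hc p.divX)
  have h2 : algebraMap ℤ L (p.coeff 0) = -aeval c (X * p.divX) := by
    rw [← X_mul_divX_add p] at hpc
    simp only [map_add, aeval_C] at hpc
    exact eq_neg_of_add_eq_zero_right hpc
  change algebraMap ℤ L _ ∈ D
  rw [map_mul, h2, eq_intCast, ← zsmul_eq_mul]
  exact D.zsmul_mem h1 _

theorem isIntegral_int [CharZero L] {c : L}
    (h : FinitelySeparable (NonUnitalSubring.closure {c})) : IsIntegral ℤ c := by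
  by_cases halg : IsAlgebraic ℤ c
  · exact h.isIntegral_int_of_isAlgebraic (NonUnitalSubring.subset_closure rfl) halg
  have h1 : NonUnitalSubring.closure {c} =
      (NonUnitalSubring.closure {X}).map ((aeval c : ℤ[X] →ₐ[ℤ] L) : ℤ[X] →ₙ+* L) := by
    rw [NonUnitalRingHom.map_closure, Set.image_singleton]
    exact congrArg (fun x ↦ NonUnitalSubring.closure {x}) (aeval_X c).symm
  rw [h1] at h
  have h2 := (h.of_map _ (transcendental_iff_injective.mp halg)).map
    ((aeval (2⁻¹ : ℚ) : ℤ[X] →ₐ[ℤ] ℚ) : ℤ[X] →ₙ+* ℚ)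
  rw [NonUnitalRingHom.map_closure] at h2
  have h3 := h2.isIntegral_int_of_isAlgebraic (c := 2⁻¹)
    (NonUnitalSubring.subset_closure ⟨X, rfl, aeval_X _⟩)
    (by simpa using (isAlgebraic_algebraMap (R := ℤ) (A := ℚ) 2).inv)
  obtain ⟨m, hm⟩ := IsIntegrallyClosed.isIntegral_iff.mp h3
  have : ((m * 2 : ℤ) : ℚ) = (1 : ℤ) := by
    rw [eq_intCast] at hm
    push_cast
    rw [hm]
    norm_num
  have := Int.cast_injective this
  omega

theorem isIntegral_polynomial_of_isAlgebraic {k : Type*} [Field k] [Finite k] [Algebra k[X] L]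
    [FaithfulSMul k[X] L] {b : L} (halg : IsAlgebraic k[X] b)
    (h : FinitelySeparable (NonUnitalSubring.closure {algebraMap k[X] L X, b})) :
    IsIntegral k[X] b := by
  refine h.isIntegral_of_isAlgebraic (NonUnitalSubring.subset_closure (by simp)) halg ?_
  refine Set.infinite_of_injective_forall_mem (f := fun n : ℕ ↦ (X : k[X]) ^ (n + 1))
    (fun m n h ↦ by simpa using congr(natDegree $h)) fun n ↦ ?_
  change algebraMap k[X] L _ ∈ NonUnitalSubring.closure {algebraMap k[X] L X, b}
  induction n with
  | zero =>
    rw [zero_add, pow_one]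
    exact NonUnitalSubring.subset_closure (by simp)
  | succ n ih =>
    rw [pow_succ, map_mul]
    exact mul_mem ih (NonUnitalSubring.subset_closure (by simp))

theorem isIntegral_polynomial {k : Type*} [Field k] [Finite k] [Algebra k[X] L]
    [FaithfulSMul k[X] L] {b : L}
    (h : FinitelySeparable (NonUnitalSubring.closure {algebraMap k[X] L X, b})) :
    IsIntegral k[X] b := by
  by_cases halg : IsAlgebraic k[X] b
  · exact h.isIntegral_polynomial_of_isAlgebraic halg
  have h1 : NonUnitalSubring.closure {algebraMap k[X] L X, b} =
      (NonUnitalSubring.closure {(C X : k[X][X]), X}).map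
        ((aeval b : k[X][X] →ₐ[k[X]] L) : k[X][X] →ₙ+* L) := by
    rw [NonUnitalRingHom.map_closure, Set.image_pair]
    exact congrArg₂ (fun x y ↦ NonUnitalSubring.closure {x, y}) (aeval_C b X).symm (aeval_X b).symm
  rw [h1] at h
  let M := FractionRing k[X]
  have h2 := (h.of_map _ (transcendental_iff_injective.mp halg)).map
    ((aeval (algebraMap k[X] M X)⁻¹ : k[X][X] →ₐ[k[X]] M) : k[X][X] →ₙ+* M)
  have h3 : (NonUnitalSubring.closure {(C X : k[X][X]), X}).map
      ((aeval (algebraMap k[X] M X)⁻¹ : k[X][X] →ₐ[k[X]] M) : k[X][X] →ₙ+* M) =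
      NonUnitalSubring.closure {algebraMap k[X] M X, (algebraMap k[X] M X)⁻¹} := by
    rw [NonUnitalRingHom.map_closure, Set.image_pair]
    exact congrArg₂ (fun x y ↦ NonUnitalSubring.closure {x, y}) (aeval_C _ X) (aeval_X _)
  rw [h3] at h2
  obtain ⟨f, hf⟩ := IsIntegrallyClosed.isIntegral_iff.mp
    (h2.isIntegral_polynomial_of_isAlgebraic (isAlgebraic_algebraMap X).inv)
  have hX : algebraMap k[X] M X ≠ 0 := by simp
  refine (not_isUnit_X (IsUnit.of_mul_eq_one f ?_)).elim
  apply FaithfulSMul.algebraMap_injective k[X] M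
  rw [map_mul, hf, mul_inv_cancel₀ hX, map_one]

theorem isIntegralElem_aeval {a b : L} (hab : FinitelySeparable (NonUnitalSubring.closure {a, b}))
    (ha : (NonUnitalSubring.closure {a} : Set L).Infinite) :
    (aeval a : ℤ[X] →ₐ[ℤ] L).toRingHom.IsIntegralElem b := by
  obtain ⟨p, hp⟩ := CharP.exists L
  rcases CharP.char_is_prime_or_zero L p with hprime | rfl
  · have : Fact p.Prime := ⟨hprime⟩
    let _ := ZMod.algebra L p
    have htr : Transcendental (ZMod p) a := by
      intro halg
      have : Module.Finite (ZMod p) (Algebra.adjoin (ZMod p) {a}) :=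
        Module.Finite.iff_fg.mpr halg.isIntegral.fg_adjoin_singleton
      have : Finite (Algebra.adjoin (ZMod p) {a}) := Module.finite_of_finite (ZMod p)
      refine ha ((Set.toFinite (Algebra.adjoin (ZMod p) {a} : Set L)).subset ?_)
      have : NonUnitalSubring.closure {a} ≤
          (Algebra.adjoin (ZMod p) {a}).toSubring.toNonUnitalSubring :=
        NonUnitalSubring.closure_le.mpr
          (Set.singleton_subset_iff.mpr (Algebra.self_mem_adjoin_singleton _ _))
      exact this
    let _ : Algebra (ZMod p)[X] L := (aeval a : (ZMod p)[X] →ₐ[ZMod p] L).toAlgebra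
    have hX : algebraMap (ZMod p)[X] L X = a := aeval_X a
    have : FaithfulSMul (ZMod p)[X] L :=
      (faithfulSMul_iff_algebraMap_injective _ _).mpr (transcendental_iff_injective.mp htr)
    rw [← hX] at hab
    obtain ⟨q, hq, hqb⟩ := hab.isIntegral_polynomial
    have hsurj := map_surjective (Int.castRingHom (ZMod p)) (ZMod.intCast_surjective)
    obtain ⟨r, rfl, -, hr⟩ := lifts_and_natDegree_eq_and_monic
      (f := mapRingHom (Int.castRingHom (ZMod p)))
      (map_surjective (mapRingHom (Int.castRingHom (ZMod p))) hsurj q) hq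
    refine ⟨r, hr, ?_⟩
    rw [eval₂_map] at hqb
    rw [← hqb]
    congr 1
    refine ringHom_ext' (Subsingleton.elim _ _) ?_
    refine (aeval_X a).trans ?_
    simp [hX]
  · have := CharP.charP_to_charZero L
    have hb : FinitelySeparable (NonUnitalSubring.closure {b}) :=
      hab.mono (NonUnitalSubring.closure_mono (Set.subset_insert a {b}))
    obtain ⟨q, hq, hqb⟩ := hb.isIntegral_int
    refine ⟨q.map C, hq.map _, ?_⟩
    rw [eval₂_map, ← hqb]
    congr 1
    exact Subsingleton.elim _ _

theorem _root_.Ideal.finite_quotient_map {R S : Type*} [CommRing R] [CommRing S] {e : R →+* S}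
    (he : Function.Surjective e) (J : Ideal R) [Finite (R ⧸ J)] : Finite (S ⧸ J.map e) :=
  Finite.of_surjective (Ideal.quotientMap (J.map e) e Ideal.le_comap_map)
    (Ideal.quotientMap_surjective he)

theorem closure_singleton_of_addSubgroups {c : L}
    (H : ∀ (G : AddSubgroup L) (x : ℤ[X]), aeval c x ∉ G →
      ∃ J : Ideal ℤ[X], Finite (ℤ[X] ⧸ J) ∧ ∀ f ∈ J, aeval c x - aeval c f ∉ G) :
    FinitelySeparable (NonUnitalSubring.closure {c}) := by
  let e : ℤ[X] →+* (aeval c : ℤ[X] →ₐ[ℤ] L).range := (aeval c : ℤ[X] →ₐ[ℤ] L).rangeRestrict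
  have he : Function.Surjective e := (aeval c : ℤ[X] →ₐ[ℤ] L).rangeRestrict_surjective
  have hle : NonUnitalSubring.closure {c} ≤
      (aeval c : ℤ[X] →ₐ[ℤ] L).range.toSubring.toNonUnitalSubring :=
    NonUnitalSubring.closure_le.mpr (Set.singleton_subset_iff.mpr ⟨X, aeval_X c⟩)
  refine of_injective (K' := (aeval c : ℤ[X] →ₐ[ℤ] L).range)
    (NonUnitalRingHom.codRestrict (NonUnitalSubringClass.subtype (NonUnitalSubring.closure {c}))
      (aeval c : ℤ[X] →ₐ[ℤ] L).range fun x ↦ hle x.2)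
    (fun _ _ hxy ↦ Subtype.ext congr(($hxy).1)) ?_
  intro d A hd
  obtain ⟨x, hx⟩ := d.2
  obtain ⟨J, hJ, hJx⟩ := H (A.toAddSubgroup.map (AddSubgroupClass.subtype _)) x (by
    rintro ⟨y, hy, hyx⟩
    have : y = d := Subtype.ext (hyx.trans hx)
    exact hd (this ▸ hy))
  have := Ideal.finite_quotient_map he J
  refine exists_small_target
    (NonUnitalRingHomClass.toNonUnitalRingHom (Ideal.Quotient.mk (J.map e))) fun y hy hdy ↦ ?_
  obtain ⟨f, hf, hfy⟩ := (Ideal.mem_map_iff_of_surjective e he).mp (Ideal.Quotient.eq.mp hdy)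
  refine hJx f hf ⟨y, hy, ?_⟩
  have h1 : aeval c f = (d : L) - y := congr(($hfy).1)
  have h2 : aeval c x = (d : L) := hx
  rw [h1, h2, sub_sub_cancel]
  rfl

end FinitelySeparable

namespace Polynomial

/-- A functional taking the value `n + 1` on `X ^ (n + 1)!` and vanishing on all other powers
of `X`. -/
noncomputable def factorialFunctional (k : Type*) [Field k] : k[X] →ₗ[k] k :=
  (basisMonomials k).constr k
    (Function.extend (fun n : ℕ ↦ (n + 1).factorial) (fun n ↦ ((n + 1 : ℕ) : k)) 0)

theorem factorialFunctional_X_pow (k : Type*) [Field k] (n : ℕ) :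
    factorialFunctional k (X ^ (n + 1).factorial) = (n + 1 : ℕ) := by
  have hinj : Function.Injective fun n : ℕ ↦ (n + 1).factorial :=
    (strictMono_nat_of_lt_succ fun n ↦
      (Nat.factorial_lt n.succ_pos).mpr (Nat.lt_succ_self _)).injective
  have h : (X : k[X]) ^ (n + 1).factorial = basisMonomials k (n + 1).factorial := by
    rw [coe_basisMonomials]
    exact (monomial_one_right_eq_X_pow _).symm
  rw [factorialFunctional, h, Module.Basis.constr_basis]
  exact hinj.extend_apply _ _ n

theorem exists_X_pow_factorial_sub_mem (J : Ideal ℤ[X]) [Finite (ℤ[X] ⧸ J)] :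
    ∃ n : ℕ, (X : ℤ[X]) ^ (n + 2).factorial - X ^ (n + 1).factorial ∈ J := by
  obtain ⟨i, j, hij, h⟩ := Finite.exists_ne_map_eq_of_infinite
    fun i : ℕ ↦ Ideal.Quotient.mk J (X ^ i)
  wlog hlt : i < j generalizing i j
  · exact this j i hij.symm h.symm (by omega)
  obtain ⟨d, rfl⟩ := Nat.exists_eq_add_of_lt hlt
  refine ⟨i + d, J.mem_of_dvd ?_ (Ideal.Quotient.eq.mp h.symm)⟩
  have h1 : i ≤ (i + d + 1).factorial := by
    have := Nat.self_le_factorial (i + d + 1)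
    omega
  have h2 : d + 1 ∣ (i + d + 1) * (i + d + 1).factorial :=
    (Nat.dvd_factorial d.succ_pos (by omega)).mul_left _
  obtain ⟨t, ht⟩ := h2
  have h3 : (i + d + 2).factorial = (i + d + 1).factorial + (d + 1) * t := by
    rw [← ht, Nat.factorial_succ]
    ring
  rw [h3, pow_add X (i + d + 1).factorial, ← mul_sub_one, add_assoc i, pow_add X i, ← mul_sub_one,
    pow_mul]
  exact mul_dvd_mul (pow_dvd_pow X h1) (sub_one_dvd_pow_sub_one _ t)

end Polynomial

namespace FinitelySeparable

open Polynomial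

variable {L : Type*} [Field L]

theorem isIntegral_of_addSubgroups {c : L}
    (H : ∀ (G : AddSubgroup L) (x : ℤ[X]), aeval c x ∉ G →
      ∃ J : Ideal ℤ[X], Finite (ℤ[X] ⧸ J) ∧ ∀ f ∈ J, aeval c x - aeval c f ∉ G) :
    IsIntegral ℤ c := by
  obtain ⟨p, hp⟩ := CharP.exists L
  rcases CharP.char_is_prime_or_zero L p with hprime | rfl
  · have : Fact p.Prime := ⟨hprime⟩
    let _ := ZMod.algebra L p
    by_cases halg : IsAlgebraic (ZMod p) c
    · have : Algebra.IsIntegral ℤ (ZMod p) := ⟨fun x ↦ by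
        obtain ⟨m, rfl⟩ := ZMod.intCast_surjective x
        exact isIntegral_algebraMap⟩
      exact isIntegral_trans (R := ℤ) (A := ZMod p) c halg.isIntegral
    have hinj := transcendental_iff_injective.mp halg
    have hmem (f : (ZMod p)[X]) : aeval c f ∈ (LinearMap.ker (factorialFunctional (ZMod p))
        ).toAddSubgroup.map ((aeval c : (ZMod p)[X] →ₐ[ZMod p] L) : (ZMod p)[X] →+ L) ↔
        factorialFunctional (ZMod p) f = 0 := by
      constructor
      · rintro ⟨g, hg, hgf⟩
        rw [← hinj hgf]
        exact hg
      · exact fun h ↦ ⟨f, h, rfl⟩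
    have hX : factorialFunctional (ZMod p) X = 1 := by
      simpa using factorialFunctional_X_pow (ZMod p) 0
    obtain ⟨J, hJ, hJX⟩ := H _ X (by
      rw [aeval_X, ← aeval_X (R := ZMod p) c, hmem, hX]
      exact one_ne_zero)
    obtain ⟨n, hn⟩ := exists_X_pow_factorial_sub_mem J
    have h1 : aeval c (X : ℤ[X]) - aeval c (X ^ (n + 2).factorial - X ^ (n + 1).factorial : ℤ[X]) =
        aeval c (X - (X ^ (n + 2).factorial - X ^ (n + 1).factorial) : (ZMod p)[X]) := by
      simp
    refine absurd ?_ (hJX _ hn)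
    rw [h1, hmem, map_sub, map_sub, hX, factorialFunctional_X_pow, factorialFunctional_X_pow]
    push_cast
    ring
  · have := CharP.charP_to_charZero L
    exact (closure_singleton_of_addSubgroups H).isIntegral_int

end FinitelySeparable

instance Int.isJacobsonRing : IsJacobsonRing ℤ := by
  refine isJacobsonRing_iff_prime_eq.mpr fun P hP ↦ ?_
  rcases eq_or_ne P ⊥ with rfl | hP0
  · refine le_antisymm (fun x hx ↦ ?_) Ideal.le_jacobson
    have h := Int.isUnit_iff.mp (Ideal.mem_jacobson_bot.mp hx (3 * x))
    have : x = 0 := by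
      by_contra h0
      have := mul_self_pos.mpr h0
      rcases h with h | h <;> nlinarith
    simp [this]
  · have := hP.isMaximal hP0
    exact Ideal.jacobson_eq_self_of_isMaximal

namespace Ideal

theorem finite_quotient_of_isMaximal_of_finiteType_int {R : Type*} [CommRing R]
    [Algebra.FiniteType ℤ R] (m : Ideal R) [hm : m.IsMaximal] : Finite (R ⧸ m) := by
  let _ := Quotient.field m
  have : Module.Finite ℤ (R ⧸ m) := finite_of_finite_type_of_isJacobsonRing ℤ (R ⧸ m)
  have hinj : ¬ Function.Injective (algebraMap ℤ (R ⧸ m)) := fun h ↦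
    Int.not_isField (isField_of_isIntegral_of_isField h (Field.toIsField (R ⧸ m)))
  rw [injective_iff_map_eq_zero] at hinj
  push Not at hinj
  obtain ⟨n, hn, hn0⟩ := hinj
  refine Module.finite_of_fg_torsion (R ⧸ m) fun {x} ↦
    ⟨⟨n, mem_nonZeroDivisors_of_ne_zero hn0⟩, ?_⟩
  change n • x = 0
  rw [zsmul_eq_mul, ← eq_intCast (algebraMap ℤ (R ⧸ m)), hn, zero_mul]

theorem finite_quotient_of_le {R : Type*} [CommRing R] {I J : Ideal R} (h : I ≤ J)
    [Finite (R ⧸ I)] : Finite (R ⧸ J) :=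
  Finite.of_surjective _ (Quotient.factor_surjective h)

theorem finite_quotient_inf {R : Type*} [CommRing R] (I J : Ideal R)
    [Finite (R ⧸ I)] [Finite (R ⧸ J)] : Finite (R ⧸ I ⊓ J) := by
  refine Finite.of_injective (Quotient.lift (I ⊓ J) ((Quotient.mk I).prod (Quotient.mk J)) ?_)
    (RingHom.lift_injective_of_ker_le_ideal _ _ ?_)
  · exact fun a ha ↦
      Prod.ext (Quotient.eq_zero_iff_mem.mpr ha.1) (Quotient.eq_zero_iff_mem.mpr ha.2)
  · exact fun a ha ↦
      ⟨Quotient.eq_zero_iff_mem.mp congr(($ha).1), Quotient.eq_zero_iff_mem.mp congr(($ha).2)⟩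

variable {R : Type*} [CommRing R] [Algebra.FiniteType ℤ R]

theorem exists_finite_quotient_notMem_smul_top {M : Type*} [AddCommGroup M] [Module R M]
    [Module.Finite R M] {x : M} (hx : x ≠ 0) :
    ∃ I : Ideal R, Finite (R ⧸ I) ∧ x ∉ I • (⊤ : Submodule R M) := by
  have : IsNoetherianRing R := Algebra.FiniteType.isNoetherianRing ℤ R
  obtain ⟨m, hm, hle⟩ := exists_le_maximal (LinearMap.toSpanSingleton R M x).ker (by
    rw [ne_top_iff_one]
    simpa using hx)
  have := finite_quotient_of_isMaximal_of_finiteType_int m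
  have h : x ∉ ⨅ k : ℕ, m ^ k • (⊤ : Submodule R M) := by
    rw [mem_iInf_smul_pow_eq_bot_iff]
    rintro ⟨r, hr⟩
    refine hm.ne_top ((eq_top_iff_one m).mpr ?_)
    have : 1 - (r : R) ∈ m := hle (by simp [sub_smul, hr])
    simpa using m.add_mem this r.2
  rw [Submodule.mem_iInf] at h
  push Not at h
  obtain ⟨k, hk⟩ := h
  exact ⟨m ^ k, finite_quotient_pow (IsNoetherian.noetherian m) k, hk⟩

theorem exists_finite_quotient_forall_mem_smul_top {M : Type*} [AddCommGroup M] [Module R M]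
    [Module.Finite R M] {S : Set M} (hS : S.Finite) :
    ∃ I : Ideal R, Finite (R ⧸ I) ∧ ∀ s ∈ S, s ∈ I • (⊤ : Submodule R M) → s = 0 := by
  induction S, hS using Set.Finite.induction_on with
  | empty => exact ⟨⊤, inferInstance, by simp⟩
  | @insert a S _ _ ih =>
    obtain ⟨I, hI, h⟩ := ih
    by_cases ha : a = 0
    · refine ⟨I, hI, ?_⟩
      rintro s (rfl | hs) hsI
      exacts [ha, h s hs hsI]
    · obtain ⟨J, hJ, hJa⟩ := exists_finite_quotient_notMem_smul_top (R := R) ha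
      refine ⟨I ⊓ J, finite_quotient_inf I J, ?_⟩
      rintro s (rfl | hs) hsI
      · exact (hJa (Submodule.smul_mono_left inf_le_right hsI)).elim
      · exact h s hs (Submodule.smul_mono_left inf_le_left hsI)

theorem exists_le_finite_quotient_of_finite_image (W : Ideal R) {S : Set R}
    (hS : (Quotient.mk W '' S).Finite) :
    ∃ J, W ≤ J ∧ Finite (R ⧸ J) ∧ ∀ s ∈ S, s ∈ J → s ∈ W := by
  obtain ⟨I, hI, h⟩ := exists_finite_quotient_forall_mem_smul_top (R := R) hS
  refine ⟨I ⊔ W, le_sup_right, finite_quotient_of_le le_sup_left, fun s hs hsJ ↦ ?_⟩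
  rw [← Quotient.eq_zero_iff_mem]
  refine h _ ⟨s, hs, rfl⟩ ?_
  obtain ⟨i, hi, w, hw, rfl⟩ := Submodule.mem_sup.mp hsJ
  have : Quotient.mk W (i + w) = i • (1 : R ⧸ W) := by
    rw [map_add, Quotient.eq_zero_iff_mem.mpr hw, add_zero, Algebra.smul_def, mul_one]
    rfl
  rw [this]
  exact Submodule.smul_mem_smul hi trivial

theorem finite_quotient_smul_top {R M : Type*} [CommRing R] [AddCommGroup M] [Module R M]
    [Module.Finite R M] (I : Ideal R) [Finite (R ⧸ I)] :
    Finite (M ⧸ I • (⊤ : Submodule R M)) := by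
  have := Module.Finite.of_restrictScalars_finite R (R ⧸ I) (M ⧸ I • (⊤ : Submodule R M))
  exact Module.finite_of_finite (R ⧸ I)

/-- The separation criterion: a subgroup `A` of a finitely generated ring `U` is closed in the
profinite topology of `U` as soon as `A` is finite modulo some ideal `M` that is a finitely
generated module over a finitely generated ring stabilizing `A ⊓ M`. -/
theorem exists_finite_quotient_forall_sub_notMem {U : Type*} [CommRing U] [Algebra.FiniteType ℤ U]
    [Algebra R U] (M : Ideal U) [Module.Finite R M] (A : AddSubgroup U)
    (hA : ∀ (r : R), ∀ y ∈ A, y ∈ M → r • y ∈ A) (hfin : (Quotient.mk M '' A).Finite)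
    {x : U} (hx : x ∉ A) : ∃ J : Ideal U, Finite (U ⧸ J) ∧ ∀ y ∈ A, x - y ∉ J := by
  by_cases h : ∃ y ∈ A, x - y ∈ M
  · obtain ⟨y₀, hy₀, hxM⟩ := h
    set x₀ : M := ⟨x - y₀, hxM⟩ with hx₀
    let N : Submodule R M :=
      { carrier := {m | (m : U) ∈ A}
        add_mem' := fun ha hb ↦ A.add_mem ha hb
        zero_mem' := A.zero_mem
        smul_mem' := fun r m hm ↦ hA r m hm m.2 }
    have hxN : x₀ ∉ N := fun h ↦ hx (by simpa [hx₀] using A.add_mem h hy₀)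
    obtain ⟨I, hI, hxI⟩ := exists_finite_quotient_notMem_smul_top (R := R)
      (mt (Submodule.Quotient.mk_eq_zero N).mp hxN)
    have := finite_quotient_smul_top (M := M) I
    let W : Ideal U :=
      { carrier := {u | ∃ h : u ∈ M, (⟨u, h⟩ : M) ∈ I • (⊤ : Submodule R M)}
        add_mem' := by
          rintro a b ⟨ha, ha'⟩ ⟨hb, hb'⟩
          exact ⟨M.add_mem ha hb, Submodule.add_mem _ ha' hb'⟩
        zero_mem' := ⟨M.zero_mem, Submodule.zero_mem _⟩
        smul_mem' := by
          rintro u a ⟨ha, ha'⟩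
          refine ⟨M.mul_mem_left u ha, ?_⟩
          have := Submodule.mem_map_of_mem (f := Algebra.lsmul R R M u) ha'
          rw [Submodule.map_smul''] at this
          exact Submodule.smul_mono le_rfl le_top this }
    have hMW : (Quotient.mk W '' M).Finite := by
      let f : M ⧸ I • (⊤ : Submodule R M) →+ U ⧸ W := QuotientAddGroup.lift
        (I • (⊤ : Submodule R M)).toAddSubgroup ((Quotient.mk W : U →+ U ⧸ W).comp
          (AddSubgroupClass.subtype M)) fun m hm ↦ Quotient.eq_zero_iff_mem.mpr ⟨m.2, hm⟩
      refine (Set.finite_range f).subset ?_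
      rintro _ ⟨m, hm, rfl⟩
      exact ⟨Submodule.Quotient.mk ⟨m, hm⟩, rfl⟩
    obtain ⟨J₁, hWJ, hJ₁, h₁⟩ := exists_le_finite_quotient_of_finite_image W hMW
    obtain ⟨J₂, hMJ, hJ₂, h₂⟩ := exists_le_finite_quotient_of_finite_image M hfin
    refine ⟨J₁ ⊓ J₂, finite_quotient_inf J₁ J₂, fun y hy hxy ↦ ?_⟩
    have hyM : y₀ - y ∈ M := by
      refine h₂ _ (A.sub_mem hy₀ hy) ?_
      have := J₂.sub_mem hxy.2 (hMJ hxM)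
      rwa [sub_sub_sub_cancel_left] at this
    obtain ⟨hwM, hw⟩ := h₁ (x - y) (by simpa using M.add_mem hxM hyM) hxy.1
    refine hxI ?_
    have h3 : Submodule.Quotient.mk x₀ = N.mkQ ⟨x - y, hwM⟩ := by
      refine (Submodule.Quotient.eq N).mpr ?_
      change x - y₀ - (x - y) ∈ A
      rw [sub_sub_sub_cancel_left]
      exact A.sub_mem hy hy₀
    rw [h3]
    have := Submodule.mem_map_of_mem (f := N.mkQ) hw
    rw [Submodule.map_smul''] at this
    exact Submodule.smul_mono le_rfl le_top this
  · push Not at h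
    obtain ⟨J, hMJ, hJ, hJA⟩ := exists_le_finite_quotient_of_finite_image M
      (S := (fun y ↦ x - y) '' A) (by
        refine (hfin.image fun y ↦ Quotient.mk M x - y).subset ?_
        rintro _ ⟨_, ⟨y, hy, rfl⟩, rfl⟩
        exact ⟨_, ⟨y, hy, rfl⟩, (map_sub _ _ _).symm⟩)
    exact ⟨J, hJ, fun y hy hxy ↦ h y hy (hJA _ ⟨y, hy, rfl⟩ hxy)⟩

end Ideal

namespace FinitelySeparable

open Polynomial

theorem aeval_mul_mem {R : Type*} [CommRing R] (S : AddSubgroup R) {b : R}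
    (hb : ∀ y ∈ S, b * y ∈ S) (f : ℤ[X]) {y : R} (hy : y ∈ S) : aeval b f * y ∈ S := by
  induction f using Polynomial.induction_on' with
  | add p q hp hq =>
    rw [map_add, add_mul]
    exact S.add_mem hp hq
  | monomial n m =>
    rw [aeval_monomial, eq_intCast, mul_assoc, ← zsmul_eq_mul]
    refine S.zsmul_mem ?_ m
    induction n with
    | zero => simpa using hy
    | succ n ih =>
      rw [pow_succ', mul_assoc]
      exact hb _ ih

variable {U : Type*} [CommRing U]

theorem exists_ideal_of_closure_pair {a b : U} {W : Ideal U}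
    (hD : FinitelySeparable (NonUnitalSubring.closure {a, b})) (haa : a * a ∈ W)
    {L : Type*} [AddCommGroup L] (β : ℤ[X] →+ L) (hβ : ∀ f, aeval b f * a ∈ W → β f = 0)
    (G : AddSubgroup L) (x : ℤ[X]) (hx : β x ∉ G) :
    ∃ J : Ideal ℤ[X], Finite (ℤ[X] ⧸ J) ∧ ∀ f ∈ J, β x - β f ∉ G := by
  set D := NonUnitalSubring.closure {a, b}
  have haD : a ∈ D := NonUnitalSubring.subset_closure (by simp)
  have hbD : b ∈ D := NonUnitalSubring.subset_closure (by simp)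
  have hmem (f : ℤ[X]) : aeval b f * a ∈ D :=
    aeval_mul_mem D.toAddSubgroup (fun y hy ↦ D.mul_mem hbD hy) f haD
  let A : NonUnitalSubring D :=
    { carrier := {d | ∃ f : ℤ[X], β f ∈ G ∧ (d : U) - aeval b f * a ∈ W}
      add_mem' := by
        rintro c d ⟨f, hf, hcf⟩ ⟨g, hg, hdg⟩
        refine ⟨f + g, by rw [map_add]; exact G.add_mem hf hg, ?_⟩
        convert W.add_mem hcf hdg using 1
        push_cast [map_add]
        ring
      zero_mem' := ⟨0, by rw [map_zero]; exact G.zero_mem, by simp⟩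
      neg_mem' := by
        rintro c ⟨f, hf, hcf⟩
        refine ⟨-f, by rw [map_neg]; exact G.neg_mem hf, ?_⟩
        convert W.neg_mem hcf using 1
        push_cast [map_neg]
        ring
      mul_mem' := by
        rintro c d ⟨f, hf, hcf⟩ ⟨g, hg, hdg⟩
        refine ⟨0, by rw [map_zero]; exact G.zero_mem, ?_⟩
        have h1 := W.mul_mem_left (aeval b f * aeval b g) haa
        have h2 := W.mul_mem_left (aeval b f * a) hdg
        have h3 := W.mul_mem_right (d : U) hcf
        convert W.add_mem (W.add_mem h1 h2) h3 using 1
        push_cast [map_zero]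
        ring }
  have hA (f : ℤ[X]) : (⟨_, hmem f⟩ : D) ∈ A ↔ β f ∈ G := by
    refine ⟨?_, fun h ↦ ⟨f, h, by simp⟩⟩
    rintro ⟨g, hg, hfg⟩
    have : β (f - g) = 0 := hβ _ (by rwa [map_sub, sub_mul])
    rw [map_sub, sub_eq_zero] at this
    rwa [this]
  obtain ⟨F, _, _, φ, hφ⟩ := hD ⟨_, hmem x⟩ A (mt (hA x).mp hx)
  let θ : ℤ[X] →+ F :=
    { toFun := fun f ↦ φ ⟨_, hmem f⟩
      map_zero' := by
        rw [← map_zero φ]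
        congr 1
        exact Subtype.ext (by simp)
      map_add' := fun f g ↦ by
        rw [← map_add φ]
        congr 1
        exact Subtype.ext (by simp [add_mul]) }
  let S : AddSubgroup U := (φ : D →+ F).ker.map (AddSubgroupClass.subtype D)
  have hS (f : ℤ[X]) : θ f = 0 ↔ aeval b f * a ∈ S := by
    refine ⟨fun h ↦ ⟨_, h, rfl⟩, ?_⟩
    rintro ⟨y, hy, hyf⟩
    have : y = ⟨_, hmem f⟩ := Subtype.ext hyf
    rw [this] at hy
    exact hy
  let J : Ideal ℤ[X] :=
    { carrier := {f | θ f = 0}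
      add_mem' := fun {f g} hf hg ↦ by
        change θ (f + g) = 0
        rw [map_add, hf, hg, add_zero]
      zero_mem' := map_zero θ
      smul_mem' := fun g f hf ↦ by
        change θ (g * f) = 0
        rw [hS, map_mul, mul_assoc]
        refine aeval_mul_mem S ?_ g ((hS f).mp hf)
        rintro _ ⟨y, hy, rfl⟩
        refine ⟨⟨b, hbD⟩ * y, ?_, rfl⟩
        have hy : φ y = 0 := hy
        change φ _ = 0
        rw [map_mul, hy, mul_zero] }
  refine ⟨J, ?_, fun f hf hfG ↦ hφ ?_⟩
  · let Θ : ℤ[X] ⧸ J →+ F := QuotientAddGroup.lift J.toAddSubgroup θ fun f hf ↦ hf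
    refine Finite.of_injective Θ ((injective_iff_map_eq_zero Θ).mpr fun f hf ↦ ?_)
    obtain ⟨f, rfl⟩ := Ideal.Quotient.mk_surjective f
    exact Ideal.Quotient.eq_zero_iff_mem.mpr hf
  · refine ⟨⟨_, hmem (x - f)⟩, (hA _).mpr (by rwa [map_sub]), ?_⟩
    change θ (x - f) = θ x
    have hf : θ f = 0 := hf
    rw [map_sub, hf, sub_zero]

theorem isIntegral_of_closure_pair {a b : U} {W : Ideal U}
    (hD : FinitelySeparable (NonUnitalSubring.closure {a, b})) (haa : a * a ∈ W)
    {L : Type*} [Field L] (π : U →+* L) (hπ : ∀ r, r * a ∈ W → π r = 0) : IsIntegral ℤ (π b) := by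
  refine isIntegral_of_addSubgroups fun G x hx ↦ exists_ideal_of_closure_pair hD haa
    ((aeval (π b) : ℤ[X] →ₐ[ℤ] L) : ℤ[X] →+ L) (fun f hf ↦ ?_) G x hx
  rw [← hπ _ hf]
  exact aeval_algHom_apply π.toIntAlgHom b f

theorem fg_inf_nilradical [Algebra.FiniteType ℤ U] {I : Ideal U}
    (hgen : Algebra.adjoin ℤ (I : Set U) = ⊤)
    (hI : ∀ a ∈ I, ∀ b ∈ I, FinitelySeparable (NonUnitalSubring.closure {a, b})) :
    ((I ⊓ nilradical U).restrictScalars ℤ).FG := by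
  have : IsNoetherianRing U := Algebra.FiniteType.isNoetherianRing ℤ U
  set N := I ⊓ nilradical U with hN
  obtain ⟨W, ⟨hWN, hWfg⟩, hmax⟩ := set_has_maximal_iff_noetherian.mpr ‹_›
    {W : Ideal U | W ≤ N ∧ (W.restrictScalars ℤ).FG} ⟨⊥, bot_le, by
      rw [Submodule.restrictScalars_bot]
      exact Submodule.fg_bot⟩
  rcases hWN.eq_or_lt with rfl | hlt
  · exact hWfg
  exfalso
  obtain ⟨n, hnN, hnW⟩ := SetLike.exists_of_lt hlt
  obtain ⟨P, hP, -⟩ := exists_le_isAssociatedPrime_of_isNoetherianRing U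
    (⟨W.mkQ n, n, hnN, rfl⟩ : Submodule.map W.mkQ N) (by
      intro h
      exact hnW ((Submodule.Quotient.mk_eq_zero W).mp congr(($h).1)))
  obtain ⟨hPp, ⟨_, a, haN, rfl⟩, hPa⟩ := isAssociatedPrime_iff.mp hP
  replace hPa (r : U) : r ∈ P ↔ r * a ∈ W := by
    rw [hPa, Submodule.mem_colon_singleton, Submodule.mem_bot, ← smul_eq_mul,
      ← Submodule.Quotient.mk_eq_zero W, Subtype.ext_iff]
    rfl
  have haW : a ∉ W := fun h ↦ hPp.ne_top ((Ideal.eq_top_iff_one P).mpr ((hPa 1).mpr (by simpa)))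
  have haP : a ∈ P := nilradical_le_prime P haN.2
  let L := FractionRing (U ⧸ P)
  have hint (b : U) (hb : b ∈ I) : IsIntegral ℤ (Ideal.Quotient.mk P b) := by
    obtain ⟨p, hp, h⟩ := isIntegral_of_closure_pair (hI a haN.1 b hb) ((hPa a).mp haP)
      ((algebraMap (U ⧸ P) L).comp (Ideal.Quotient.mk P)) fun r hr ↦ by
        rw [RingHom.comp_apply, Ideal.Quotient.eq_zero_iff_mem.mpr ((hPa r).mpr hr), map_zero]
    refine ⟨p, hp, IsFractionRing.injective (U ⧸ P) L ?_⟩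
    rw [hom_eval₂, map_zero, ← h]
    congr 1
    exact Subsingleton.elim _ _
  have hint' : Algebra.IsIntegral ℤ (U ⧸ P) := by
    refine ⟨fun y ↦ ?_⟩
    obtain ⟨y, rfl⟩ := Ideal.Quotient.mk_surjective y
    have : (⊤ : Subalgebra ℤ U) ≤ (integralClosure ℤ (U ⧸ P)).comap (Ideal.Quotient.mkₐ ℤ P) := by
      rw [← hgen, Algebra.adjoin_le_iff]
      exact hint
    exact this (x := y) trivial
  have : Module.Finite ℤ (U ⧸ P) := Algebra.IsIntegral.finite
  refine hmax (W ⊔ Ideal.span {a}) ⟨sup_le hWN ?_, ?_⟩ ?_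
  · exact (Ideal.span_singleton_le_iff_mem _).mpr haN
  · obtain ⟨k, s, hs⟩ := Module.Finite.exists_fin (R := ℤ) (M := U ⧸ P)
    choose t ht using fun i ↦ Ideal.Quotient.mk_surjective (s i)
    let T : Submodule ℤ U := Submodule.span ℤ (Set.range t)
    have hT (r : U) : ∃ v ∈ T, r - v ∈ P := by
      have : Ideal.Quotient.mk P r ∈ T.map (Ideal.Quotient.mkₐ ℤ P).toLinearMap := by
        rw [Submodule.map_span, ← Set.range_comp]
        convert! Submodule.mem_top (R := ℤ) (x := Ideal.Quotient.mk P r)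
        rw [← hs]
        congr 2
        exact funext ht
      obtain ⟨v, hv, hvr⟩ := this
      exact ⟨v, hv, Ideal.Quotient.eq.mp hvr.symm⟩
    have hTfg : (T.map (LinearMap.mulRight ℤ a)).FG :=
      Submodule.FG.map _ (Submodule.fg_span (Set.finite_range t))
    convert! hWfg.sup hTfg
    refine le_antisymm (fun u hu ↦ ?_) (sup_le (fun u hu ↦ Ideal.mem_sup_left hu) ?_)
    · obtain ⟨w, hw, v, hv, rfl⟩ := Submodule.mem_sup.mp hu
      obtain ⟨r, rfl⟩ := Ideal.mem_span_singleton'.mp hv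
      obtain ⟨v, hv, hrv⟩ := hT r
      have hw' := W.add_mem hw ((hPa _).mp hrv)
      convert Submodule.add_mem_sup (S := W.restrictScalars ℤ) hw'
        (Submodule.mem_map_of_mem (f := LinearMap.mulRight ℤ a) hv) using 1
      rw [LinearMap.mulRight_apply]
      ring
    · rintro _ ⟨v, -, rfl⟩
      exact Ideal.mem_sup_right (Ideal.mem_span_singleton'.mpr ⟨v, rfl⟩)
  · exact lt_of_le_of_ne le_sup_left fun h ↦
      haW (h ▸ Ideal.mem_sup_right (Ideal.mem_span_singleton_self a))

end FinitelySeparable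

theorem Algebra.FiniteType.int_of_surjective {R S : Type*} [CommRing R] [CommRing S]
    [Algebra ℤ R] [Algebra ℤ S] [Algebra.FiniteType ℤ R] (f : R →+* S)
    (hf : Function.Surjective f) : Algebra.FiniteType ℤ S :=
  .of_surjective { f with commutes' := fun n ↦ by simp : R →ₐ[ℤ] S } hf

theorem AddMonoidHom.exists_forall_notMem_of_infinite {G ι : Type*} [AddGroup G] [Finite ι]
    {B : ι → Type*} [∀ i, AddGroup (B i)] (π : ∀ i, G →+ B i)
    (hπ : ∀ i, (Set.range (π i)).Infinite) (F : ∀ i, Set (B i)) (hF : ∀ i, (F i).Finite) :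
    ∃ g, ∀ i, π i g ∉ F i := by
  by_contra! h
  have (i : ι) : Finite ↥(F i ∩ Set.range (π i)) := ((hF i).inter_of_left _).to_subtype
  let _ := Fintype.ofFinite (Σ i, ↥(F i ∩ Set.range (π i)))
  choose g hg using fun k : Σ i, ↥(F i ∩ Set.range (π i)) ↦ k.2.2.2
  obtain ⟨k, -, hk⟩ := AddSubgroup.exists_finiteIndex_of_leftCoset_cover
    (H := fun k ↦ (π k.1).ker) (g := g) (s := Finset.univ) (by
      refine Set.eq_univ_of_forall fun x ↦ ?_
      obtain ⟨i, hi⟩ := h x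
      refine Set.mem_biUnion (Finset.mem_coe.mpr (Finset.mem_univ ⟨i, π i x, hi, x, rfl⟩)) ?_
      rw [Set.mem_vadd_set_iff_neg_vadd_mem, vadd_eq_add, SetLike.mem_coe, AddMonoidHom.mem_ker,
        map_add, map_neg, hg, neg_add_cancel])
  refine hπ k.1 ?_
  have : Finite (π k.1).range :=
    Finite.of_equiv _ (QuotientAddGroup.quotientKerEquivRange (π k.1)).toEquiv
  exact Set.toFinite ((π k.1).range : Set (B k.1))

theorem NonUnitalSubring.finite_setOf_finite_closure_singleton {B : Type*} [CommRing B]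
    [IsDomain B] [Algebra.FiniteType ℤ B] :
    {x : B | (closure {x} : Set B).Finite}.Finite := by
  obtain ⟨m, hm⟩ := Ideal.exists_maximal B
  have := Ideal.finite_quotient_of_isMaximal_of_finiteType_int m
  let H : AddSubgroup B :=
    AddCommGroup.torsion B ⊓ (integralClosure ℤ B).toSubring.toAddSubgroup
  have hH : Function.Injective
      ((Ideal.Quotient.mk m : B →+ B ⧸ m).comp H.subtype) := by
    rw [injective_iff_map_eq_zero]
    rintro ⟨x, htor, hint⟩ hx
    replace hx : x ∈ m := Ideal.Quotient.eq_zero_iff_mem.mp hx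
    by_contra h0
    replace h0 : x ≠ 0 := fun h ↦ h0 (Subtype.ext h)
    replace hint : IsIntegral ℤ x := hint
    obtain ⟨n, hn, hnx⟩ := isOfFinAddOrder_iff_nsmul_eq_zero.mp htor
    have hn0 : (n : B) = 0 := by
      rw [nsmul_eq_mul] at hnx
      exact (mul_eq_zero.mp hnx).resolve_right h0
    let D := Algebra.adjoin ℤ {x}
    have : Module.Finite ℤ D := Module.Finite.iff_fg.mpr hint.fg_adjoin_singleton
    have : Finite D := Module.finite_of_fg_torsion D fun {y} ↦
      ⟨⟨n, mem_nonZeroDivisors_of_ne_zero (by exact_mod_cast hn.ne')⟩, by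
        refine Subtype.ext ?_
        change (n : ℤ) • (y : B) = 0
        rw [zsmul_eq_mul, Int.cast_natCast, hn0, zero_mul]⟩
    obtain ⟨y, hy⟩ := (Finite.isField_of_domain D).mul_inv_cancel
      (a := ⟨x, Algebra.self_mem_adjoin_singleton ℤ x⟩) fun h ↦ h0 congr(($h).1)
    refine hm.ne_top ((Ideal.eq_top_iff_one m).mpr ?_)
    rw [← show x * y = 1 from congr(($hy).1)]
    exact m.mul_mem_right _ hx
  have hHfin : (H : Set B).Finite := Finite.of_injective _ hH
  refine hHfin.subset fun x hx ↦ ?_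
  have hx : Finite (closure {x}) := hx
  have hmem : x ∈ closure {x} := subset_closure rfl
  constructor
  · exact (closure {x}).toAddSubgroup.subtype.isOfFinAddOrder
      (isOfFinAddOrder_of_finite (⟨x, hmem⟩ : closure {x}))
  · have hpow (n : ℕ) : x ^ (n + 1) ∈ closure {x} := by
      induction n with
      | zero => simpa using hmem
      | succ n ih => exact pow_succ x (n + 1) ▸ mul_mem ih hmem
    obtain ⟨i, j, hij, h⟩ := Finite.exists_ne_map_eq_of_infinite
      fun n : ℕ ↦ (⟨x ^ (n + 1), hpow n⟩ : closure {x})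
    wlog hlt : i < j generalizing i j
    · exact this j i hij.symm h.symm (by lia)
    refine ⟨Polynomial.X ^ (j + 1) - Polynomial.X ^ (i + 1),
      Polynomial.monic_X_pow_sub ((Polynomial.degree_X_pow_le _).trans_lt
        (by exact_mod_cast Nat.succ_lt_succ hlt)), ?_⟩
    rw [Polynomial.eval₂_sub, Polynomial.eval₂_X_pow, Polynomial.eval₂_X_pow, sub_eq_zero]
    exact congr(($h).1).symm

namespace FinitelySeparable

open Polynomial

theorem isIntegralElem_comp_aeval {U : Type*} [CommRing U] {a b : U}
    (hab : FinitelySeparable (NonUnitalSubring.closure {a, b})) {B : Type*} [CommRing B]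
    [IsDomain B] (π : U →+* B) (ha : (NonUnitalSubring.closure {π a} : Set B).Infinite) :
    (π.comp (aeval a : ℤ[X] →ₐ[ℤ] U).toRingHom).IsIntegralElem (π b) := by
  obtain ⟨L, _, j, hj⟩ : ∃ (L : Type _) (_ : Field L) (j : B →+* L), Function.Injective j :=
    ⟨FractionRing B, inferInstance, algebraMap B _, IsFractionRing.injective B _⟩
  obtain ⟨p, hp, h⟩ := isIntegralElem_aeval (a := j (π a)) (b := j (π b)) (by
    have := hab.map ((j.comp π : U →+* L) : U →ₙ+* L)
    rwa [NonUnitalRingHom.map_closure, Set.image_pair] at this) (by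
    have := NonUnitalRingHom.map_closure (j : B →ₙ+* L) {π a}
    rw [Set.image_singleton] at this
    rw [← show _ = NonUnitalSubring.closure {j (π a)} from this]
    exact ha.image hj.injOn)
  refine ⟨p, hp, hj ?_⟩
  rw [hom_eval₂, map_zero, ← h]
  congr 1
  refine Polynomial.ringHom_ext' (Subsingleton.elim _ _) ?_
  change j (π (aeval a X)) = aeval (j (π a)) X
  rw [aeval_X, aeval_X]

theorem finite_comp_aeval {U : Type*} [CommRing U] [Algebra.FiniteType ℤ U] {I : Ideal U}
    (hgen : Algebra.adjoin ℤ (I : Set U) = ⊤)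
    (hI : ∀ a ∈ I, ∀ b ∈ I, FinitelySeparable (NonUnitalSubring.closure {a, b}))
    {B : Type*} [CommRing B] [IsDomain B] {π : U →+* B} (hπ : Function.Surjective π) {a : U}
    (haI : a ∈ I) (ha : (NonUnitalSubring.closure {π a} : Set B).Infinite) :
    (π.comp (aeval a : ℤ[X] →ₐ[ℤ] U).toRingHom).Finite := by
  set f := π.comp (aeval a : ℤ[X] →ₐ[ℤ] U).toRingHom
  refine RingHom.IsIntegral.to_finite (fun y ↦ ?_) ?_
  · obtain ⟨y, rfl⟩ := hπ y
    have hy : y ∈ Algebra.adjoin ℤ (I : Set U) := hgen ▸ trivial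
    induction hy using Algebra.adjoin_induction with
    | mem b hb => exact isIntegralElem_comp_aeval (hI a haI b hb) π ha
    | algebraMap n =>
      convert f.isIntegralElem_map (x := (n : ℤ[X])) using 1
      simp
    | add u v _ _ hu hv => rw [map_add]; exact hu.add f hv
    | mul u v _ _ hu hv => rw [map_mul]; exact hu.mul f hv
  · refine RingHom.FiniteType.of_comp_finiteType (f := algebraMap ℤ ℤ[X]) ?_
    have : f.comp (algebraMap ℤ ℤ[X]) = π.comp (algebraMap ℤ U) := Subsingleton.elim _ _
    rw [this]
    exact RingHom.FiniteType.comp_surjective (RingHom.finiteType_algebraMap.mpr ‹_›) hπ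

theorem exists_ideal_finite_quotient {U : Type*} [CommRing U] [Algebra.FiniteType ℤ U]
    {I : Ideal U} (hgen : Algebra.adjoin ℤ (I : Set U) = ⊤)
    (hI : ∀ a ∈ I, ∀ b ∈ I, FinitelySeparable (NonUnitalSubring.closure {a, b}))
    {A : NonUnitalSubring U} (hAI : (A : Set U) ⊆ I) {x : U} (hx : x ∉ A) :
    ∃ J : Ideal U, Finite (U ⧸ J) ∧ ∀ y ∈ A, x - y ∉ J := by
  have : IsNoetherianRing U := Algebra.FiniteType.isNoetherianRing ℤ U
  let T : Set (Ideal U) := {q ∈ minimalPrimes U | (Ideal.Quotient.mk q '' A).Infinite}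
  let T' : Set (Ideal U) := {q ∈ minimalPrimes U | (Ideal.Quotient.mk q '' A).Finite}
  have hmin := Ideal.finite_minimalPrimes_of_isNoetherianRing U ⊥
  have (q : Ideal U) : @Algebra.FiniteType ℤ (U ⧸ q) _ _ (Ring.toIntAlgebra _) :=
    Algebra.FiniteType.int_of_surjective (Ideal.Quotient.mk q) Ideal.Quotient.mk_surjective
  have : @Algebra.FiniteType ℤ ℤ[X] _ _ (Ring.toIntAlgebra _) :=
    Algebra.FiniteType.int_of_surjective (RingHom.id ℤ[X]) Function.surjective_id
  have : Finite T := (hmin.subset fun q hq ↦ hq.1).to_subtype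
  have : Finite T' := (hmin.subset fun q hq ↦ hq.1).to_subtype
  have (q : T) : q.1.IsPrime := q.2.1.1.1
  obtain ⟨⟨a, haA⟩, ha⟩ := AddMonoidHom.exists_forall_notMem_of_infinite
    (fun q : T ↦ (Ideal.Quotient.mk q.1 : U →+ U ⧸ q.1).comp A.toAddSubgroup.subtype)
    (fun q ↦ by
      convert q.2.2
      ext z
      simp)
    (fun q ↦ {x | (NonUnitalSubring.closure {x} : Set (U ⧸ q.1)).Finite})
    fun q ↦ NonUnitalSubring.finite_setOf_finite_closure_singleton
  let _ := (aeval a : ℤ[X] →ₐ[ℤ] U).toAlgebra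
  let M := I ⊓ sInf T'
  have hMfg : (M.restrictScalars ℤ[X]).FG := by
    have (q : T) : Module.Finite ℤ[X] (U ⧸ q.1) :=
      finite_comp_aeval hgen hI Ideal.Quotient.mk_surjective (hAI haA) (ha q)
    refine Submodule.fg_of_fg_map_of_fg_inf_ker
      (LinearMap.pi fun q : T ↦ q.1.mkQ.restrictScalars ℤ[X]) (IsNoetherian.noetherian _) ?_
    have := Submodule.FG.of_restrictScalars (S := (I ⊓ nilradical U).restrictScalars ℤ[X]) ℤ
      (fg_inf_nilradical hgen hI)
    convert! this
    ext u
    have hnil : u ∈ nilradical U ↔ ∀ q ∈ minimalPrimes U, u ∈ q := by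
      rw [nilradical, ← Ideal.sInf_minimalPrimes, Submodule.mem_sInf]
      rfl
    simp only [M, Submodule.mem_inf, Submodule.restrictScalars_mem, Submodule.mem_sInf, hnil,
      LinearMap.mem_ker, funext_iff, LinearMap.pi_apply, Pi.zero_apply, and_assoc, Subtype.forall,
      LinearMap.coe_restrictScalars, Submodule.mkQ_apply, Submodule.Quotient.mk_eq_zero, T, T',
      Set.mem_ofPred_eq]
    refine and_congr_right fun _ ↦ ⟨fun h q hq ↦ ?_, fun h ↦ ⟨fun q hq ↦ h q hq.1,
      fun q hq ↦ h q hq.1⟩⟩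
    exact (Set.finite_or_infinite _).elim (fun hf ↦ h.1 q ⟨hq, hf⟩) fun hf ↦ h.2 q ⟨hq, hf⟩
  have : Module.Finite ℤ[X] M := Module.Finite.iff_fg.mpr hMfg
  refine Ideal.exists_finite_quotient_forall_sub_notMem (R := ℤ[X]) M A.toAddSubgroup
    (fun f y hy _ ↦ ?_) ?_ hx
  · rw [Algebra.smul_def]
    exact aeval_mul_mem A.toAddSubgroup (fun z hz ↦ A.mul_mem haA hz) f hy
  · let g (u : U) (q : T') : U ⧸ q.1 := Ideal.Quotient.mk q.1 u
    have hg : (g '' A).Finite := by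
      refine (Set.Finite.pi fun q : T' ↦ q.2.2).subset ?_
      rintro _ ⟨y, hy, rfl⟩ q -
      exact ⟨y, hy, rfl⟩
    refine (hg.image fun z ↦ Ideal.Quotient.mk M (Function.invFunOn g A z)).subset ?_
    rintro _ ⟨y, hy, rfl⟩
    have hex : ∃ z ∈ (A : Set U), g z = g y := ⟨y, hy, rfl⟩
    refine ⟨g y, ⟨y, hy, rfl⟩, Ideal.Quotient.eq.mpr ⟨?_, ?_⟩⟩
    · exact I.sub_mem (hAI (Function.invFunOn_mem hex)) (hAI hy)
    · exact Submodule.mem_sInf.mpr fun q hq ↦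
        Ideal.Quotient.eq.mp (congrFun (Function.invFunOn_eq hex) ⟨q, hq⟩)

end FinitelySeparable

theorem NonUnitalSubring.exists_injective_range_eq_ideal.{u} {K : Type u} [NonUnitalCommRing K]
    (hfg : ∃ S : Finset K, closure (S : Set K) = ⊤) :
    ∃ (U : Type u) (_ : CommRing U) (ι : K →ₙ+* U) (I : Ideal U), Function.Injective ι ∧
      (I : Set U) = Set.range ι ∧ Algebra.FiniteType ℤ U ∧
        Algebra.adjoin ℤ (I : Set U) = ⊤ := by
  classical
  obtain ⟨S, hS⟩ := hfg
  let ι : K →ₙ+* Unitization ℤ K := (Unitization.inrNonUnitalAlgHom ℤ K : K →ₙ+* Unitization ℤ K)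
  let I : Ideal (Unitization ℤ K) := RingHom.ker (Unitization.fstHom ℤ K)
  have hI : (I : Set (Unitization ℤ K)) = Set.range ι := by
    ext u
    refine ⟨fun h ↦ ⟨u.snd, Unitization.ext (Eq.symm h) rfl⟩, ?_⟩
    rintro ⟨k, rfl⟩
    exact Unitization.fst_inr ℤ k
  let _ := Ring.toIntAlgebra (Unitization ℤ K)
  have hgen : Algebra.adjoin ℤ (ι '' S) = ⊤ := by
    set B := Algebra.adjoin ℤ (ι '' S)
    have hmem (k : K) : ι k ∈ B := by
      have : closure (S : Set K) ≤ B.toSubring.toNonUnitalSubring.comap ι :=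
        closure_le.mpr fun s hs ↦ Algebra.subset_adjoin ⟨s, hs, rfl⟩
      rw [hS] at this
      exact this (x := k) trivial
    refine eq_top_iff.mpr fun u _ ↦ ?_
    rw [← Unitization.inl_fst_add_inr_snd_eq u]
    refine B.add_mem ?_ (hmem _)
    rw [← Unitization.inlRingHom_apply, eq_intCast]
    exact intCast_mem B _
  refine ⟨Unitization ℤ K, inferInstance, ι, I, Unitization.inr_injective, hI, ⟨?_⟩, ?_⟩
  · rw [← hgen, ← Finset.coe_image]
    exact Subalgebra.fg_adjoin_finset _
  · rw [hI, eq_top_iff, ← hgen]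
    exact Algebra.adjoin_mono (Set.image_subset_range _ _)

/-- A finitely generated commutative (not necessarily unital) ring is finitely
separable if and only if each of its subrings generated by two elements is finitely separable. -/
theorem stmt1 {K : Type*} [NonUnitalCommRing K]
    (hfg : ∃ S : Finset K, NonUnitalSubring.closure (S : Set K) = ⊤) :
    FinitelySeparable K ↔
      ∀ a b : K, FinitelySeparable (NonUnitalSubring.closure {a, b}) := by
  refine ⟨fun h a b ↦ h.of_injective
    (NonUnitalSubringClass.subtype _) Subtype.val_injective, fun h x A hx ↦ ?_⟩
  obtain ⟨U, _, ι, I, hι, hI, hft, hgen⟩ := NonUnitalSubring.exists_injective_range_eq_ideal hfg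
  obtain ⟨J, hJ, hxJ⟩ := FinitelySeparable.exists_ideal_finite_quotient hgen (by
      intro a ha b hb
      obtain ⟨a, rfl⟩ := hI ▸ SetLike.mem_coe.mpr ha
      obtain ⟨b, rfl⟩ := hI ▸ SetLike.mem_coe.mpr hb
      have := (h a b).map ι
      rwa [NonUnitalRingHom.map_closure, Set.image_pair] at this)
    (A := A.map ι) (x := ι x) (by
      rintro _ ⟨k, -, rfl⟩
      exact hI ▸ ⟨k, rfl⟩) (by
      rintro ⟨y, hy, hyx⟩
      exact hx (hι hyx ▸ hy))
  exact FinitelySeparable.exists_small_target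
    ((Ideal.Quotient.mk J : U →ₙ+* U ⧸ J).comp ι)
    fun y hy hxy ↦ hxJ _ ⟨y, hy, rfl⟩ (Ideal.Quotient.eq.mp hxy)
end

section
/- If a (not necessarily unital) ring K of prime characteristic p is finitely separable and a² = 0 for some element a ∈ K, then for every element b ∈ K there exists a monic polynomial f(x) with integer coefficients and zero constant term such that a·f(b) = 0. -/
/-- Evaluation at `a ∈ K` of an integer polynomial with zero constant term in a non-unital
ring: for `f = z₁ x + z₂ x² + ⋯`, `zEval f a = z₁ a + z₂ a² + ⋯`. -/
noncomputable def zEval {K : Type*} [NonUnitalNonAssocRing K] (f : Polynomial ℤ) (a : K) : K :=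
  ∑ i ∈ f.support, f.coeff i • (if i = 0 then 0 else nupow a (i - 1))

open Polynomial

/-- The sequence step: a finite submodule avoiding `c` can be enlarged, still avoiding `c`, so as
to meet the coset `c + I` of an infinite set `I`. -/
lemma exists_finite_submodule_extension {p : ℕ} [Fact p.Prime] {V : Type*} [AddCommGroup V]
    [Module (ZMod p) V] {c : V} {I : Set V} (hI : I.Infinite) (A : Submodule (ZMod p) V)
    (hA : (A : Set V).Finite) (hc : c ∉ A) :
    ∃ g ∈ I, ((A ⊔ Submodule.span (ZMod p) {c + g} : Submodule (ZMod p) V) : Set V).Finite ∧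
      c ∉ A ⊔ Submodule.span (ZMod p) {c + g} := by
  have hfin : ∀ x : V,
      ((A ⊔ Submodule.span (ZMod p) {x} : Submodule (ZMod p) V) : Set V).Finite := by
    intro x
    have hx : ((Submodule.span (ZMod p) {x} : Submodule (ZMod p) V) : Set V).Finite := by
      rw [Submodule.span_singleton_eq_range]
      exact Set.finite_range _
    rw [Submodule.coe_sup]
    exact hA.add hx
  obtain ⟨g, hgI, hg⟩ := hI.exists_notMem_finite (hfin c)
  refine ⟨g, hgI, hfin _, fun hmem => ?_⟩
  obtain ⟨y, hy, z, hz, hyz⟩ := Submodule.mem_sup.1 hmem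
  obtain ⟨r, rfl⟩ := Submodule.mem_span_singleton.1 hz
  by_cases hr : r = 0
  · apply hc
    rw [← hyz, hr, zero_smul, add_zero]
    exact hy
  · apply hg
    have hrg : r • g ∈ A ⊔ Submodule.span (ZMod p) {c} := by
      have : r • g = -y + ((1 : ZMod p) - r) • c := by
        rw [eq_neg_add_iff_add_eq, sub_smul, one_smul, eq_sub_iff_add_eq, add_assoc,
          add_comm (r • g), ← smul_add, hyz]
      rw [this]
      exact add_mem (Submodule.mem_sup_left (neg_mem hy))
        (Submodule.mem_sup_right (Submodule.smul_mem _ _ (Submodule.mem_span_singleton_self c)))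
    exact (Submodule.smul_mem_iff _ hr).1 hrg

/-- If `c ≠ 0` lies in a submodule, then so does a submodule avoiding `c` that meets every coset
`c + I n` of a given sequence of infinite subsets. -/
lemma exists_submodule_notMem_forall_meets {p : ℕ} [Fact p.Prime] {V : Type*} [AddCommGroup V]
    [Module (ZMod p) V] (N : Submodule (ZMod p) V) {c : V} (hcN : c ∈ N) (hc0 : c ≠ 0)
    (I : ℕ → Set V) (hIN : ∀ n, I n ⊆ N) (hI : ∀ n, (I n).Infinite) :
    ∃ A : Submodule (ZMod p) V, A ≤ N ∧ c ∉ A ∧ ∀ n, ∃ g ∈ I n, c + g ∈ A := by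
  let S := {A : Submodule (ZMod p) V // A ≤ N ∧ (A : Set V).Finite ∧ c ∉ A}
  have step : ∀ (n : ℕ) (A : S), ∃ B : S, A.1 ≤ B.1 ∧ ∃ g ∈ I n, c + g ∈ B.1 := by
    rintro n ⟨A, hAN, hA, hc⟩
    obtain ⟨g, hg, hfin, hcg⟩ := exists_finite_submodule_extension (hI n) A hA hc
    refine ⟨⟨_, sup_le hAN ?_, hfin, hcg⟩, le_sup_left, g, hg,
      Submodule.mem_sup_right (Submodule.mem_span_singleton_self _)⟩
    rw [Submodule.span_singleton_le_iff_mem]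
    exact add_mem hcN (hIN n hg)
  choose next hle hmeet using step
  let A : ℕ → S := fun n => Nat.rec ⟨⊥, bot_le, by simp, by simpa using hc0⟩ next n
  have hmono : Monotone fun n => (A n).1 := monotone_nat_of_le_succ fun n => hle n (A n)
  refine ⟨⨆ n, (A n).1, iSup_le fun n => (A n).2.1, fun h => ?_, fun n => ?_⟩
  · obtain ⟨n, hn⟩ := (Submodule.mem_iSup_of_directed _ hmono.directed_le).1 h
    exact (A n).2.2.2 hn
  · obtain ⟨g, hg, hgA⟩ := hmeet n (A n)
    exact ⟨g, hg, Submodule.mem_iSup_of_mem (n + 1) hgA⟩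

/-- A finitely separable ring has no nontrivial submodule `N` with zero multiplication that admits
a sequence of infinite subsets such that each homomorphism to a finite ring kills one of them. -/
lemma not_finitelySeparable_of_infinite_killed {p : ℕ} [Fact p.Prime] {K : Type*}
    [NonUnitalRing K] [Module (ZMod p) K] (N : Submodule (ZMod p) K)
    (hN : ∀ x ∈ N, ∀ y ∈ N, x * y = 0)
    (I : ℕ → Set K) (hIN : ∀ n, I n ⊆ N) (hI : ∀ n, (I n).Infinite)
    (hkill : ∀ (F : Type) [NonUnitalRing F] [Finite F] (φ : K →ₙ+* F), ∃ n, ∀ x ∈ I n, φ x = 0) :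
    ¬ FinitelySeparable K := by
  intro hsep
  obtain ⟨c, hcI, hc0⟩ := (hI 0).exists_notMem_finite (Set.finite_singleton (0 : K))
  obtain ⟨A, hAN, hcA, hA⟩ :=
    exists_submodule_notMem_forall_meets N (hIN 0 hcI) hc0 I hIN hI
  let A' : NonUnitalSubring K :=
    { A.toAddSubgroup with
      mul_mem' := fun {x y} hx hy => by
        have h0 : x * y = 0 := hN x (hAN hx) y (hAN hy)
        rw [h0]
        exact A.zero_mem }
  obtain ⟨F, _, _, φ, hφ⟩ := hsep c A' hcA
  obtain ⟨n, hn⟩ := hkill F φ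
  obtain ⟨g, hg, hgA⟩ := hA n
  exact hφ ⟨c + g, hgA, by rw [map_add, hn g hg, add_zero]⟩

/-- Right multiplication by `b` as a linear map over `ZMod p`. -/
def rightMul (p : ℕ) {K : Type*} [NonUnitalRing K] [Module (ZMod p) K] (b : K) :
    K →ₗ[ZMod p] K :=
  (AddMonoidHom.mulRight b).toZModLinearMap p

section

variable {p : ℕ} {K : Type*} [NonUnitalRing K] [Module (ZMod p) K]

@[simp] lemma rightMul_apply (b x : K) : rightMul p b x = x * b := rfl

lemma rightMul_pow_apply (b x : K) (k : ℕ) : (rightMul p b ^ k) x = (· * b)^[k] x := by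
  rw [Module.End.pow_apply]
  rfl

lemma mul_aeval_rightMul (b x y : K) (f : (ZMod p)[X]) :
    y * aeval (rightMul p b) f x = aeval (rightMul p b) f (y * x) := by
  let L : K →ₗ[ZMod p] K := (AddMonoidHom.mulLeft y).toZModLinearMap p
  have hL : Commute L (rightMul p b) := by
    ext z
    exact (mul_assoc y z b).symm
  have h : Commute L (aeval (rightMul p b) f) := by
    induction f using Polynomial.induction_on' with
    | add f g hf hg => rw [map_add]; exact hf.add_right hg
    | monomial n r =>
      rw [aeval_monomial]
      exact (Algebra.commute_algebraMap_right r L).mul_right (hL.pow_right n)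
  exact LinearMap.congr_fun h x

/-- The polynomials `X ^ (m + d + 1) - X ^ m`, enumerated through `Nat.unpair`. -/
noncomputable def periodPoly (p n : ℕ) : (ZMod p)[X] :=
  X ^ (n.unpair.1 + (n.unpair.2 + 1)) - X ^ n.unpair.1

lemma periodPoly_monic [Fact p.Prime] (n : ℕ) : (periodPoly p n).Monic := by
  apply monic_X_pow_sub
  rw [degree_X_pow]
  exact_mod_cast (by omega)

lemma exists_periodPoly_killed {F : Type*} [NonUnitalRing F] [Finite F] (φ : K →ₙ+* F) (b : K) :
    ∃ n, ∀ (x : K) (q : (ZMod p)[X]),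
      φ (aeval (rightMul p b) (periodPoly p n * q) x) = 0 := by
  obtain ⟨i, j, hij, h⟩ :=
    Finite.exists_ne_map_eq_of_infinite fun k : ℕ => (fun y : F => y * φ b)^[k]
  wlog hlt : i < j generalizing i j
  · exact this j i hij.symm h.symm (by omega)
  obtain ⟨d, rfl⟩ := Nat.exists_eq_add_of_lt hlt
  refine ⟨Nat.pair i d, fun x q => ?_⟩
  have hφ : Function.Semiconj φ (· * b) (· * φ b) := fun y => map_mul φ y b
  rw [map_mul, Module.End.mul_apply, periodPoly, Nat.unpair_pair, map_sub, map_pow, map_pow,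
    aeval_X, LinearMap.sub_apply, map_sub, rightMul_pow_apply, rightMul_pow_apply,
    (hφ.iterate_right _).eq, (hφ.iterate_right _).eq, sub_eq_zero]
  exact (congrFun h _).symm

lemma infinite_range_comp_monic_mul [Fact p.Prime] {V : Type*} [AddCommGroup V]
    [Module (ZMod p) V] (S : (ZMod p)[X] →ₗ[ZMod p] V) (hS : (Set.range S).Infinite)
    {h : (ZMod p)[X]} (hh : h.Monic) : (Set.range fun q => S (h * q)).Infinite := by
  intro hfin
  have : Finite (degreeLT (ZMod p) h.natDegree) :=
    Finite.of_equiv _ (degreeLTEquiv (ZMod p) h.natDegree).symm.toEquiv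
  refine hS (((Set.finite_range fun r : degreeLT (ZMod p) h.natDegree => S r).add hfin).subset ?_)
  rintro _ ⟨f, rfl⟩
  refine ⟨_, ⟨⟨f %ₘ h, ?_⟩, rfl⟩, _, ⟨f /ₘ h, rfl⟩, ?_⟩
  · rw [mem_degreeLT, ← degree_eq_natDegree hh.ne_zero]
    exact degree_modByMonic_lt f hh
  · exact (map_add S _ _).symm.trans (by rw [modByMonic_add_div])

lemma exists_ne_zero_aeval_rightMul_eq_zero [Fact p.Prime] (hsep : FinitelySeparable K) {a : K}
    (ha : a * a = 0) (b : K) : ∃ g : (ZMod p)[X], g ≠ 0 ∧ aeval (rightMul p b) g a = 0 := by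
  by_contra! hne
  let T : (ZMod p)[X] →ₗ[ZMod p] K :=
    (LinearMap.applyₗ a).comp (aeval (rightMul p b)).toLinearMap
  have hT : Function.Injective T := (injective_iff_map_eq_zero T).2 fun f hf => by
    by_contra h
    exact hne f h hf
  let S : (ZMod p)[X] →ₗ[ZMod p] K := (rightMul p a).comp T
  have haT : ∀ f, a * T f = 0 := fun f =>
    (mul_aeval_rightMul b a a f).trans (by rw [ha, map_zero])
  by_cases hS : (Set.range S).Infinite
  · refine not_finitelySeparable_of_infinite_killed (LinearMap.range S) ?_
      (fun n => Set.range fun q => S (periodPoly p n * q)) ?_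
      (fun n => infinite_range_comp_monic_mul S hS (periodPoly_monic n)) ?_ hsep
    · rintro _ ⟨f, rfl⟩ _ ⟨g, rfl⟩
      change T f * a * (T g * a) = 0
      rw [mul_assoc, ← mul_assoc a, haT, zero_mul, mul_zero]
    · rintro n _ ⟨q, rfl⟩
      exact ⟨_, rfl⟩
    · intro F _ _ φ
      obtain ⟨n, hn⟩ := exists_periodPoly_killed (p := p) φ b
      refine ⟨n, ?_⟩
      rintro _ ⟨q, rfl⟩
      change φ (T _ * a) = 0
      rw [map_mul, show φ (T _) = 0 from hn a q, zero_mul]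
  · rw [Set.not_infinite] at hS
    refine not_finitelySeparable_of_infinite_killed ((LinearMap.ker S).map T) ?_
      (fun n => (fun q => T (periodPoly p n * q)) '' {q | S (periodPoly p n * q) = 0}) ?_ ?_ ?_
      hsep
    · rintro _ ⟨f, hf, rfl⟩ _ ⟨g, -, rfl⟩
      have hf : T f * a = 0 := hf
      exact (mul_aeval_rightMul b a (T f) g).trans (by rw [hf, map_zero])
    · rintro n _ ⟨q, hq, rfl⟩
      exact ⟨_, hq, rfl⟩
    · intro n
      refine Set.Infinite.image (fun q _ r _ hqr => ?_) fun hfin => ?_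
      · exact mul_left_cancel₀ (periodPoly_monic n).ne_zero (hT hqr)
      · let U : (ZMod p)[X] →ₗ[ZMod p] K := S.comp (LinearMap.mulLeft (ZMod p) (periodPoly p n))
        have hU : (Set.range U).Finite :=
          hS.subset (Set.range_subset_iff.2 fun q => ⟨_, rfl⟩)
        have : Finite (LinearMap.ker U).toAddSubgroup := hfin
        have : Finite (LinearMap.range U) := hU
        have : Finite ((ZMod p)[X] ⧸ (LinearMap.ker U).toAddSubgroup) :=
          Finite.of_equiv _ U.quotKerEquivRange.symm.toEquiv
        have : Finite (ZMod p)[X] :=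
          Finite.of_equiv _ (AddSubgroup.addGroupEquivQuotientProdAddSubgroup
            (s := (LinearMap.ker U).toAddSubgroup)).symm
        exact not_finite (ZMod p)[X]
    · intro F _ _ φ
      obtain ⟨n, hn⟩ := exists_periodPoly_killed (p := p) φ b
      refine ⟨n, ?_⟩
      rintro _ ⟨q, -, rfl⟩
      exact hn a q

lemma mul_nupow (a b : K) (n : ℕ) : a * nupow b n = (rightMul p b ^ (n + 1)) a := by
  induction n with
  | zero => simp [nupow]
  | succ n ih => rw [nupow, ← mul_assoc, ih, pow_succ' _ (n + 1)]; rfl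

lemma mul_zEval (a b : K) {f : ℤ[X]} (hf : f.coeff 0 = 0) :
    a * zEval f b = aeval (rightMul p b) (f.map (Int.castRingHom (ZMod p))) a := by
  rw [zEval, Finset.mul_sum, aeval_def, eval₂_map, eval₂_eq_sum, Polynomial.sum,
    LinearMap.sum_apply]
  refine Finset.sum_congr rfl fun i hi => ?_
  obtain _ | n := i
  · exact absurd hf (mem_support_iff.1 hi)
  · rw [if_neg n.succ_ne_zero, mul_smul_comm, Nat.add_sub_cancel, mul_nupow (p := p)]
    simp

lemma exists_monic_int_mul_zEval_eq_zero [Fact p.Prime] (hsep : FinitelySeparable K) {a : K}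
    (ha : a * a = 0) (b : K) :
    ∃ f : ℤ[X], f.Monic ∧ f.coeff 0 = 0 ∧ a * zEval f b = 0 := by
  obtain ⟨g, hg0, hg⟩ := exists_ne_zero_aeval_rightMul_eq_zero (p := p) hsep ha b
  have hmonic : (g * C g.leadingCoeff⁻¹).Monic := monic_mul_leadingCoeff_inv hg0
  obtain ⟨f, hf, -, hfm⟩ := lifts_and_degree_eq_and_monic
    ((lifts_iff_coeff_lifts _).2 fun n => ZMod.intCast_surjective ((g * C g.leadingCoeff⁻¹).coeff n)
      : _ ∈ lifts (Int.castRingHom (ZMod p))) hmonic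
  refine ⟨X * f, monic_X.mul hfm, by simp, ?_⟩
  rw [mul_zEval (p := p) a b (by simp), Polynomial.map_mul, hf, mul_comm g, ← mul_assoc,
    map_mul, Module.End.mul_apply, hg, map_zero]

end

/-- If a (not necessarily unital) ring `K` of prime characteristic `p` is
finitely separable and `a² = 0` for some `a ∈ K`, then for every `b ∈ K` there is a monic
integer polynomial `f` with zero constant term such that `a * f (b) = 0`. -/
theorem stmt3 {K : Type*} [NonUnitalRing K] (p : ℕ) (hp : p.Prime)
    (hchar : ∀ c : K, p • c = 0) (hsep : FinitelySeparable K)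
    (a : K) (ha : a * a = 0) (b : K) :
    ∃ f : Polynomial ℤ, f.Monic ∧ f.coeff 0 = 0 ∧ a * zEval f b = 0 := by
  have : Fact p.Prime := ⟨hp⟩
  let _ : Module (ZMod p) K := AddCommGroup.zmodModule hchar
  exact exists_monic_int_mul_zEval_eq_zero (p := p) hsep ha b
end

section
/- Every primary ideal of a finitely separable finitely generated commutative (not necessarily unital) ring of prime characteristic is either a prime ideal or an ideal of finite index. -/
theorem map_nupow {K L : Type*} [NonUnitalNonAssocSemiring K] [NonUnitalNonAssocSemiring L]
    (f : K →ₙ+* L) (a : K) (n : ℕ) : f (nupow a n) = nupow (f a) n := by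
  induction n with
  | zero => rfl
  | succ n ih => simp only [nupow, map_mul, ih]

theorem nupow_eq_pow {M : Type*} [Monoid M] (a : M) (n : ℕ) : nupow a n = a ^ (n + 1) := by
  induction n with
  | zero => simp [nupow]
  | succ n ih => rw [nupow, ih, pow_succ a (n + 1)]

/-- The powers of an element of a finite structure are eventually periodic. -/
theorem exists_period_nupow {F : Type*} [Mul F] [Finite F] (x : F) :
    ∃ n m : ℕ, 0 < m ∧ ∀ k, n ≤ k → nupow x k = nupow x (k + m) := by
  obtain ⟨i, j, hij, h⟩ := Finite.exists_ne_map_eq_of_infinite (fun n : ℕ => nupow x n)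
  wlog hlt : i < j generalizing i j
  · exact this j i hij.symm h.symm (by omega)
  refine ⟨i, j - i, by omega, fun k hk => ?_⟩
  induction k, hk using Nat.le_induction with
  | base => rw [Nat.add_sub_cancel' hlt.le]; exact h
  | succ k _ ih =>
    rw [Nat.add_right_comm]
    simp only [nupow, ih]

/-- If the zero divisors are nilpotent and `y ↦ y * c` kills a nontrivial combination of the powers
of `x`, then `x` is integral over the ground field. -/
theorem isIntegral_inr_of_not_linearIndependent {R Q : Type*} [Field R] [NonUnitalCommRing Q]
    [Module R Q] [IsScalarTower R Q Q] [SMulCommClass R Q Q]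
    {c : Q} (hnil : ∀ y : Q, c * y = 0 → ∃ n, nupow y n = 0) {x : Q}
    (hx : ¬ LinearIndependent R (fun i : ℕ => c * nupow x i)) :
    IsIntegral R (Unitization.inr x : Unitization R Q) := by
  rw [linearIndependent_iff'] at hx
  push Not at hx
  obtain ⟨s, g, hsum, i, his, hgi⟩ := hx
  obtain ⟨n, hn⟩ := hnil (∑ j ∈ s, g j • nupow x j) (by
    rw [Finset.mul_sum, ← hsum]
    exact Finset.sum_congr rfl fun j _ => mul_smul_comm _ _ _)
  have hpow : ∀ (z : Q) (k : ℕ),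
      (Unitization.inr (nupow z k) : Unitization R Q) = Unitization.inr z ^ (k + 1) := by
    intro z k
    rw [← nupow_eq_pow]
    exact map_nupow (Unitization.inrNonUnitalAlgHom R Q : Q →ₙ+* Unitization R Q) z k
  let f : Polynomial R := ∑ j ∈ s, Polynomial.monomial (j + 1) (g j)
  have hf : f ≠ 0 := by
    intro h0
    apply hgi
    have := congrArg (fun q => Polynomial.coeff q (i + 1)) h0
    simpa [f, Polynomial.finsetSum_coeff, Polynomial.coeff_monomial, his] using this
  have hev : Polynomial.aeval (Unitization.inr x : Unitization R Q) f
      = Unitization.inr (∑ j ∈ s, g j • nupow x j) := by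
    have hmap := map_sum (Unitization.inrNonUnitalAlgHom R Q) (fun j => g j • nupow x j) s
    change Unitization.inr _ = ∑ j ∈ s, Unitization.inr (g j • nupow x j) at hmap
    rw [hmap, map_sum]
    refine Finset.sum_congr rfl fun j _ => ?_
    rw [Polynomial.aeval_monomial, Unitization.inr_smul, hpow, Algebra.smul_def]
  have halg : IsAlgebraic R (Unitization.inr x : Unitization R Q) := by
    refine ⟨f ^ (n + 1), pow_ne_zero _ hf, ?_⟩
    rw [map_pow, hev, ← hpow, hn, Unitization.inr_zero]
  exact halg.isIntegral

/-- A finitely generated commutative non-unital algebra over a finite field, all of whose elements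
are integral, is finite. -/
theorem finite_of_isIntegral_inr {R Q : Type*} [Field R] [Finite R] [NonUnitalCommRing Q]
    [Module R Q] [IsScalarTower R Q Q] [SMulCommClass R Q Q]
    {S : Set Q} (hS : S.Finite) (hgen : NonUnitalSubring.closure S = ⊤)
    (hint : ∀ x ∈ S, IsIntegral R (Unitization.inr x : Unitization R Q)) : Finite Q := by
  let T : Set (Unitization R Q) := Unitization.inr '' S
  have hfg : (Algebra.adjoin R T).toSubmodule.FG :=
    fg_adjoin_of_finite (hS.image _) (by rintro _ ⟨x, hx, rfl⟩; exact hint x hx)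
  have : Module.Finite R (Algebra.adjoin R T).toSubmodule := Module.Finite.iff_fg.mpr hfg
  have hfin : Finite (Algebra.adjoin R T).toSubmodule := Module.finite_of_finite R
  have hmem : ∀ x : Q, (Unitization.inr x : Unitization R Q) ∈ (Algebra.adjoin R T) := by
    intro x
    have hx : x ∈ NonUnitalSubring.closure S := hgen ▸ NonUnitalSubring.mem_top x
    induction hx using NonUnitalSubring.closure_induction with
    | mem x hx => exact Algebra.subset_adjoin ⟨x, hx, rfl⟩
    | zero => rw [Unitization.inr_zero]; exact zero_mem _
    | add x y _ _ hx hy => rw [Unitization.inr_add]; exact add_mem hx hy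
    | neg x _ hx => rw [Unitization.inr_neg]; exact neg_mem hx
    | mul x y _ _ hx hy => rw [Unitization.inr_mul]; exact mul_mem hx hy
  refine Finite.of_injective
    (fun x : Q => (⟨Unitization.inr x, hmem x⟩ : (Algebra.adjoin R T).toSubmodule)) ?_
  intro x y hxy
  exact Unitization.inr_injective (congrArg Subtype.val hxy)

/-- A finitely separable ring has no quotient with a square-zero element `c` and an element `x`
such that the products of `c` with the powers of `x` are linearly independent. -/
theorem not_linearIndependent_of_finitelySeparable {K R Q : Type*} [NonUnitalCommRing K]
    (hsep : FinitelySeparable K) [Field R] [NonUnitalCommRing Q] [Module R Q]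
    (π : K →ₙ+* Q) (hπ : Function.Surjective π) {c : Q} (hc : c * c = 0) (x : Q) :
    ¬ LinearIndependent R (fun i : ℕ => c * nupow x i) := by
  classical
  intro hli
  obtain ⟨l, hl⟩ : ∃ l : Q →ₗ[R] R, ∀ i, l (c * nupow x i) = if IsSquare i then 1 else 0 := by
    obtain ⟨l, hl⟩ := LinearMap.exists_extend
      ((Finsupp.linearCombination R (fun i : ℕ => if IsSquare i then (1 : R) else 0)) ∘ₗ
        hli.repr)
    refine ⟨l, fun i => ?_⟩
    have hi : c * nupow x i ∈ Submodule.span R (Set.range fun i : ℕ => c * nupow x i) :=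
      Submodule.subset_span ⟨i, rfl⟩
    have := LinearMap.congr_fun hl ⟨_, hi⟩
    simp only [LinearMap.comp_apply, Submodule.subtype_apply] at this
    rw [this, hli.repr_eq_single i ⟨_, hi⟩ rfl]
    simp
  obtain ⟨c', rfl⟩ := hπ c
  obtain ⟨x', rfl⟩ := hπ x
  let A : NonUnitalSubring K :=
    { carrier := {y | l (π y) = 0 ∧ ∃ z, π y = π c' * z}
      add_mem' := by
        rintro a b ⟨ha, u, hu⟩ ⟨hb, v, hv⟩
        exact ⟨by rw [map_add, map_add, ha, hb, add_zero], u + v, by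
          rw [map_add, hu, hv, mul_add]⟩
      zero_mem' := ⟨by simp, 0, by simp⟩
      neg_mem' := by
        rintro a ⟨ha, u, hu⟩
        exact ⟨by rw [map_neg, map_neg, ha, neg_zero], -u, by rw [map_neg, hu, mul_neg]⟩
      mul_mem' := by
        rintro a b ⟨_, u, hu⟩ ⟨_, v, hv⟩
        have h0 : π (a * b) = 0 := by
          rw [map_mul, hu, hv, mul_mul_mul_comm, hc, zero_mul]
        exact ⟨by rw [h0, map_zero], 0, by rw [h0, mul_zero]⟩ }
  have hπx : ∀ i, π (c' * nupow x' i) = π c' * nupow (π x') i := fun i => by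
    rw [map_mul, map_nupow]
  have ha : c' * nupow x' 0 ∉ A := by
    rintro ⟨h, -⟩
    rw [hπx, hl, if_pos (IsSquare.zero)] at h
    exact one_ne_zero h
  obtain ⟨F, _, _, φ, hφ⟩ := hsep _ A ha
  obtain ⟨n, m, hm, hper⟩ := exists_period_nupow (φ x')
  apply hφ
  let k := n + m
  have hk : n ≤ k * k := (Nat.le_add_right n m).trans (Nat.le_mul_self _)
  have hsq : ¬ IsSquare (k * k + m) := by
    rintro ⟨r, hr⟩
    have h1 : k < r := by nlinarith
    have h2 : m ≤ k := Nat.le_add_left m n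
    nlinarith
  refine ⟨c' * nupow x' 0 - c' * nupow x' (k * k) + c' * nupow x' (k * k + m), ⟨?_,
    nupow (π x') 0 - nupow (π x') (k * k) + nupow (π x') (k * k + m), ?_⟩, ?_⟩
  · simp only [map_add, map_sub, hπx]
    rw [hl, hl, hl, if_pos IsSquare.zero, if_pos ⟨k, rfl⟩, if_neg hsq]
    simp
  · simp only [map_add, map_sub, hπx, mul_add, mul_sub]
  · simp only [map_add, map_sub, map_mul, map_nupow, ← hper _ hk]
    simp

/-- If a nilpotent element is nonzero, some power of it is nonzero with square zero. -/
theorem exists_mul_self_eq_zero_of_nupow_eq_zero {Q : Type*} [NonUnitalCommRing Q] {b : Q}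
    (hb : b ≠ 0) {n : ℕ} (hn : nupow b n = 0) : ∃ c : Q, c ≠ 0 ∧ c * c = 0 := by
  have hdvd : ∀ k, ∃ z, nupow b k * nupow b k = nupow b (k + 1) * z ∨
      nupow b k * nupow b k = nupow b (k + 1) := by
    intro k
    cases k with
    | zero => exact ⟨0, Or.inr rfl⟩
    | succ k => exact ⟨nupow b k, Or.inl (by simp only [nupow]; ac_rfl)⟩
  induction n with
  | zero => exact absurd hn hb
  | succ n ih =>
    by_cases h : nupow b n = 0
    · exact ih h
    · obtain ⟨z, hz | hz⟩ := hdvd n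
      · exact ⟨_, h, by rw [hz, hn, zero_mul]⟩
      · exact ⟨_, h, by rw [hz, hn]⟩

/-- Every primary ideal of a finitely separable finitely generated commutative
(not necessarily unital) ring of prime characteristic is either a prime ideal or an ideal of
finite index. -/
theorem stmt4 {K : Type*} [NonUnitalCommRing K]
    (hfg : ∃ S : Finset K, NonUnitalSubring.closure (S : Set K) = ⊤)
    (p : ℕ) (hp : p.Prime) (hchar : ∀ c : K, p • c = 0)
    (hsep : FinitelySeparable K)
    (I : TwoSidedIdeal K) (hne : I ≠ ⊤)
    (hprimary : ∀ a b : K, a * b ∈ I → a ∈ I ∨ ∃ n : ℕ, nupow b n ∈ I) :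
    (I ≠ ⊤ ∧ ∀ a b : K, a * b ∈ I → a ∈ I ∨ b ∈ I) ∨ Finite I.ringCon.Quotient := by
  have : Fact p.Prime := ⟨hp⟩
  refine or_iff_not_imp_left.mpr fun hnot => ?_
  let π : K →ₙ+* I.ringCon.Quotient :=
    { toFun := fun a => (a : I.ringCon.Quotient)
      map_mul' := fun _ _ => rfl
      map_zero' := rfl
      map_add' := fun _ _ => rfl }
  have hπ : Function.Surjective π := Quotient.mk''_surjective
  have hker : ∀ a, π a = 0 ↔ a ∈ I := fun a =>
    (RingCon.eq I.ringCon (a := a) (b := 0)).trans (I.mem_iff a).symm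
  let _ : Module (ZMod p) I.ringCon.Quotient := AddCommGroup.zmodModule (n := p) (by
    intro y
    obtain ⟨y, rfl⟩ := hπ y
    rw [← map_nsmul, hchar, map_zero])
  have hsmul : ∀ (r : ZMod p) (y : I.ringCon.Quotient), r • y = r.val • y := by
    intro r y
    rw [← Nat.cast_smul_eq_nsmul (ZMod p), ZMod.natCast_zmod_val]
  have : IsScalarTower (ZMod p) I.ringCon.Quotient I.ringCon.Quotient :=
    ⟨fun r y z => by rw [hsmul, hsmul, smul_assoc]⟩
  have : SMulCommClass (ZMod p) I.ringCon.Quotient I.ringCon.Quotient :=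
    ⟨fun r y z => by rw [hsmul, hsmul, smul_comm]⟩
  push Not at hnot
  obtain ⟨a, b, hab, haI, hbI⟩ := hnot hne
  obtain ⟨n, hn⟩ := (hprimary a b hab).resolve_left haI
  obtain ⟨c, hc0, hcc⟩ := exists_mul_self_eq_zero_of_nupow_eq_zero
    (b := π b) (n := n) (fun h => hbI ((hker b).mp h)) (by rw [← map_nupow, hker]; exact hn)
  have hnil : ∀ y, c * y = 0 → ∃ n, nupow y n = 0 := by
    intro y hy
    obtain ⟨c, rfl⟩ := hπ c
    obtain ⟨y, rfl⟩ := hπ y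
    rw [← map_mul, hker] at hy
    obtain ⟨n, hn⟩ := (hprimary c y hy).resolve_left fun h => hc0 ((hker c).mpr h)
    exact ⟨n, by rw [← map_nupow, hker]; exact hn⟩
  obtain ⟨S, hS⟩ := hfg
  refine finite_of_isIntegral_inr (R := ZMod p) (S := π '' (S : Set K))
    (S.finite_toSet.image _) ?_ fun x _ =>
      isIntegral_inr_of_not_linearIndependent hnil
        (not_linearIndependent_of_finitelySeparable hsep π hπ hcc x)
  rw [← NonUnitalRingHom.map_closure, hS, ← NonUnitalRingHom.range_eq_map]
  exact NonUnitalRingHom.range_eq_top.mpr hπ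
end

section
/- If a finitely generated commutative (not necessarily unital) ring K is finitely separable, then there exists a squarefree natural number k such that K is a finite extension of its torsion ideal I_k, and I_k is isomorphic to a direct product of a finite collection of rings of pairwise distinct prime characteristics; more precisely, if k = p₁⋯p_n is the factorization of k into distinct primes, then I_k is the direct sum of the ideals (k/p_i)·I_k, and (k/p_i)·I_k has characteristic p_i. -/
/-- The image set `m • I_k = {m • x : x ∈ I_k}` of the `k`-torsion ideal of `K` under
multiplication by the natural number `m`. -/
def smulTorsion (K : Type*) [NonUnitalCommRing K] (k m : ℕ) : Set K :=
  (fun x : K => m • x) '' (torsionSubring K k : Set K)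

open Polynomial

theorem isIntegral_aeval_divX_iterate_mul {R S : Type*} [CommRing R] [CommRing S] [Algebra R S]
    (h : R[X]) (x : S) (hx : aeval x h = 0) (k : ℕ) :
    IsIntegral R (aeval x (divX^[k] h) * x) := by
  set n := h.natDegree + 1 with hn
  set M : Submodule R S := Submodule.span R ((fun i => x ^ i) '' (Finset.range n : Set ℕ)) with hM
  have hpow : ∀ i < n, x ^ i ∈ M := fun i hi =>
    Submodule.subset_span ⟨i, by simpa using hi, rfl⟩
  have hdeg : ∀ k, (divX^[k] h).natDegree < n := by
    intro k
    induction k with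
    | zero => simp [hn]
    | succ k ih =>
      rw [Function.iterate_succ_apply', natDegree_divX_eq_natDegree_tsub_one]
      omega
  have hmem : ∀ f : R[X], f.natDegree < n → aeval x f ∈ M := by
    intro f hf
    rw [aeval_eq_sum_range' hf]
    exact Submodule.sum_mem _ fun i hi => M.smul_mem _ (hpow i (Finset.mem_range.1 hi))
  have key : ∀ k, ∀ i < n, aeval x (divX^[k] h) * x ^ i ∈ M := by
    intro k
    induction k with
    | zero => intro i _; simp [hx]
    | succ k ih =>
      rintro (_ | i) hi
      · simpa using hmem _ (hdeg (k + 1))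
      · have e : aeval x (divX^[k + 1] h) * x ^ (i + 1) =
            aeval x (divX^[k] h) * x ^ i - (divX^[k] h).coeff 0 • x ^ i := by
          have := congrArg (aeval x) (divX_mul_X_add (divX^[k] h))
          rw [Function.iterate_succ_apply', ← this]
          simp only [map_add, map_mul, aeval_X, aeval_C, Algebra.smul_def]
          ring
        rw [e]
        exact M.sub_mem (ih i (by omega)) (M.smul_mem _ (hpow i (by omega)))
  set s := aeval x (divX^[k] h) * x with hs
  have hstab : ∀ m ∈ M, LinearMap.mulLeft R s m ∈ M := by
    intro m hm
    rw [LinearMap.mulLeft_apply]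
    induction hm using Submodule.span_induction with
    | mem m hm =>
      obtain ⟨i, hi, rfl⟩ := hm
      have hi : i < n := by simpa using hi
      rcases k with _ | k
      · simp [hs, hx]
      · have := key k i hi
        have e : s * x ^ i =
            aeval x (divX^[k] h) * x ^ i - (divX^[k] h).coeff 0 • x ^ i := by
          have := congrArg (aeval x) (divX_mul_X_add (divX^[k] h))
          rw [hs, Function.iterate_succ_apply', ← this]
          simp only [map_add, map_mul, aeval_X, aeval_C, Algebra.smul_def]
          ring
        simp only [e]
        exact M.sub_mem this (M.smul_mem _ (hpow i hi))
    | zero => simp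
    | add a b _ _ ha hb => rw [mul_add]; exact M.add_mem ha hb
    | smul r a _ ha => rw [mul_smul_comm]; exact M.smul_mem _ ha
  have : Module.Finite R M :=
    Module.Finite.iff_fg.2 (Submodule.fg_span ((Finset.finite_toSet _).image _))
  obtain ⟨f, hf, hf0⟩ := LinearMap.exists_monic_and_aeval_eq_zero R
    ((LinearMap.mulLeft R s).restrict hstab)
  refine ⟨f, hf, ?_⟩
  have haev : ∀ (g : R[X]) (m : M),
      ((aeval ((LinearMap.mulLeft R s).restrict hstab) g m : M) : S) = aeval s g * m := by
    intro g m
    induction g using Polynomial.induction_on' generalizing m with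
    | add a b ha hb => simp [ha, hb, add_mul]
    | monomial i r =>
      simp only [aeval_monomial, Module.End.mul_apply, Module.algebraMap_end_apply,
        Submodule.coe_smul]
      rw [Algebra.smul_def, mul_assoc]
      congr 1
      induction i generalizing m with
      | zero => simp
      | succ i ih => rw [pow_succ, Module.End.mul_apply, ih, pow_succ, mul_assoc]; simp
  have h1 := haev f ⟨1, by simpa using hpow 0 (by omega)⟩
  rw [hf0] at h1
  simpa [aeval_def] using h1.symm

theorem exists_isIntegral_pow_mul_of_mem_closure {S : Type*} [CommRing S] {x y z : S} {b c : ℤ}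
    (hy : IsIntegral ℤ y) (hx : IsIntegral ℤ ((c * b : ℤ) * x : S))
    (hz : z ∈ NonUnitalSubring.closure ({y, (b : S) * x} : Set S)) :
    ∃ D : ℕ, IsIntegral ℤ ((c : S) ^ D * z) := by
  have hc : IsIntegral ℤ (c : S) := by simpa using isIntegral_algebraMap (R := ℤ) (A := S) (x := c)
  induction hz using NonUnitalSubring.closure_induction with
  | mem z hz =>
    rcases hz with rfl | rfl
    · exact ⟨0, by simpa⟩
    · exact ⟨1, by simpa [mul_assoc] using hx⟩
  | zero => exact ⟨0, by simpa using isIntegral_zero⟩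
  | add u v _ _ hu hv =>
    obtain ⟨d, hd⟩ := hu
    obtain ⟨e, he⟩ := hv
    refine ⟨d + e, ?_⟩
    have := ((hc.pow e).mul hd).add ((hc.pow d).mul he)
    convert this using 1
    ring
  | neg u _ hu =>
    obtain ⟨d, hd⟩ := hu
    exact ⟨d, by simpa using hd.neg⟩
  | mul u v _ _ hu hv =>
    obtain ⟨d, hd⟩ := hu
    obtain ⟨e, he⟩ := hv
    refine ⟨d + e, ?_⟩
    have := hd.mul he
    convert this using 1
    ring

theorem exists_sub_mem_of_forall_prime {A : NonUnitalSubring ℤ[X]}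
    (hA : ∀ q : ℕ, q.Prime → ∃ b ∈ A, ∃ w, X = b + (q : ℤ[X]) * X * w) {N : ℕ} (hN : 0 < N) :
    ∀ v : ℤ[X], ∃ b ∈ A, ∃ w, X * v = b + (N : ℤ[X]) * X * w := by
  have hgen : ∀ M : ℕ, (∃ b ∈ A, ∃ w, X = b + (M : ℤ[X]) * X * w) →
      ∀ v : ℤ[X], ∃ b ∈ A, ∃ w, X * v = b + (M : ℤ[X]) * X * w := by
    rintro M ⟨b, hb, w, hw⟩ v
    induction v using Polynomial.induction_on with
    | C a =>
      refine ⟨a • b, A.zsmul_mem hb a, C a * w, ?_⟩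
      rw [zsmul_eq_mul]
      nth_rewrite 1 [hw]
      simp only [eq_intCast]
      ring
    | add f g hf hg =>
      obtain ⟨b1, hb1, w1, h1⟩ := hf
      obtain ⟨b2, hb2, w2, h2⟩ := hg
      exact ⟨b1 + b2, A.add_mem hb1 hb2, w1 + w2, by rw [mul_add, h1, h2]; ring⟩
    | monomial n a ih =>
      obtain ⟨b1, hb1, w1, h1⟩ := ih
      refine ⟨b1 * b, A.mul_mem hb1 hb, b1 * w + w1 * X, ?_⟩
      have : (X : ℤ[X]) * (C a * X ^ (n + 1)) = (X * (C a * X ^ n)) * X := by ring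
      rw [this, h1]
      linear_combination b1 * hw
  induction N using induction_on_primes with
  | zero => omega
  | one => exact fun v => ⟨0, A.zero_mem, v, by simp⟩
  | prime_mul p m hp ih =>
    intro v
    obtain ⟨b, hb, w, hw⟩ := ih (Nat.pos_of_mul_pos_left hN) v
    obtain ⟨b', hb', w', hw'⟩ := hgen p (hA p hp) w
    refine ⟨b + m • b', A.add_mem hb (A.nsmul_mem hb' m), w', ?_⟩
    rw [hw, nsmul_eq_mul]
    push_cast
    linear_combination (m : ℤ[X]) * hw'

/-- An ideal `I` of `ℤ[X]` such that `X * v` lies in a subring above `I` as soon as it lies in it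
modulo all ideals of finite index in the ideal generated by `X`. -/
def FiniteIndexClosed (I : Ideal ℤ[X]) : Prop :=
  ∀ A : NonUnitalSubring ℤ[X], (∀ f ∈ I, f ∈ A) → ∀ v : ℤ[X],
    (∀ J : Ideal ℤ[X], (∃ N : ℕ, 0 < N ∧ (N : ℤ[X]) * X ∈ J) →
      (∃ q : ℤ[X], q.Monic ∧ X * q ∈ J) → ∃ b ∈ A, X * v - b ∈ J) → X * v ∈ A

theorem FiniteIndexClosed.mono {I I' : Ideal ℤ[X]} (h : FiniteIndexClosed I) (hle : I ≤ I') :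
    FiniteIndexClosed I' :=
  fun A hA => h A fun f hf => hA f (hle hf)

theorem FiniteIndexClosed.X_mem {I : Ideal ℤ[X]} (hI : FiniteIndexClosed I)
    {A : NonUnitalSubring ℤ[X]} (hIA : ∀ f ∈ I, f ∈ A) {p : ℕ} (hp : p.Prime) {j : ℕ} {c : ℤ}
    (hc : ¬ (p : ℤ) ∣ c) {v : ℤ[X]} (h1 : (p : ℤ[X]) ^ j * X ∈ A)
    (h2 : (c : ℤ[X]) * X + (p : ℤ[X]) * X * v ∈ A) : X ∈ A := by
  have hA : ∀ q : ℕ, q.Prime → ∃ b ∈ A, ∃ w, X = b + (q : ℤ[X]) * X * w := by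
    intro q hq
    by_cases hqp : q = p
    · subst hqp
      obtain ⟨s, t, hst⟩ := ((Nat.prime_iff_prime_int.1 hp).coprime_iff_not_dvd).2 hc
      refine ⟨t • ((c : ℤ[X]) * X + (q : ℤ[X]) * X * v), A.zsmul_mem h2 t,
        (s : ℤ[X]) - t * v, ?_⟩
      have hst' : (s : ℤ[X]) * q + t * c = 1 := by exact_mod_cast congrArg (Int.cast (R := ℤ[X])) hst
      rw [zsmul_eq_mul]
      linear_combination - X * hst'
    · have : IsCoprime ((p : ℤ) ^ j) (q : ℤ) :=
        (Nat.isCoprime_iff_coprime.2 ((Nat.coprime_primes hp hq).2 (Ne.symm hqp))).pow_left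
      obtain ⟨s, t, hst⟩ := this
      refine ⟨s • ((p : ℤ[X]) ^ j * X), A.zsmul_mem h1 s, (t : ℤ[X]), ?_⟩
      have hst' : (s : ℤ[X]) * p ^ j + t * q = 1 := by
        exact_mod_cast congrArg (Int.cast (R := ℤ[X])) hst
      rw [zsmul_eq_mul]
      linear_combination - X * hst'
  have := hI A hIA 1 ?_
  · simpa using this
  · rintro J ⟨N, hN, hNJ⟩ -
    obtain ⟨b, hb, w, hw⟩ := exists_sub_mem_of_forall_prime hA hN 1
    exact ⟨b, hb, by rw [hw, add_sub_cancel_left]; exact J.mul_mem_right _ hNJ⟩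

theorem FiniteIndexClosed.ne_bot {I : Ideal ℤ[X]} (hI : FiniteIndexClosed I) : I ≠ ⊥ := by
  rintro rfl
  set ev : ℤ[X] →+* ℚ := eval₂RingHom (Int.castRingHom ℚ) (1 / 2) with hev
  set A : NonUnitalSubring ℤ[X] :=
    ((Int.castRingHom ℚ).comp (RingHom.id ℤ)).range.toNonUnitalSubring.comap ev with hA
  have hmem : ∀ f : ℤ[X], f ∈ A ↔ ∃ n : ℤ, (n : ℚ) = ev f := by
    intro f
    rw [hA, NonUnitalSubring.mem_comap]
    exact Iff.rfl
  have hX : X ∈ A := by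
    refine hI.X_mem ?_ Nat.prime_two (j := 1) (c := 1) (v := -X) (by norm_num) ?_ ?_
    · intro f hf
      rw [Ideal.mem_bot.1 hf]; exact A.zero_mem
    · rw [hmem]; exact ⟨1, by simp [hev]⟩
    · rw [hmem]; exact ⟨0, by simp [hev]⟩
  obtain ⟨n, hn⟩ := (hmem X).1 hX
  have h2 : (n : ℚ) * 2 = 1 := by rw [hn]; simp [hev]
  have : n * 2 = 1 := by exact_mod_cast h2
  omega

theorem coeff_divX_iterate {R : Type*} [Semiring R] (h : R[X]) (d i : ℕ) :
    (divX^[d] h).coeff i = h.coeff (i + d) := by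
  induction d generalizing i with
  | zero => rfl
  | succ d ih => rw [Function.iterate_succ_apply', coeff_divX, ih]; congr 1; ring

theorem FiniteIndexClosed.exists_not_dvd_leadingCoeff {I : Ideal ℤ[X]} (hI : FiniteIndexClosed I)
    {p : ℕ} (hp : p.Prime) {h : ℤ[X]} (hh : h ∈ I) {i : ℕ} (hi : ¬ (p : ℤ) ∣ h.coeff i) :
    ∃ f ∈ I, ¬ (p : ℤ) ∣ f.leadingCoeff := by
  have hp' := Nat.prime_iff_prime_int.1 hp
  have hfact : Fact p.Prime := ⟨hp⟩
  set g := h.map (Int.castRingHom (ZMod p)) with hg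
  have hcoeff : ∀ n, g.coeff n = 0 ↔ (p : ℤ) ∣ h.coeff n := fun n => by
    rw [hg, coeff_map, eq_intCast, ZMod.intCast_zmod_eq_zero_iff_dvd]
  have hg0 : g ≠ 0 := fun h0 => hi ((hcoeff i).1 (by simp [h0]))
  set d := g.natDegree with hd
  have hd1 : ¬ (p : ℤ) ∣ h.coeff d := by
    rw [← hcoeff]
    exact leadingCoeff_ne_zero.2 hg0
  have hd2 : ∀ n, d < n → (p : ℤ) ∣ h.coeff n := fun n hn => by
    rw [← hcoeff]
    exact coeff_eq_zero_of_natDegree_lt hn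
  have hh0 : h ≠ 0 := by rintro rfl; simp at hi
  obtain ⟨c, hc, hjc⟩ := (Int.finiteMultiplicity_iff.2
    ⟨by simpa using hp.ne_one, leadingCoeff_ne_zero.2 hh0⟩ :
    FiniteMultiplicity (p : ℤ) h.leadingCoeff).exists_eq_pow_mul_and_not_dvd
  set j := multiplicity (p : ℤ) h.leadingCoeff
  obtain ⟨w, hw⟩ : C (p : ℤ) ∣ divX^[d + 1] h := by
    rw [C_dvd_iff_dvd_coeff]
    intro n
    rw [coeff_divX_iterate]
    exact hd2 _ (by omega)
  set φ := Ideal.Quotient.mk I with hφ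
  have haev : ∀ f : ℤ[X], aeval (φ X) f = φ f := by
    intro f
    have : ((aeval (φ X) : ℤ[X] →ₐ[ℤ] ℤ[X] ⧸ I) : ℤ[X] →+* ℤ[X] ⧸ I) = φ := by
      ext <;> simp
    exact congrArg (fun r : ℤ[X] →+* ℤ[X] ⧸ I => r f) this
  have hroot : aeval (φ X) h = 0 := by rw [haev]; exact Ideal.Quotient.eq_zero_iff_mem.2 hh
  set y := divX^[d] h * X with hy
  have hyint : IsIntegral ℤ (φ y) := by
    have := isIntegral_aeval_divX_iterate_mul h (φ X) hroot d
    rwa [haev, ← map_mul] at this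
  have hxint : IsIntegral ℤ (((c * (p : ℤ) ^ j : ℤ) : ℤ[X] ⧸ I) * φ X) := by
    have := isIntegral_leadingCoeff_smul h (φ X) hroot
    rwa [hc, zsmul_eq_mul, mul_comm ((p : ℤ) ^ j)] at this
  set A : NonUnitalSubring ℤ[X] := (NonUnitalSubring.closure
    ({φ y, (((p : ℤ) ^ j : ℤ) : ℤ[X] ⧸ I) * φ X} : Set (ℤ[X] ⧸ I))).comap φ with hA
  have hXA : X ∈ A := by
    refine hI.X_mem ?_ hp (j := j) (c := h.coeff d) (v := w * X) hd1 ?_ ?_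
    · intro f hf
      rw [hA, NonUnitalSubring.mem_comap]
      have : φ f = 0 := Ideal.Quotient.eq_zero_iff_mem.2 hf
      exact this ▸ NonUnitalSubring.zero_mem _
    · rw [hA, NonUnitalSubring.mem_comap]
      refine NonUnitalSubring.subset_closure (Or.inr ?_)
      simp
    · rw [hA, NonUnitalSubring.mem_comap]
      refine NonUnitalSubring.subset_closure (Or.inl ?_)
      have e : (h.coeff d : ℤ[X]) * X + (p : ℤ[X]) * X * (w * X) = y := by
        have h1 := divX_mul_X_add (divX^[d] h)
        rw [← Function.iterate_succ_apply' divX d h, hw, coeff_divX_iterate, zero_add] at h1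
        simp only [eq_intCast, Int.cast_natCast] at h1
        rw [hy, ← h1]
        ring
      exact congrArg φ e
  rw [hA, NonUnitalSubring.mem_comap] at hXA
  obtain ⟨D, f, hf, hf0⟩ := exists_isIntegral_pow_mul_of_mem_closure hyint hxint hXA
  refine ⟨f.comp (C (c ^ D) * X), ?_, ?_⟩
  · rw [← Ideal.Quotient.eq_zero_iff_mem]
    change φ _ = 0
    rw [← haev, aeval_comp, haev, map_mul]
    rw [← hf0, aeval_def]
    congr 2
    simp
  · have hc0 : c ^ D ≠ 0 := pow_ne_zero _ fun h0 => hjc (h0 ▸ dvd_zero _)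
    rw [leadingCoeff_comp (by rw [natDegree_C_mul_X _ hc0]; exact one_ne_zero), hf.leadingCoeff,
      leadingCoeff_C_mul_X, one_mul, ← pow_mul]
    exact fun hdvd => hjc (hp'.dvd_of_dvd_pow hdvd)

theorem FiniteIndexClosed.exists_monic_mem {I : Ideal ℤ[X]} (hI : FiniteIndexClosed I)
    {h : ℤ[X]} (hh : h ∈ I) (hprim : h.IsPrimitive) : ∃ f ∈ I, f.Monic := by
  obtain ⟨g, hg⟩ := IsPrincipalIdealRing.principal I.leadingCoeff
  have hdvd : ∀ f ∈ I, g ∣ f.leadingCoeff := fun f hf => by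
    have : f.leadingCoeff ∈ I.leadingCoeff := (I.mem_leadingCoeff _).2 ⟨f, hf, rfl⟩
    rw [hg] at this
    exact Ideal.mem_span_singleton.1 this
  have hg1 : g.natAbs = 1 := by
    by_contra hne
    obtain ⟨p, hp, hpg⟩ := Nat.exists_prime_and_dvd hne
    have hpg' : (p : ℤ) ∣ g := Int.natCast_dvd.2 hpg
    obtain ⟨i, hi⟩ : ∃ i, ¬ (p : ℤ) ∣ h.coeff i := by
      by_contra! hall
      have := hprim _ ((C_dvd_iff_dvd_coeff _ _).2 hall)
      rw [Int.isUnit_iff_natAbs_eq] at this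
      exact hp.ne_one (by simpa using this)
    obtain ⟨f, hf, hpf⟩ := hI.exists_not_dvd_leadingCoeff hp hh hi
    exact hpf (hpg'.trans (hdvd f hf))
  have h1 : (1 : ℤ) ∈ I.leadingCoeff := by
    rw [hg]
    exact Ideal.mem_span_singleton.2 (Int.isUnit_iff_natAbs_eq.2 hg1).dvd
  obtain ⟨f, hf, hf1⟩ := (I.mem_leadingCoeff 1).1 h1
  exact ⟨f, hf, hf1⟩

theorem FiniteIndexClosed.exists_monic_natCast_mul_mem {I : Ideal ℤ[X]}
    (hI : FiniteIndexClosed I) :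
    ∃ N : ℕ, 0 < N ∧ ∃ f : ℤ[X], f.Monic ∧ (N : ℤ[X]) * f ∈ I := by
  obtain ⟨h, hh, h0⟩ := Submodule.exists_mem_ne_zero_of_ne_bot hI.ne_bot
  have hcont : ((h.content.natAbs : ℤ[X])) * h.primPart ∈ I := by
    have e := h.eq_C_content_mul_primPart
    rcases Int.natAbs_eq h.content with hN | hN
    · rw [e, hN] at hh
      simpa using hh
    · rw [e, hN] at hh
      simpa using hh
  obtain ⟨f, hf, hfm⟩ := (hI.mono (I' := Submodule.comap
    (LinearMap.mulLeft ℤ[X] (h.content.natAbs : ℤ[X])) I) fun f hf => I.mul_mem_left _ hf).exists_monic_mem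
    hcont h.isPrimitive_primPart
  exact ⟨h.content.natAbs, Int.natAbs_pos.2 (content_eq_zero_iff.not.2 h0), f, hfm, hf⟩

/-- The sum of the coefficients of a polynomial at the powers of `2`. -/
noncomputable def sumCoeffTwoPow : ℤ[X] →ₗ[ℤ] ℤ :=
  open Classical in lsum fun i => if ∃ m : ℕ, i = 2 ^ m then LinearMap.id else 0

theorem sumCoeffTwoPow_monomial_two_pow (m : ℕ) (c : ℤ) :
    sumCoeffTwoPow (monomial (2 ^ m) c) = c := by
  simp [sumCoeffTwoPow, lsum_apply]

theorem sumCoeffTwoPow_monomial_of_ne {i : ℕ} (hi : ∀ m : ℕ, i ≠ 2 ^ m) (c : ℤ) :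
    sumCoeffTwoPow (monomial i c) = 0 := by
  simp [sumCoeffTwoPow, lsum_apply, hi]

theorem exists_sumCoeffTwoPow_mul_eq_one {r : ℤ[X]} (hr : r.Monic) :
    ∃ s : ℤ[X], sumCoeffTwoPow (r * s) = 1 := by
  set D := r.natDegree with hD
  have hlt : D < 2 ^ D := Nat.lt_two_pow_self
  refine ⟨X ^ (2 ^ (D + 1) - D), ?_⟩
  have hpow : 2 ^ (D + 1) = 2 ^ D + 2 ^ D := by ring
  set j := 2 ^ (D + 1) - D with hj
  have e : r * X ^ j = monomial (2 ^ (D + 1)) 1 +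
      ∑ i ∈ Finset.range D, monomial (i + j) (r.coeff i) := by
    conv_lhs => rw [hr.as_sum]
    rw [add_mul, ← pow_add, Finset.sum_mul, ← hD, show D + j = 2 ^ (D + 1) by omega,
      X_pow_eq_monomial]
    congr 1
    refine Finset.sum_congr rfl fun i _ => ?_
    rw [mul_assoc, ← pow_add, C_mul_X_pow_eq_monomial]
  rw [e, map_add, sumCoeffTwoPow_monomial_two_pow, map_sum, Finset.sum_eq_zero, add_zero]
  intro i hi
  have hi := Finset.mem_range.1 hi
  refine sumCoeffTwoPow_monomial_of_ne (fun m hm => ?_) _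
  rcases Nat.lt_or_ge D m with h | h
  · have : 2 ^ (D + 1) ≤ 2 ^ m := Nat.pow_le_pow_right two_pos h
    omega
  · have : 2 ^ m ≤ 2 ^ D := Nat.pow_le_pow_right two_pos h
    omega

theorem exists_monic_dvd_mul_sub {p : ℕ} (hp : p.Prime) {u : ℤ[X]} (hu : ¬ C (p : ℤ) ∣ u) :
    ∃ g w : ℤ[X], g.Monic ∧ C (p : ℤ) ∣ g - u * w := by
  have : Fact p.Prime := ⟨hp⟩
  set ψ := Int.castRingHom (ZMod p) with hψ
  have hψs : Function.Surjective ψ := ZMod.intCast_surjective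
  have hdvd : ∀ f : ℤ[X], C (p : ℤ) ∣ f ↔ f.map ψ = 0 := by
    intro f
    rw [C_dvd_iff_dvd_coeff, Polynomial.ext_iff]
    simp [hψ, ZMod.intCast_zmod_eq_zero_iff_dvd]
  have hu0 : u.map ψ ≠ 0 := (hdvd u).not.1 hu
  obtain ⟨a, ha⟩ := hψs (u.map ψ).leadingCoeff⁻¹
  obtain ⟨g, hg, -, hgm⟩ := lifts_and_natDegree_eq_and_monic
    ((mem_lifts _).2 (map_surjective ψ hψs (u.map ψ * C (u.map ψ).leadingCoeff⁻¹)))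
    (monic_mul_leadingCoeff_inv hu0)
  refine ⟨g, C a, hgm, (hdvd _).2 ?_⟩
  rw [Polynomial.map_sub, hg, Polynomial.map_mul, map_C, ha, sub_self]

theorem FiniteIndexClosed.exists_monic_of_sq {I : Ideal ℤ[X]} (hI : FiniteIndexClosed I) {p : ℕ}
    (hp : p.Prime) {f : ℤ[X]} (hf : f.Monic) (hfI : (p : ℤ[X]) ^ 2 * f ∈ I) :
    ∃ g : ℤ[X], g.Monic ∧ (p : ℤ[X]) * g ∈ I := by
  set A : NonUnitalSubring ℤ[X] :=
    { carrier := {a | ∃ g, sumCoeffTwoPow g = 0 ∧ a - p * f * g ∈ I}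
      add_mem' := by
        rintro a b ⟨g, hg, ha⟩ ⟨g', hg', hb⟩
        refine ⟨g + g', by rw [map_add, hg, hg', add_zero], ?_⟩
        have := I.add_mem ha hb
        convert this using 1
        ring
      zero_mem' := ⟨0, map_zero _, by simp⟩
      neg_mem' := by
        rintro a ⟨g, hg, ha⟩
        refine ⟨-g, by rw [map_neg, hg, neg_zero], ?_⟩
        have := I.neg_mem ha
        convert this using 1
        ring
      mul_mem' := by
        rintro a b ⟨g, hg, ha⟩ ⟨g', hg', hb⟩
        refine ⟨0, map_zero _, ?_⟩
        have := I.add_mem (I.add_mem (I.mul_mem_left b ha) (I.mul_mem_left (p * f * g) hb))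
          (I.mul_mem_left (f * g * g') hfI)
        convert this using 1
        ring } with hA
  have hmem : ∀ a, a ∈ A ↔ ∃ g, sumCoeffTwoPow g = 0 ∧ a - p * f * g ∈ I := fun _ => Iff.rfl
  have hX : sumCoeffTwoPow X = 1 := by
    simpa [monomial_one_one_eq_X] using sumCoeffTwoPow_monomial_two_pow 0 1
  have hXA : X * ((p : ℤ[X]) * f) ∈ A := by
    refine hI A (fun a ha => (hmem a).2 ⟨0, map_zero _, by simpa using ha⟩) _ ?_
    rintro J - ⟨q, hq, hqJ⟩
    obtain ⟨s, hs⟩ := exists_sumCoeffTwoPow_mul_eq_one (monic_X.mul hq)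
    refine ⟨(p : ℤ[X]) * f * (X - X * q * s), (hmem _).2 ⟨X - X * q * s, ?_, by simp⟩, ?_⟩
    · rw [map_sub, hs, hX, sub_self]
    · have := J.mul_mem_left ((p : ℤ[X]) * f * s) hqJ
      convert this using 1
      ring
  obtain ⟨g, hg, hgI⟩ := (hmem _).1 hXA
  have hu : ¬ C (p : ℤ) ∣ X - g := by
    rintro ⟨w, hw⟩
    have : sumCoeffTwoPow (X - g) = p * sumCoeffTwoPow w := by
      rw [hw, ← smul_eq_C_mul, map_smul, smul_eq_mul]
    rw [map_sub, hX, hg, sub_zero] at this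
    exact (Nat.prime_iff_prime_int.1 hp).not_isUnit (IsUnit.of_mul_eq_one _ this.symm)
  obtain ⟨e, w, he, v, hv⟩ := exists_monic_dvd_mul_sub hp hu
  simp only [eq_intCast, Int.cast_natCast] at hv
  refine ⟨f * e, hf.mul he, ?_⟩
  have := I.add_mem (I.mul_mem_left w hgI) (I.mul_mem_left v hfI)
  convert this using 1
  linear_combination (p : ℤ[X]) * f * hv

theorem FiniteIndexClosed.exists_squarefree {I : Ideal ℤ[X]} (hI : FiniteIndexClosed I) :
    ∃ k : ℕ, Squarefree k ∧ ∃ f : ℤ[X], f.Monic ∧ (k : ℤ[X]) * f ∈ I := by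
  classical
  have hex := hI.exists_monic_natCast_mul_mem
  obtain ⟨hpos, f, hf, hfI⟩ := Nat.find_spec hex
  refine ⟨Nat.find hex, ?_, f, hf, hfI⟩
  rw [Nat.squarefree_iff_prime_squarefree]
  rintro p hp ⟨m, hm⟩
  rw [hm] at hfI
  have hm0 : 0 < m := Nat.pos_of_ne_zero fun h0 => by simp [h0] at hm
  obtain ⟨g, hg, hgI⟩ := (hI.mono (I' := Submodule.comap (LinearMap.mulLeft ℤ[X] (m : ℤ[X])) I)
    fun f hf => I.mul_mem_left _ hf).exists_monic_of_sq hp hf (by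
      change (m : ℤ[X]) * _ ∈ I
      convert hfI using 1
      push_cast
      ring)
  refine Nat.find_min hex (m := m * p) ?_ ⟨Nat.mul_pos hm0 hp.pos, g, hg, ?_⟩
  · rw [hm, mul_comm p p, mul_comm m p]
    have := Nat.mul_pos hp.pos hm0
    nlinarith [hp.two_le]
  · have : (m : ℤ[X]) * (p * g) ∈ I := hgI
    rwa [← mul_assoc, ← Nat.cast_mul] at this

universe u in
theorem exists_commRing_unitization (K : Type u) [NonUnitalCommRing K] :
    ∃ (U : Type u) (_ : CommRing U) (ι : K →ₙ+* U), Function.Injective ι ∧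
      ∀ u, ∃ (n : ℤ) (m : K), u = n + ι m := by
  refine ⟨Unitization ℤ K, inferInstance,
    { toFun := Unitization.inr
      map_mul' := Unitization.inr_mul ℤ
      map_zero' := Unitization.inr_zero ℤ
      map_add' := Unitization.inr_add ℤ }, Unitization.inr_injective, fun u => ?_⟩
  refine ⟨u.fst, u.snd, ?_⟩
  have : ((u.fst : ℤ) : Unitization ℤ K) = Unitization.inl u.fst :=
    (map_intCast (Unitization.inlRingHom ℤ K) u.fst).symm
  rw [this]
  exact (Unitization.inl_fst_add_inr_snd_eq u).symm

section Unitization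

variable {K U : Type*} [NonUnitalCommRing K] [CommRing U] {ι : K →ₙ+* U}

theorem FinitelySeparable.finiteIndexClosed_ker (hsep : FinitelySeparable K)
    (hU : ∀ u, ∃ (n : ℤ) (m : K), u = n + ι m) (a : K) :
    FiniteIndexClosed (RingHom.ker (eval₂RingHom (Int.castRingHom U) (ι a))) := by
  set ev := eval₂RingHom (Int.castRingHom U) (ι a) with hev
  have hmul : ∀ (u : U) (k : K), ∃ (n : ℤ) (m : K), u * ι k = ι (n • k + m * k) := by
    intro u k
    obtain ⟨n, m, rfl⟩ := hU u
    refine ⟨n, m, ?_⟩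
    rw [map_add, map_zsmul, map_mul, zsmul_eq_mul, add_mul]
  intro A hA v hv
  have hevX : ev X = ι a := by simp [hev]
  obtain ⟨n, m, hnm⟩ := hmul (ev v) a
  set g := n • a + m * a with hg
  have hevg : ev (X * v) = ι g := by rw [map_mul, hevX, mul_comm, hnm]
  have hgA : g ∈ (A.map (ev : ℤ[X] →ₙ+* U)).comap ι := by
    by_contra hgA
    obtain ⟨F, _, _, φ, hφ⟩ := hsep g _ hgA
    let J : Ideal ℤ[X] :=
      { carrier := {f | ∃ k, ev f = ι k ∧ φ k = 0}
        add_mem' := by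
          rintro f f' ⟨k, hk, hk0⟩ ⟨k', hk', hk0'⟩
          exact ⟨k + k', by rw [map_add, map_add, hk, hk'], by rw [map_add, hk0, hk0', add_zero]⟩
        zero_mem' := ⟨0, by simp, map_zero _⟩
        smul_mem' := by
          rintro c f ⟨k, hk, hk0⟩
          obtain ⟨n, m, h⟩ := hmul (ev c) k
          exact ⟨n • k + m * k, by rw [smul_eq_mul, map_mul, hk, h],
            by rw [map_add, map_zsmul, map_mul, hk0, smul_zero, mul_zero, add_zero]⟩ }
    obtain ⟨b, hb, k, hk, hk0⟩ := hv J ⟨Nat.card F, Nat.card_pos, Nat.card F • a, by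
        simp [hevX], by rw [map_nsmul, card_nsmul_eq_zero']⟩ (by
      have hpow : ∀ i : ℕ, ∃ k, ev (X ^ (i + 1)) = ι k := by
        intro i
        obtain ⟨n, m, h⟩ := hmul (ev (X ^ i)) a
        exact ⟨_, by rw [pow_succ, map_mul, hevX, h]⟩
      choose k hk using hpow
      obtain ⟨i, j, hij, hφij⟩ := Finite.exists_ne_map_eq_of_infinite fun i => φ (k i)
      wlog hlt : j < i generalizing i j
      · exact this j i hij.symm hφij.symm (lt_of_le_of_ne (not_lt.1 hlt) hij)
      refine ⟨X ^ i - X ^ j, monic_X_pow_sub (by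
        rw [degree_X_pow]; exact_mod_cast hlt), k i - k j, ?_, ?_⟩
      · rw [map_sub, ← hk, ← hk, ← map_sub]
        congr 1
        ring
      · rw [map_sub, sub_eq_zero]
        exact hφij)
    rw [map_sub, hevg, sub_eq_iff_eq_add', ← sub_eq_iff_eq_add, ← map_sub] at hk
    refine hφ ⟨g - k, ⟨b, hb, hk.symm⟩, by rw [map_sub, hk0, sub_zero]⟩
  obtain ⟨f, hf, hfg⟩ := hgA
  have hfg' : ev f = ev (X * v) := hfg.trans hevg.symm
  have := A.add_mem hf (hA (X * v - f) (by rw [RingHom.mem_ker, map_sub, hfg', sub_self]))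
  rwa [add_sub_cancel] at this

theorem FinitelySeparable.exists_squarefree (hsep : FinitelySeparable K)
    (hU : ∀ u, ∃ (n : ℤ) (m : K), u = n + ι m) (a : K) :
    ∃ k : ℕ, Squarefree k ∧ ∃ f : ℤ[X], f.Monic ∧ (k : U) * aeval (ι a) f = 0 := by
  obtain ⟨k, hk, f, hf, hfk⟩ := (hsep.finiteIndexClosed_ker hU a).exists_squarefree
  refine ⟨k, hk, f, hf, ?_⟩
  simpa [aeval_def] using hfk

theorem adjoin_image_eq_top (hU : ∀ u, ∃ (n : ℤ) (m : K), u = n + ι m) {S : Set K}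
    (hS : NonUnitalSubring.closure S = ⊤) : Algebra.adjoin ℤ (ι '' S) = ⊤ := by
  refine eq_top_iff.2 ?_
  rintro u -
  obtain ⟨n, m, rfl⟩ := hU u
  refine add_mem (intCast_mem _ n) ?_
  have hm : m ∈ NonUnitalSubring.closure S := hS ▸ NonUnitalSubring.mem_top m
  induction hm using NonUnitalSubring.closure_induction with
  | mem x hx => exact Algebra.subset_adjoin ⟨x, hx, rfl⟩
  | zero => rw [map_zero]; exact zero_mem _
  | add x y _ _ hx hy => rw [map_add]; exact add_mem hx hy
  | neg x _ hx => rw [map_neg]; exact neg_mem hx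
  | mul x y _ _ hx hy => rw [map_mul]; exact mul_mem hx hy

end Unitization

theorem countable_of_closure_eq_top {K : Type*} [NonUnitalCommRing K] {S : Finset K}
    (hS : NonUnitalSubring.closure (S : Set K) = ⊤) : Countable K := by
  obtain ⟨U, _, ι, hι, hU⟩ := exists_commRing_unitization K
  have htop := adjoin_image_eq_top hU hS
  have : Countable (ι '' (S : Set K)) := (S.finite_toSet.image ι).countable
  have hsurj : Function.Surjective
      (MvPolynomial.aeval (R := ℤ) ((↑) : (ι '' (S : Set K)) → U)) := by
    rw [← AlgHom.range_eq_top, ← Algebra.adjoin_range_eq_range_aeval, Subtype.range_coe, htop]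
  have : Countable U := by
    have : Countable (MvPolynomial (ι '' (S : Set K)) ℤ) := by
      rw [← Cardinal.mk_le_aleph0_iff]
      refine MvPolynomial.cardinalMk_le_max_lift.trans ?_
      simp
    exact hsurj.countable
  exact hι.countable

theorem FinitelySeparable.exists_squarefree_fg {K : Type*} [NonUnitalCommRing K]
    (hsep : FinitelySeparable K) {S : Finset K}
    (hS : NonUnitalSubring.closure (S : Set K) = ⊤) :
    ∃ k : ℕ, Squarefree k ∧ AddGroup.FG (K ⧸ torsionAddSubgroup K k) := by
  obtain ⟨U, _, ι, hι, hU⟩ := exists_commRing_unitization K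
  choose m hm f hf hmf using hsep.exists_squarefree hU
  obtain ⟨k, hk, hdvd⟩ : ∃ k : ℕ, Squarefree k ∧ ∀ a ∈ S, m a ∣ k := by
    refine ⟨UniqueFactorizationMonoid.radical (∏ a ∈ S, m a),
      UniqueFactorizationMonoid.squarefree_radical, fun a ha => ?_⟩
    exact (UniqueFactorizationMonoid.dvd_radical_iff (hm a).isRadical
      (Finset.prod_ne_zero_iff.2 fun b _ => (hm b).ne_zero)).2 (Finset.dvd_prod_of_mem m ha)
  refine ⟨k, hk, ?_⟩
  let T : Ideal U :=
    { carrier := {u | (k : U) * u = 0 ∧ ∃ x, u = ι x}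
      add_mem' := by
        rintro u v ⟨hu, x, rfl⟩ ⟨hv, y, rfl⟩
        exact ⟨by rw [mul_add, hu, hv, add_zero], x + y, (map_add _ _ _).symm⟩
      zero_mem' := ⟨mul_zero _, 0, (map_zero _).symm⟩
      smul_mem' := by
        rintro c u ⟨hu, x, rfl⟩
        obtain ⟨n, y, rfl⟩ := hU c
        refine ⟨by rw [smul_eq_mul, mul_left_comm, hu, mul_zero], n • x + y * x, ?_⟩
        rw [map_add, map_zsmul, map_mul, zsmul_eq_mul, smul_eq_mul, add_mul] }
  have hT : ∀ x, ι x ∈ T ↔ k • x = 0 := by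
    intro x
    have : (k : U) * ι x = 0 ↔ k • x = 0 := by
      rw [← nsmul_eq_mul, ← map_nsmul, ← map_zero ι, hι.eq_iff]
    exact ⟨fun h => this.1 h.1, fun h => ⟨this.2 h, x, rfl⟩⟩
  set π := Ideal.Quotient.mkₐ ℤ T with hπ
  have hπs : Function.Surjective π := Ideal.Quotient.mkₐ_surjective ℤ T
  have htop : Algebra.adjoin ℤ (π '' (ι '' (S : Set K))) = ⊤ := by
    rw [← AlgHom.map_adjoin, adjoin_image_eq_top (ι := ι) hU hS, Algebra.map_top, AlgHom.range_eq_top]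
    exact hπs
  have hfin : Module.Finite ℤ (U ⧸ T) := by
    rw [Module.finite_def, ← Algebra.top_toSubmodule, ← htop]
    refine fg_adjoin_of_finite ((S.finite_toSet.image _).image _) ?_
    rintro _ ⟨_, ⟨a, ha, rfl⟩, rfl⟩
    refine ⟨X * f a, monic_X.mul (hf a), ?_⟩
    rw [← aeval_def, aeval_algHom_apply]
    refine Ideal.Quotient.eq_zero_iff_mem.2 ?_
    obtain ⟨n, y, hy⟩ := hU (aeval (ι a) (f a))
    obtain ⟨c, hc⟩ := hdvd a ha
    refine ⟨?_, n • a + a * y, ?_⟩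
    · rw [map_mul, mul_left_comm, hc, Nat.cast_mul, mul_comm (m a : U), mul_assoc, hmf, mul_zero,
        mul_zero]
    · rw [map_mul, aeval_X, hy, map_add, map_zsmul, map_mul, zsmul_eq_mul]
      ring
  let g : K ⧸ torsionAddSubgroup K k →+ U ⧸ T :=
    QuotientAddGroup.lift _ ((π : U →+ U ⧸ T).comp (ι : K →+ U)) fun x hx =>
      Ideal.Quotient.eq_zero_iff_mem.2 ((hT x).2 hx)
  have hg : Function.Injective g := by
    rw [injective_iff_map_eq_zero]
    intro x
    induction x using QuotientAddGroup.induction_on with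
    | H x =>
      intro hx
      exact (QuotientAddGroup.eq_zero_iff x).2 ((hT x).1 (Ideal.Quotient.eq_zero_iff_mem.1 hx))
  rw [← Module.Finite.iff_addGroup_fg]
  exact Module.Finite.of_injective g.toIntLinearMap hg

theorem eq_zero_of_coprime_nsmul {G : Type*} [AddGroup G] {a b : ℕ} (hab : a.Coprime b) {x : G}
    (ha : a • x = 0) (hb : b • x = 0) : x = 0 := by
  rw [← AddMonoid.addOrderOf_eq_one_iff, ← Nat.dvd_one, ← hab]
  exact Nat.dvd_gcd (addOrderOf_dvd_of_nsmul_eq_zero ha) (addOrderOf_dvd_of_nsmul_eq_zero hb)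

theorem mem_torsionSubring {K : Type*} [NonUnitalCommRing K] {k : ℕ} {x : K} :
    x ∈ torsionSubring K k ↔ k • x = 0 := Iff.rfl

theorem mem_smulTorsion_iff {K : Type*} [NonUnitalCommRing K] {k p : ℕ} (hk : Squarefree k)
    (hpk : p ∣ k) {y : K} : y ∈ smulTorsion K k (k / p) ↔ p • y = 0 := by
  obtain ⟨m, rfl⟩ := hpk
  have hp0 : 0 < p := Nat.pos_of_ne_zero fun h => hk.ne_zero (by simp [h])
  rw [Nat.mul_div_cancel_left m hp0]
  constructor
  · rintro ⟨x, hx, rfl⟩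
    rw [← mul_nsmul']
    exact hx
  · intro hy
    obtain ⟨s, t, hst⟩ := Nat.isCoprime_iff_coprime.2 (Nat.coprime_of_squarefree_mul hk)
    have hy' : (p : ℤ) • y = 0 := by rw [natCast_zsmul, hy]
    refine ⟨t • y, ?_, ?_⟩
    · change (p * m) • t • y = 0
      rw [smul_comm, mul_comm, mul_nsmul', hy, smul_zero, smul_zero]
    · change m • t • y = y
      rw [← natCast_zsmul, ← mul_zsmul']
      conv_rhs => rw [← one_zsmul y, ← hst, add_zsmul, mul_zsmul, hy', smul_zero, zero_add]

section PrimeDecomposition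

variable {G ι : Type*} [AddCommGroup G] [Fintype ι] {q : ι → ℕ}

theorem exists_sum_eq_of_prod_nsmul_eq_zero (hq : Pairwise (Function.onFun Nat.Coprime q)) {x : G}
    (hx : (∏ i, q i) • x = 0) : ∃ f : ι → G, (∀ i, q i • f i = 0) ∧ x = ∑ i, f i := by
  classical
  rcases isEmpty_or_nonempty ι with hι | hι
  · exact ⟨fun _ => 0, fun _ => smul_zero _, by simpa using hx⟩
  obtain ⟨μ, hμ⟩ := (exists_sum_eq_one_iff_pairwise_coprime' (s := fun i => (q i : ℤ))).2
    fun i j hij => Nat.isCoprime_iff_coprime.2 (hq hij)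
  refine ⟨fun i => (μ i * ∏ j ∈ {i}ᶜ, (q j : ℤ)) • x, fun i => ?_, ?_⟩
  · have e : (q i : ℤ) * (μ i * ∏ j ∈ {i}ᶜ, (q j : ℤ)) = μ i * ((∏ i, q i : ℕ) : ℤ) := by
      rw [Fintype.prod_eq_mul_prod_compl i]
      push_cast
      ring
    rw [← natCast_zsmul, ← mul_zsmul', mul_comm, e, mul_zsmul, natCast_zsmul, hx, smul_zero]
  · rw [← Finset.sum_smul, hμ, one_zsmul]

theorem eq_of_sum_eq_of_nsmul_eq_zero (hq : Pairwise (Function.onFun Nat.Coprime q)) {f g : ι → G}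
    (hf : ∀ i, q i • f i = 0) (hg : ∀ i, q i • g i = 0) (h : ∑ i, f i = ∑ i, g i) : f = g := by
  classical
  funext i
  rw [← sub_eq_zero]
  have hd : ∀ j, q j • (f j - g j) = 0 := fun j => by rw [smul_sub, hf, hg, sub_zero]
  refine eq_zero_of_coprime_nsmul (b := ∏ j ∈ {i}ᶜ, q j) (Nat.Coprime.prod_right fun j hj =>
    hq (by simpa [eq_comm] using hj)) (hd i) ?_
  have hsum : ∑ j, (∏ j ∈ {i}ᶜ, q j) • (f j - g j) = 0 := by
    rw [← Finset.smul_sum, Finset.sum_sub_distrib, h, sub_self, smul_zero]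
  rwa [Finset.sum_eq_single i] at hsum
  · intro j _ hj
    obtain ⟨m, hm⟩ := Finset.dvd_prod_of_mem q (show j ∈ ({i} : Finset ι)ᶜ by simpa using hj)
    rw [hm, mul_nsmul, hd, smul_zero]
  · simp

end PrimeDecomposition

theorem nonempty_torsionSubring_ringEquiv_pi (K : Type*) [NonUnitalCommRing K] {ι : Type*}
    [Fintype ι] {q : ι → ℕ} (hq : Pairwise (Function.onFun Nat.Coprime q)) :
    Nonempty (torsionSubring K (∏ i, q i) ≃+* ∀ i, torsionSubring K (q i)) := by
  classical
  have hsum : ∀ y : ∀ i, torsionSubring K (q i), ∑ i, (y i : K) ∈ torsionSubring K (∏ i, q i) := by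
    intro y
    refine sum_mem fun i _ => ?_
    obtain ⟨m, hm⟩ := Finset.dvd_prod_of_mem q (Finset.mem_univ i)
    rw [mem_torsionSubring, hm, mul_nsmul, mem_torsionSubring.1 (y i).2, smul_zero]
  let Ψ : (∀ i, torsionSubring K (q i)) →ₙ+* torsionSubring K (∏ i, q i) :=
    { toFun := fun y => ⟨∑ i, (y i : K), hsum y⟩
      map_mul' := fun y z => Subtype.ext <| by
        change ∑ i, (y i : K) * z i = (∑ i, (y i : K)) * ∑ i, (z i : K)
        rw [Finset.sum_mul_sum]
        refine Finset.sum_congr rfl fun i _ => ?_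
        rw [Finset.sum_eq_single i _ fun h => (h (Finset.mem_univ i)).elim]
        intro j _ hj
        refine eq_zero_of_coprime_nsmul (hq hj.symm) ?_ ?_
        · rw [← smul_mul_assoc, mem_torsionSubring.1 (y i).2, zero_mul]
        · rw [← mul_smul_comm, mem_torsionSubring.1 (z j).2, mul_zero]
      map_zero' := Subtype.ext <| by simp
      map_add' := fun y z => Subtype.ext <| by simp [Finset.sum_add_distrib] }
  refine ⟨(RingEquiv.ofBijective Ψ ⟨fun y z h => ?_, fun x => ?_⟩).symm⟩
  · have := eq_of_sum_eq_of_nsmul_eq_zero hq (fun i => mem_torsionSubring.1 (y i).2)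
      (fun i => mem_torsionSubring.1 (z i).2) (congrArg Subtype.val h)
    exact funext fun i => Subtype.ext (congrFun this i)
  · obtain ⟨f, hf, hx⟩ := exists_sum_eq_of_prod_nsmul_eq_zero hq (mem_torsionSubring.1 x.2)
    exact ⟨fun i => ⟨f i, hf i⟩, Subtype.ext hx.symm⟩

theorem exists_type_zero_ringEquiv (R : Type*) [NonUnitalRing R] [Countable R] :
    ∃ (R' : Type) (_ : NonUnitalRing R'), Nonempty (R ≃+* R') :=
  ⟨Shrink.{0} R, inferInstance, ⟨(Shrink.ringEquiv.{0} R).symm⟩⟩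
/-- If a finitely generated commutative (not necessarily unital) ring `K` is
finitely separable, then there is a squarefree `k` such that `K` is a finite extension of its
torsion ideal `I_k`, and `I_k` is isomorphic to a direct product of finitely many rings of
pairwise distinct prime characteristics; more precisely, for the factorization `k = p₁ ⋯ p_n`
into distinct primes, `I_k` is the direct sum of the ideals `(k / pᵢ) • I_k`, and
`(k / pᵢ) • I_k` has characteristic `pᵢ`. -/
theorem stmt7 {K : Type*} [NonUnitalCommRing K]
    (hfg : ∃ S : Finset K, NonUnitalSubring.closure (S : Set K) = ⊤)
    (hsep : FinitelySeparable K) :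
    ∃ k : ℕ, Squarefree k ∧
      AddGroup.FG (K ⧸ torsionAddSubgroup K k) ∧
      ∃ (n : ℕ) (q : Fin n → ℕ),
        (∀ i, (q i).Prime) ∧ Function.Injective q ∧ k = ∏ i, q i ∧
        -- `I_k` is isomorphic to a direct product of rings of pairwise distinct prime
        -- characteristics `q i`
        (∃ (R : Fin n → Type) (_ : ∀ i, NonUnitalRing (R i)),
          (∀ i, ∀ c : R i, q i • c = 0) ∧
          Nonempty (torsionSubring K k ≃+* ∀ i, R i)) ∧
        -- each `(k / q i) • I_k` has characteristic `q i` …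
        (∀ i, ∀ y ∈ smulTorsion K k (k / q i), q i • y = 0) ∧
        -- … and is an ideal of `I_k`
        (∀ i, ∀ y ∈ smulTorsion K k (k / q i), y ∈ torsionSubring K k) ∧
        (∀ i, ∀ y ∈ smulTorsion K k (k / q i), ∀ z ∈ smulTorsion K k (k / q i),
          y + z ∈ smulTorsion K k (k / q i) ∧ -y ∈ smulTorsion K k (k / q i)) ∧
        (∀ i, ∀ y ∈ smulTorsion K k (k / q i), ∀ r ∈ torsionSubring K k,
          r * y ∈ smulTorsion K k (k / q i)) ∧
        -- `I_k` is the direct sum of the ideals `(k / q i) • I_k`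
        (∀ x ∈ torsionSubring K k, ∃ f : Fin n → K,
          (∀ i, f i ∈ smulTorsion K k (k / q i)) ∧ x = ∑ i, f i) ∧
        (∀ f g : Fin n → K,
          (∀ i, f i ∈ smulTorsion K k (k / q i)) →
          (∀ i, g i ∈ smulTorsion K k (k / q i)) →
          ∑ i, f i = ∑ i, g i → f = g) := by
  obtain ⟨S, hS⟩ := hfg
  obtain ⟨k, hk, hkfg⟩ := hsep.exists_squarefree_fg hS
  have hcount := countable_of_closure_eq_top hS
  let e := k.primeFactors.equivFin.symm
  let q : Fin k.primeFactors.card → ℕ := fun i => e i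
  have hq : ∀ i, (q i).Prime := fun i => Nat.prime_of_mem_primeFactors (e i).2
  have hinj : Function.Injective q := Subtype.val_injective.comp e.injective
  have hprod : k = ∏ i, q i := by
    rw [e.prod_comp (fun p => (p : ℕ)), Finset.prod_coe_sort k.primeFactors (fun p => p),
      Nat.prod_primeFactors_of_squarefree hk]
  have hcop : Pairwise (Function.onFun Nat.Coprime q) := fun i j hij =>
    (Nat.coprime_primes (hq i) (hq j)).2 (hinj.ne hij)
  have hmem : ∀ i (y : K), y ∈ smulTorsion K k (k / q i) ↔ q i • y = 0 := fun i y =>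
    mem_smulTorsion_iff hk (Nat.dvd_of_mem_primeFactors (e i).2)
  refine ⟨k, hk, hkfg, k.primeFactors.card, q, hq, hinj, hprod, ?_, ?_, ?_, ?_, ?_, ?_, ?_⟩
  · choose R hR hKR using fun i => exists_type_zero_ringEquiv (torsionSubring K (q i))
    refine ⟨R, hR, fun i c => ?_, ?_⟩
    · obtain ⟨x, rfl⟩ := (hKR i).some.surjective c
      rw [← map_nsmul, show q i • x = 0 from Subtype.ext x.2, map_zero]
    · obtain ⟨Ψ⟩ := nonempty_torsionSubring_ringEquiv_pi K hcop
      rw [← hprod] at Ψ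
      exact ⟨Ψ.trans (RingEquiv.piCongrRight fun i => (hKR i).some)⟩
  · exact fun i y hy => (hmem i y).1 hy
  · intro i y hy
    obtain ⟨m, hm⟩ := Nat.dvd_of_mem_primeFactors (e i).2
    rw [mem_torsionSubring, hm, mul_nsmul, (hmem i y).1 hy, smul_zero]
  · intro i y hy z hz
    rw [hmem] at hy hz
    rw [hmem, hmem, smul_add, smul_neg, hy, hz]
    simp
  · intro i y hy r _
    rw [hmem] at hy ⊢
    rw [← mul_smul_comm, hy, mul_zero]
  · intro x hx
    obtain ⟨f, hf, hxf⟩ := exists_sum_eq_of_prod_nsmul_eq_zero hcop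
      (hprod ▸ mem_torsionSubring.1 hx)
    exact ⟨f, fun i => (hmem i _).2 (hf i), hxf⟩
  · exact fun f g hf hg h => eq_of_sum_eq_of_nsmul_eq_zero hcop (fun i => (hmem i _).1 (hf i))
      (fun i => (hmem i _).1 (hg i)) h
end

section
/- If a finitely generated commutative (not necessarily unital) ring K of prime characteristic is finitely separable, then K is a subdirect product of a finite ring and a finite collection of rings without zero divisors. -/
namespace FinitelySeparable

universe u

/-- Every commutative ring embeds into a unital commutative ring generated by it and `1`. -/
theorem exists_unitization (K : Type u) [NonUnitalCommRing K] :
    ∃ (R : Type u) (_ : CommRing R) (ι : K →ₙ+* R), Function.Injective ι ∧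
      ∀ r : R, ∃ (n : ℤ) (k : K), (n : R) + ι k = r := by
  refine ⟨Unitization ℤ K, inferInstance,
    { toFun := Unitization.inr
      map_zero' := Unitization.inr_zero ℤ
      map_add' := Unitization.inr_add ℤ
      map_mul' := Unitization.inr_mul ℤ }, Unitization.inr_injective, fun r => ⟨r.fst, r.snd, ?_⟩⟩
  rw [← eq_intCast (Unitization.inlRingHom ℤ K) r.fst]
  exact Unitization.inl_fst_add_inr_snd_eq r

section

variable {K : Type*} [NonUnitalCommRing K] {R : Type*} [CommRing R] {ι : K →ₙ+* R}

theorem finiteType_of_closure_eq_top (hι : ∀ r : R, ∃ (n : ℤ) (k : K), (n : R) + ι k = r)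
    {S : Finset K} (hS : NonUnitalSubring.closure (S : Set K) = ⊤) : Algebra.FiniteType ℤ R := by
  classical
  let A : Subalgebra ℤ R := Algebra.adjoin ℤ (ι '' (S : Set K))
  have hA : ∀ k : K, ι k ∈ A := by
    intro k
    have hk : k ∈ NonUnitalSubring.closure (S : Set K) := by rw [hS]; trivial
    induction hk using NonUnitalSubring.closure_induction with
    | mem x hx => exact Algebra.subset_adjoin ⟨x, hx, rfl⟩
    | zero => rw [map_zero]; exact A.zero_mem
    | add x y _ _ hx hy => rw [map_add]; exact A.add_mem hx hy
    | neg x _ hx => rw [map_neg]; exact A.neg_mem hx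
    | mul x y _ _ hx hy => rw [map_mul]; exact A.mul_mem hx hy
  refine ⟨⟨S.image ι, ?_⟩⟩
  rw [Finset.coe_image, eq_top_iff]
  rintro x -
  obtain ⟨n, k, rfl⟩ := hι x
  exact A.add_mem (A.intCast_mem n) (hA k)

/-- An embedded commutative ring is an ideal of any unital ring generated by it and `1`. -/
theorem exists_eq_mul (hι : ∀ r : R, ∃ (n : ℤ) (k : K), (n : R) + ι k = r) (r : R) (k : K) :
    ∃ l : K, ι l = r * ι k ∧
      ∀ {F : Type} [NonUnitalRing F] (φ : K →ₙ+* F), φ k = 0 → φ l = 0 := by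
  obtain ⟨n, m, rfl⟩ := hι r
  exact ⟨n • k + m * k, by rw [map_add, map_zsmul, map_mul, add_mul, zsmul_eq_mul],
    fun φ h => by simp [map_zsmul, h]⟩

theorem countable_of_finiteType_int (R : Type*) [CommRing R] [Algebra.FiniteType ℤ R] :
    Countable R := by
  obtain ⟨n, f, hf⟩ := Algebra.FiniteType.iff_quotient_mvPolynomial''.mp ‹Algebra.FiniteType ℤ R›
  have : Countable (MvPolynomial (Fin n) ℤ) := AddMonoidAlgebra.coeff_injective.countable
  exact hf.countable

theorem countable_ideal (R : Type*) [CommRing R] [IsNoetherianRing R] [Countable R] :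
    Countable (Ideal R) := by
  refine Function.Surjective.countable (f := fun s : Finset R => Ideal.span (s : Set R)) ?_
  intro I
  exact IsNoetherian.noetherian I

/-- The image under `ι` of the kernel of a homomorphism out of `K`, as an ideal. -/
def kerIdeal (hι : ∀ r : R, ∃ (n : ℤ) (k : K), (n : R) + ι k = r) {F : Type} [NonUnitalRing F]
    (φ : K →ₙ+* F) : Ideal R where
  carrier := {r | ∃ k, φ k = 0 ∧ ι k = r}
  add_mem' := by
    rintro _ _ ⟨a, ha, rfl⟩ ⟨b, hb, rfl⟩
    exact ⟨a + b, by simp [ha, hb], map_add ι _ _⟩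
  zero_mem' := ⟨0, map_zero φ, map_zero ι⟩
  smul_mem' := by
    rintro c _ ⟨a, ha, rfl⟩
    obtain ⟨l, hl, hφ⟩ := exists_eq_mul hι c a
    exact ⟨l, hφ φ ha, hl⟩

theorem mem_kerIdeal (hinj : Function.Injective ι)
    (hι : ∀ r : R, ∃ (n : ℤ) (k : K), (n : R) + ι k = r) {F : Type} [NonUnitalRing F]
    (φ : K →ₙ+* F) (k : K) : ι k ∈ kerIdeal hι φ ↔ φ k = 0 := by
  constructor
  · rintro ⟨l, hl, h⟩
    rwa [← hinj h]
  · intro h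
    exact ⟨k, h, rfl⟩

/-- An additive subgroup is finite if its image under a homomorphism and its intersection
with the kernel are. -/
theorem finite_of_finite_image_of_finite_ker {G H : Type*} [AddCommGroup G] [AddCommGroup H]
    (f : G →+ H) (N : AddSubgroup G) (him : (f '' (N : Set G)).Finite)
    (hker : {x | x ∈ N ∧ f x = 0}.Finite) : (N : Set G).Finite := by
  refine Set.Finite.of_finite_fibers f him ?_
  rintro _ ⟨y, hy, rfl⟩
  refine (hker.image (fun z => z + y)).subset ?_
  rintro z ⟨hz, hzy⟩
  have hzy : f z = f y := hzy
  exact ⟨z - y, ⟨N.sub_mem hz hy, by simp [hzy]⟩, by simp⟩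

/-- In an abelian group of prime exponent, given countably many infinite sets and a nonzero
element `a`, some subgroup omits `a` but meets every translate `a - W i`. -/
theorem exists_addSubgroup_notMem {G : Type*} [AddCommGroup G] {p : ℕ} (hp : p.Prime)
    (hG : ∀ g : G, p • g = 0) {a : G} (ha : a ≠ 0) (W : ℕ → Set G) (hW : ∀ i, (W i).Infinite) :
    ∃ V : AddSubgroup G, a ∉ V ∧ ∀ i, ∃ w ∈ W i, a - w ∈ V := by
  have hfin : ∀ g : G, (AddSubgroup.zmultiples g : Set G).Finite := fun g =>
    finite_zmultiples.mpr
      (isOfFinAddOrder_iff_nsmul_eq_zero.mpr ⟨p, hp.pos, hG g⟩)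
  have hsup : ∀ (V : AddSubgroup G) (g : G), (V : Set G).Finite →
      ((V ⊔ AddSubgroup.zmultiples g : AddSubgroup G) : Set G).Finite := by
    intro V g hV
    rw [AddSubgroup.normal_add]
    exact hV.add (hfin g)
  have step : ∀ (i : ℕ) (V : {V : AddSubgroup G // (V : Set G).Finite ∧ a ∉ V}),
      ∃ V' : {V : AddSubgroup G // (V : Set G).Finite ∧ a ∉ V},
        V.1 ≤ V'.1 ∧ ∃ w ∈ W i, a - w ∈ V'.1 := by
    rintro i ⟨V, hV, haV⟩
    obtain ⟨w, hw, hwV⟩ := (hW i).exists_notMem_finite (hsup V a hV)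
    refine ⟨⟨V ⊔ AddSubgroup.zmultiples (a - w), hsup V _ hV, ?_⟩, le_sup_left, w, hw,
      AddSubgroup.mem_sup_right (AddSubgroup.mem_zmultiples _)⟩
    intro hmem
    obtain ⟨v, hv, _, ⟨k, rfl⟩, hk⟩ := AddSubgroup.mem_sup.mp hmem
    have hk : v + k • (a - w) = a := hk
    by_cases hpk : (p : ℤ) ∣ k
    · obtain ⟨m, rfl⟩ := hpk
      rw [mul_smul, natCast_zsmul, hG, add_zero] at hk
      exact haV (hk ▸ hv)
    · obtain ⟨s, t, hst⟩ : IsCoprime (p : ℤ) k :=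
        (Nat.prime_iff_prime_int.mp hp).coprime_iff_not_dvd.mpr hpk
      have hkw : k • w ∈ V ⊔ AddSubgroup.zmultiples a := by
        have : k • w = v + (k - 1) • a := by
          rw [smul_sub] at hk
          rw [sub_smul, one_smul]
          nth_rewrite 2 [← hk]
          abel
        rw [this]
        exact AddSubgroup.add_mem _ (AddSubgroup.mem_sup_left hv)
          (AddSubgroup.mem_sup_right ⟨k - 1, rfl⟩)
      refine hwV ?_
      have : w = t • (k • w) := by
        calc w = (s * p + t * k) • w := by rw [hst, one_smul]
          _ = t • (k • w) := by
            rw [add_smul, mul_smul, natCast_zsmul, hG, smul_zero, zero_add, mul_smul]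
      rw [this]
      exact AddSubgroup.zsmul_mem _ hkw t
  choose next hle hnext using step
  let V : ℕ → {V : AddSubgroup G // (V : Set G).Finite ∧ a ∉ V} := fun n =>
    Nat.rec ⟨⊥, by simp, by simpa using ha⟩ (fun i U => next i U) n
  have hmono : Monotone fun n => (V n).1 := monotone_nat_of_le_succ fun n => hle n (V n)
  refine ⟨⨆ n, (V n).1, ?_, fun i => ?_⟩
  · rw [AddSubgroup.mem_iSup_of_directed hmono.directed_le]
    rintro ⟨n, hn⟩
    exact (V n).2.2 hn
  · obtain ⟨w, hw, hwV⟩ := hnext i (V i)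
    exact ⟨w, hw, le_iSup (fun n => (V n).1) (i + 1) hwV⟩

/-- In a finitely generated, finitely separable commutative ring of prime characteristic, every
additive subgroup with zero multiplication is finite. -/
theorem finite_of_mul_eq_zero (hinj : Function.Injective ι)
    (hι : ∀ r : R, ∃ (n : ℤ) (k : K), (n : R) + ι k = r)
    (hsep : FinitelySeparable K) {p : ℕ} (hp : p.Prime)
    (hchar : ∀ c : K, p • c = 0) [Countable (Ideal R)] (N : AddSubgroup K)
    (hN : ∀ x ∈ N, ∀ y ∈ N, x * y = 0) : (N : Set K).Finite := by
  by_contra hinf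
  have hinf' : Infinite N := Set.infinite_coe_iff.mpr hinf
  let T := {I : Ideal R // {w : N | ι (w : K) ∈ I}.Infinite}
  have : Nonempty T := ⟨⟨⊤, by simpa using Set.infinite_univ⟩⟩
  obtain ⟨I, hI⟩ := exists_surjective_nat T
  obtain ⟨a, ha⟩ := exists_ne (0 : N)
  obtain ⟨V, haV, hV⟩ := exists_addSubgroup_notMem hp
    (fun g : N => Subtype.ext (by simpa using hchar g)) ha
    (fun i => {w : N | ι (w : K) ∈ (I i).1}) (fun i => (I i).2)
  let A : NonUnitalSubring K :=
    { V.map N.subtype with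
      mul_mem' := by
        rintro _ _ ⟨x, hx, rfl⟩ ⟨y, hy, rfl⟩
        exact ⟨0, V.zero_mem, (hN _ x.2 _ y.2).symm⟩ }
  have haA : (a : K) ∉ A := by
    rintro ⟨x, hx, hxa⟩
    exact haV (Subtype.ext hxa ▸ hx)
  obtain ⟨F, _, _, φ, hφ⟩ := hsep a A haA
  have hker : {w : N | ι (w : K) ∈ kerIdeal hι φ}.Infinite := by
    intro hfin
    have := finite_of_finite_image_of_finite_ker ((φ : K →+ F).comp N.subtype) ⊤
      (Set.toFinite _) (hfin.subset fun w hw => (mem_kerIdeal hinj hι φ _).mpr hw.2)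
    exact Set.infinite_univ this
  obtain ⟨i, hi⟩ := hI ⟨kerIdeal hι φ, hker⟩
  obtain ⟨w, hw, hwV⟩ := hV i
  simp only [hi, Set.mem_ofPred_eq, mem_kerIdeal hinj hι] at hw
  exact hφ ⟨a - w, ⟨a - w, hwV, by simp⟩, by simp [hw]⟩

theorem finite_span_singleton_of_isNilpotent (hinj : Function.Injective ι)
    (hι : ∀ r : R, ∃ (n : ℤ) (k : K), (n : R) + ι k = r)
    (hsep : FinitelySeparable K) {p : ℕ} (hp : p.Prime)
    (hchar : ∀ c : K, p • c = 0) [Countable (Ideal R)] {x : K}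
    (hx : IsNilpotent (ι x)) : (Ideal.span {ι x} : Set R).Finite := by
  set r : R := ι x
  obtain ⟨m, hm⟩ := hx
  suffices h : ∀ j k, m ≤ j + k + 1 →
      (Ideal.span {r ^ (k + 1)} : Set R).Finite by
    simpa using h m 0 (by omega)
  intro j
  induction j with
  | zero =>
    intro k hk
    rw [pow_eq_zero_of_le (by omega) hm]
    simp
  | succ j ih =>
    intro k hk
    have hfin := ih (k + 1) (by omega)
    refine finite_of_finite_image_of_finite_ker (AddMonoidHom.mulLeft r)
      (Ideal.span {r ^ (k + 1)}).toAddSubgroup (hfin.subset ?_) ?_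
    · rintro _ ⟨u, hu, rfl⟩
      obtain ⟨s, rfl⟩ := Ideal.mem_span_singleton'.mp hu
      exact Ideal.mem_span_singleton'.mpr ⟨s, by simp only [AddMonoidHom.coe_mulLeft]; ring⟩
    · let N : AddSubgroup K :=
        ((Ideal.span {r ^ (k + 1)}).toAddSubgroup ⊓ (AddMonoidHom.mulLeft r).ker).comap
          (ι : K →+ R)
      have hN : (N : Set K).Finite := by
        refine finite_of_mul_eq_zero hinj hι hsep hp hchar N ?_
        rintro u ⟨hu, -⟩ v ⟨-, hv⟩
        obtain ⟨s, hs⟩ := Ideal.mem_span_singleton'.mp hu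
        have hs : s * r ^ (k + 1) = ι u := hs
        have hv : r * ι v = 0 := hv
        apply hinj
        rw [map_mul, ← hs, pow_succ, mul_assoc, mul_assoc, hv, mul_zero, mul_zero,
          map_zero]
      refine (hN.image ι).subset ?_
      rintro u ⟨hu, hur⟩
      obtain ⟨y, rfl⟩ : ∃ y : K, ι y = u := by
        obtain ⟨s, rfl⟩ := Ideal.mem_span_singleton'.mp hu
        obtain ⟨l, hl, -⟩ := exists_eq_mul hι (s * r ^ k) x
        exact ⟨l, by rw [hl, pow_succ, mul_assoc]⟩
      exact ⟨y, ⟨hu, hur⟩, rfl⟩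

theorem finite_isNilpotent (hinj : Function.Injective ι)
    (hι : ∀ r : R, ∃ (n : ℤ) (k : K), (n : R) + ι k = r)
    (hsep : FinitelySeparable K) {p : ℕ} (hp : p.Prime)
    (hchar : ∀ c : K, p • c = 0) [Countable (Ideal R)] [IsNoetherianRing R] :
    {x : K | IsNilpotent (ι x)}.Finite := by
  let J : Ideal R := nilradical R ⊓ kerIdeal hι (0 : K →ₙ+* ℤ)
  have hJ : J ≤ J → (J : Set R).Finite := by
    refine Submodule.fg_induction (motive := fun N _ => N ≤ J → (N : Set R).Finite) ?_ ?_ J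
      (IsNoetherian.noetherian J)
    · intro u hu
      obtain ⟨hu, x, -, rfl⟩ := hu (Submodule.mem_span_singleton_self u)
      exact finite_span_singleton_of_isNilpotent hinj hι hsep hp hchar (mem_nilradical.mp hu)
    · intro N₁ N₂ _ _ h₁ h₂ h
      rw [Submodule.coe_sup]
      exact (h₁ (le_sup_left.trans h)).add (h₂ (le_sup_right.trans h))
  refine Set.Finite.of_finite_image ((hJ le_rfl).subset ?_) hinj.injOn
  rintro _ ⟨x, hx, rfl⟩
  exact ⟨mem_nilradical.mpr hx, x, rfl, rfl⟩

/-- Some homomorphism onto a finite ring kills no nonzero element of a given finite set. -/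
theorem exists_surjective_forall_ne_zero (hsep : FinitelySeparable K) {s : Set K}
    (hs : s.Finite) : ∃ (F : Type) (_ : NonUnitalRing F) (_ : Finite F) (φ : K →ₙ+* F),
      Function.Surjective φ ∧ ∀ x ∈ s, x ≠ 0 → φ x ≠ 0 := by
  have : Finite {x // x ∈ s ∧ x ≠ 0} := hs.subset fun x hx => hx.1
  obtain ⟨n, ⟨e⟩⟩ := Finite.exists_equiv_fin {x // x ∈ s ∧ x ≠ 0}
  have key : ∀ i : Fin n, ∃ (F : Type) (_ : NonUnitalRing F) (_ : Finite F) (φ : K →ₙ+* F),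
      φ (e.symm i) ≠ 0 := by
    intro i
    obtain ⟨F, h₁, h₂, φ, hφ⟩ := hsep (e.symm i) ⊥
      (fun h => (e.symm i).2.2 (NonUnitalSubring.mem_bot.mp h))
    exact ⟨F, h₁, h₂, φ, fun h => hφ ⟨0, NonUnitalSubring.zero_mem _, by rw [h, map_zero]⟩⟩
  choose F h₁ h₂ φ hφ using key
  let Φ : K →ₙ+* ∀ i, F i :=
    { toFun := fun x i => φ i x
      map_zero' := by ext; simp
      map_add' := by intros; ext; simp
      map_mul' := by intros; ext; simp }
  refine ⟨Φ.range, inferInstance, inferInstance, Φ.rangeRestrict, Φ.rangeRestrict_surjective, ?_⟩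
  intro x hx hx0 h
  have h0 : φ (e ⟨x, hx, hx0⟩) x = 0 := congrFun (congrArg Subtype.val h) _
  exact hφ (e ⟨x, hx, hx0⟩) (by simpa using h0)

/-- The image of `K` in the quotient of a commutative ring by a prime ideal is, up to isomorphism, a
ring in `Type` without zero divisors. -/
theorem exists_surjective_of_isPrime [Countable K] (ι : K →ₙ+* R) (P : Ideal R) [P.IsPrime] :
    ∃ (D : Type) (_ : NonUnitalRing D) (φ : K →ₙ+* D),
      (∀ x y : D, x ≠ 0 → y ≠ 0 → x * y ≠ 0) ∧ Function.Surjective φ ∧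
      ∀ x, φ x = 0 → ι x ∈ P := by
  let ψ : K →ₙ+* R ⧸ P := NonUnitalRingHom.comp (Ideal.Quotient.mk P : R →ₙ+* R ⧸ P) ι
  have : Countable ψ.range := ψ.rangeRestrict_surjective.countable
  have : Small.{0} ψ.range := inferInstance
  let e : Shrink.{0} ψ.range ≃+* ψ.range := Shrink.ringEquiv ψ.range
  refine ⟨Shrink.{0} ψ.range, inferInstance,
    NonUnitalRingHom.comp (e.symm : ψ.range →ₙ+* Shrink.{0} ψ.range) ψ.rangeRestrict, ?_,
    e.symm.surjective.comp ψ.rangeRestrict_surjective, ?_⟩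
  · intro x y hx hy hxy
    have h : ((e x : ψ.range) : R ⧸ P) * (e y : ψ.range) = 0 := by
      simpa using congrArg (fun z => ((e z : ψ.range) : R ⧸ P)) hxy
    rcases mul_eq_zero.mp h with h | h
    · exact hx (by simpa using h)
    · exact hy (by simpa using h)
  · intro x hx
    have h : e.symm (ψ.rangeRestrict x) = 0 := hx
    rw [map_eq_zero_iff _ e.symm.injective] at h
    exact Ideal.Quotient.eq_zero_iff_mem.mp (congrArg Subtype.val h)

end

end FinitelySeparable

/-- If a finitely generated commutative (not necessarily unital) ring `K` of
prime characteristic is finitely separable, then `K` is a subdirect product of a finite ring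
and a finite collection of rings without zero divisors. -/
theorem stmt8 {K : Type*} [NonUnitalCommRing K]
    (hfg : ∃ S : Finset K, NonUnitalSubring.closure (S : Set K) = ⊤)
    (p : ℕ) (hp : p.Prime) (hchar : ∀ c : K, p • c = 0)
    (hsep : FinitelySeparable K) :
    ∃ (F : Type) (_ : NonUnitalRing F) (_ : Finite F)
      (n : ℕ) (R : Fin n → Type) (_ : ∀ i, NonUnitalRing (R i)),
      (∀ i, ∀ x y : R i, x ≠ 0 → y ≠ 0 → x * y ≠ 0) ∧
      ∃ φ : K →ₙ+* F × (∀ i, R i),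
        Function.Injective φ ∧
        Function.Surjective (fun x => (φ x).1) ∧
        (∀ i, Function.Surjective (fun x => (φ x).2 i)) := by
  obtain ⟨S, hS⟩ := hfg
  obtain ⟨U, _, ι, hinj, hι⟩ := FinitelySeparable.exists_unitization K
  have := FinitelySeparable.finiteType_of_closure_eq_top hι hS
  have : IsNoetherianRing U := Algebra.FiniteType.isNoetherianRing ℤ _
  have : Countable U := FinitelySeparable.countable_of_finiteType_int _
  have := FinitelySeparable.countable_ideal U
  have : Countable K := hinj.countable
  obtain ⟨F, hF, hFfin, φ, hφ, hφ0⟩ := FinitelySeparable.exists_surjective_forall_ne_zero hsep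
    (FinitelySeparable.finite_isNilpotent hinj hι hsep hp hchar)
  have : Finite (minimalPrimes U) :=
    minimalPrimes.finite_of_isNoetherianRing U
  obtain ⟨n, ⟨e⟩⟩ := Finite.exists_equiv_fin (minimalPrimes U)
  have key := fun i : Fin n =>
    have : (e.symm i).1.IsPrime := (e.symm i).2.1.1
    FinitelySeparable.exists_surjective_of_isPrime ι (e.symm i).1
  choose R hR ψ hdom hsurj hker using key
  let Φ : K →ₙ+* F × (∀ i, R i) :=
    { toFun := fun x => (φ x, fun i => ψ i x)
      map_zero' := by ext <;> simp
      map_add' := by intros; ext <;> simp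
      map_mul' := by intros; ext <;> simp }
  refine ⟨F, hF, hFfin, n, R, hR, hdom, Φ, ?_, hφ, hsurj⟩
  rw [injective_iff_map_eq_zero]
  intro x hx
  by_contra hx0
  refine hφ0 x ?_ hx0 (congrArg Prod.fst hx)
  rw [Set.mem_ofPred_eq, ← mem_nilradical, nilradical, ← Ideal.sInf_minimalPrimes, Ideal.mem_sInf]
  intro P hP
  have := hker (e ⟨P, hP⟩) x (congrFun (congrArg Prod.snd hx) _)
  simpa using this
end
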